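/- Fix constants 0 < w < u₀ < u₁ < v < x₀ < x₁ with x₀ > v. Then, as q → ∞, ∑_{n=1}^∞ (∑_{d|n} ψ_d)² · n^{−1} · j(n) = (1 + O(L^{−1} log L)) · (x₁ + x₀ − u₁ − v)/(2(v − u₁)), with the implied constant depending only on the fixed exponents. -/

import Mathlib

open scoped Classical

/-- The sieve weights `ψ_d`: `μ(d)` for `d ≤ q^{u₁}`, `μ(d)·log(q^v/d)/log(q^v/q^{u₁})` for
`q^{u₁} ≤ d ≤ q^v`, and `0` for `d ≥ q^v`. -/
noncomputable def psiD (q : ℕ) (u₁ v : ℝ) (d : ℕ) : ℝ :=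
  if (d : ℝ) ≤ (q : ℝ) ^ u₁ then (ArithmeticFunction.moebius d : ℝ)
  else if (d : ℝ) ≤ (q : ℝ) ^ v then
    (ArithmeticFunction.moebius d : ℝ) * Real.log ((q : ℝ) ^ v / d) /
      Real.log ((q : ℝ) ^ v / (q : ℝ) ^ u₁)
  else 0

/-- The averaged weight
`j(n) = (∫_{x₀}^{x₁} ∫_{u₀}^{u₁} (e^{-n/q^x} - e^{-n(log q)²/q^u}) du dx)/((u₁-u₀)(x₁-x₀))`. -/
noncomputable def jWeight (q : ℕ) (u₀ u₁ x₀ x₁ : ℝ) (n : ℕ) : ℝ :=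
  (∫ x in x₀..x₁, ∫ u in u₀..u₁,
      (Real.exp (-(n : ℝ) / (q : ℝ) ^ x) -
        Real.exp (-(n : ℝ) * (Real.log q) ^ 2 / (q : ℝ) ^ u)))
    / ((u₁ - u₀) * (x₁ - x₀))

section
open Real (exp log)
open ArithmeticFunction (moebius)

section
noncomputable def zT (n : ℕ) (s : ℂ) : ℂ :=
  ((n + 1 : ℝ) : ℂ) ^ (1 - s) - ((n + 2 : ℝ) : ℂ) ^ (1 - s) - (s - 1) * ((n + 2 : ℝ) : ℂ) ^ (-s)

lemma hasDerivAt_rcpow (c : ℂ) {x : ℝ} (hx : 0 < x) :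
    HasDerivAt (fun y : ℝ => (y : ℂ) ^ c) (c * (x : ℂ) ^ (c - 1)) x := by
  have h := (hasDerivAt_id (x : ℂ)).cpow_const (c := c) (by simp [Complex.slitPlane, hx])
  simpa using h.comp_ofReal

lemma cpow_diff_bound {a b : ℝ} (ha : 0 < a) (hab : a ≤ b) {s : ℂ} (hs : 0 ≤ s.re) :
    ‖(b : ℂ) ^ (-s) - (a : ℂ) ^ (-s)‖ ≤ ‖s‖ * a ^ (-s.re - 1) * (b - a) := by
  have := norm_image_sub_le_of_norm_deriv_le_segment' (f := fun y : ℝ => (y : ℂ) ^ (-s))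
    (f' := fun x : ℝ => (-s) * (x : ℂ) ^ (-s - 1)) (a := a) (b := b)
    (C := ‖s‖ * a ^ (-s.re - 1))
    (fun x hx => (hasDerivAt_rcpow (-s) (lt_of_lt_of_le ha hx.1)).hasDerivWithinAt)
    (fun x hx => by
      have hx0 : 0 < x := lt_of_lt_of_le ha hx.1
      rw [norm_mul, norm_neg, Complex.norm_cpow_eq_rpow_re_of_pos hx0]
      simp only [Complex.sub_re, Complex.neg_re, Complex.one_re]
      gcongr ?_ * ?_
      exact Real.rpow_le_rpow_of_nonpos ha hx.1 (by linarith))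
  exact this b ⟨hab, le_rfl⟩

lemma zT_bound_aux (n : ℕ) {s : ℂ} {K : ℝ} 
    (hK : ∀ x : ℝ, (n + 1 : ℝ) ≤ x → x ≤ n + 2 →
      ‖(x : ℂ) ^ (-s) - ((n + 2 : ℝ) : ℂ) ^ (-s)‖ ≤ K) :
    ‖zT n s‖ ≤ ‖s - 1‖ * K := by
  have := norm_image_sub_le_of_norm_deriv_le_segment'
    (f := fun y : ℝ => (y : ℂ) ^ (1 - s) + (s - 1) * (y * ((n + 2 : ℝ) : ℂ) ^ (-s)))
    (f' := fun x : ℝ => (1 - s) * (x : ℂ) ^ (1 - s - 1) +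
      (s - 1) * (1 * ((n + 2 : ℝ) : ℂ) ^ (-s))) (a := n + 1) (b := n + 2)
    (C := ‖s - 1‖ * K)
    (fun x hx => by
      have h1 := hasDerivAt_rcpow (1 - s) (lt_of_lt_of_le (by positivity) hx.1)
      have h2 : HasDerivAt (fun y : ℝ => (y : ℂ)) 1 x := (hasDerivAt_id (x : ℂ)).comp_ofReal
      exact (h1.add ((h2.mul_const _).const_mul (s - 1))).hasDerivWithinAt)
    (fun x hx => by
      have : (1 - s) * (x : ℂ) ^ (1 - s - 1) + (s - 1) * (1 * ((n + 2 : ℝ) : ℂ) ^ (-s)) =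
        -((s - 1) * ((x : ℂ) ^ (-s) - ((n + 2 : ℝ) : ℂ) ^ (-s))) := by
        rw [show 1 - s - 1 = -s by ring]; ring
      rw [this, norm_neg, norm_mul]
      gcongr
      exact hK x hx.1 hx.2.le)
  have h := this (n + 2) ⟨by linarith, le_rfl⟩
  have e : zT n s = -(((n + 2 : ℝ) : ℂ) ^ (1 - s) + (s - 1) * ((n + 2 : ℝ) * ((n + 2 : ℝ) : ℂ) ^ (-s)) -
    (((n + 1 : ℝ) : ℂ) ^ (1 - s) + (s - 1) * ((n + 1 : ℝ) * ((n + 2 : ℝ) : ℂ) ^ (-s)))) := by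
    unfold zT; push_cast; ring
  rw [e, norm_neg]
  refine h.trans (le_of_eq (by ring))

lemma zT_bound (n : ℕ) {s : ℂ} (hs : 0 ≤ s.re) {ε : ℝ} (h0 : 0 ≤ ε) (h1 : ε ≤ 1) :
    ‖zT n s‖ ≤ ‖s - 1‖ * (2 * ‖s‖ ^ ε * (n + 1 : ℝ) ^ (-s.re - ε)) := by
  have hn : (0 : ℝ) < n + 1 := by positivity
  apply zT_bound_aux
  intro x hx1 hx2
  have hx : 0 < x := by linarith
  set N : ℝ := n + 1
  set D := ‖(x : ℂ) ^ (-s) - ((n + 2 : ℝ) : ℂ) ^ (-s)‖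
  have hD1 : D ≤ 2 * N ^ (-s.re) := by
    refine (norm_sub_le _ _).trans ?_
    rw [Complex.norm_cpow_eq_rpow_re_of_pos hx, Complex.norm_cpow_eq_rpow_re_of_pos (by positivity)]
    have a1 : x ^ (-s).re ≤ N ^ (-s.re) := Real.rpow_le_rpow_of_nonpos hn hx1 (by simpa using hs)
    have a2 : (n + 2 : ℝ) ^ (-s).re ≤ N ^ (-s.re) :=
      Real.rpow_le_rpow_of_nonpos hn (by simp only [N]; linarith) (by simpa using hs)
    linarith
  have hD2 : D ≤ 2 * N ^ (-s.re) * (‖s‖ / N) := by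
    have := cpow_diff_bound hx hx2 hs
    rw [norm_sub_rev] at this
    refine this.trans ?_
    have a1 : x ^ (-s.re - 1) ≤ N ^ (-s.re - 1) := Real.rpow_le_rpow_of_nonpos hn hx1 (by linarith)
    calc ‖s‖ * x ^ (-s.re - 1) * (n + 2 - x) ≤ ‖s‖ * N ^ (-s.re - 1) * 2 := by
          gcongr; simp only [N] at *; linarith
      _ = _ := by rw [Real.rpow_sub_one hn.ne']; ring
  have hA : 0 ≤ 2 * N ^ (-s.re) := by positivity
  have key : D ≤ 2 * N ^ (-s.re) * (‖s‖ / N) ^ ε := by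
    by_cases h : ‖s‖ / N ≤ 1
    · refine hD2.trans (mul_le_mul_of_nonneg_left ?_ hA)
      rcases (show (0:ℝ) ≤ ‖s‖ / N by positivity).eq_or_lt with h' | h'
      · rw [← h']; positivity
      · simpa using Real.rpow_le_rpow_of_exponent_ge h' h h1
    · refine hD1.trans (le_mul_of_one_le_right hA ?_)
      exact Real.one_le_rpow (by linarith) h0
  refine key.trans (le_of_eq ?_)
  rw [Real.div_rpow (norm_nonneg _) hn.le, Real.rpow_sub hn]; ring

lemma summable_zT_bound {a : ℝ} (ha : 1 < a) : Summable (fun n : ℕ => (n + 1 : ℝ) ^ (-a)) := by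
  have := (summable_nat_add_iff 1).mpr (Real.summable_nat_rpow.mpr (show -a < -1 by linarith))
  simpa using this

lemma zeta1_eq_of_one_lt {s : ℂ} (hs : 1 < s.re) :
    riemannZeta₁ s = s - ∑' n, zT n s := by
  have hs1 : s ≠ 1 := by rintro rfl; simp at hs
  have hz : riemannZeta₁ s = (s - 1) * riemannZeta s := by
    rw [riemannZeta_eq_inv_sub_mul hs1]; field_simp [sub_ne_zero.mpr hs1]
  have hsz : Summable (fun n => zT n s) := by
    refine Summable.of_norm_bounded (g := fun n : ℕ => ‖s - 1‖ * (2 * ‖s‖ ^ (0:ℝ) * (n + 1 : ℝ) ^ (-s.re - 0)))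
      ?_ (fun n => zT_bound n (by linarith) le_rfl zero_le_one)
    refine Summable.mul_left _ (Summable.mul_left _ ?_)
    simpa using summable_zT_bound hs
  have ht : Filter.Tendsto (fun n : ℕ => ((n + 1 : ℝ) : ℂ) ^ (1 - s)) Filter.atTop (nhds 0) := by
    rw [tendsto_zero_iff_norm_tendsto_zero]
    have : ∀ n : ℕ, ‖((n + 1 : ℝ) : ℂ) ^ (1 - s)‖ = (n + 1 : ℝ) ^ (-(s.re - 1)) := by
      intro n
      rw [Complex.norm_cpow_eq_rpow_re_of_pos (by positivity)]; simp
    simp_rw [this]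
    exact (tendsto_rpow_neg_atTop (by linarith)).comp
      (Filter.tendsto_atTop_add_const_right _ _ tendsto_natCast_atTop_atTop)
  have hsum1 : Summable (fun n : ℕ => 1 / ((n : ℂ) + 1) ^ s) := by
    have := (summable_nat_add_iff 1).mpr (Complex.summable_one_div_nat_cpow.mpr hs)
    simpa using this
  have hsum2 : Summable (fun n : ℕ => ((n + 2 : ℝ) : ℂ) ^ (-s)) := by
    have := (summable_nat_add_iff 1).mpr hsum1
    refine this.congr (fun n => ?_)
    rw [Complex.cpow_neg, one_div]; push_cast; ring_nf
  have hze : riemannZeta s = 1 + ∑' n : ℕ, ((n + 2 : ℝ) : ℂ) ^ (-s) := by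
    rw [zeta_eq_tsum_one_div_nat_add_one_cpow hs, hsum1.tsum_eq_zero_add]
    congr 1
    · simp
    · refine tsum_congr (fun n => ?_)
      rw [Complex.cpow_neg, one_div]; push_cast; ring_nf
  have hg := (hsz.add (hsum2.mul_left (s - 1))).hasSum.tendsto_sum_nat
  have hp : ∀ N : ℕ, ∑ n ∈ Finset.range N, (zT n s + (s - 1) * ((n + 2 : ℝ) : ℂ) ^ (-s)) =
      1 - ((N + 1 : ℝ) : ℂ) ^ (1 - s) := by
    intro N
    induction N with
    | zero => simp
    | succ N ih =>
      rw [Finset.sum_range_succ, ih]; unfold zT; push_cast; ring_nf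
  have hl := tendsto_nhds_unique hg (by
    simp_rw [hp]
    exact (tendsto_const_nhds.sub ht))
  rw [hsz.tsum_add (hsum2.mul_left _), tsum_mul_left] at hl
  rw [hz, hze]
  linear_combination hl

lemma zeta1_eq {ε : ℝ} (h0 : 0 < ε) (h1 : ε ≤ 1) {s : ℂ} (hs : 1 - ε / 2 < s.re) :
    riemannZeta₁ s = s - ∑' n, zT n s := by
  let U : Set ℂ := {z | 1 - ε / 2 < z.re}
  have hUo : IsOpen U := isOpen_lt continuous_const Complex.continuous_re
  have hUc : Convex ℝ U := convex_halfSpace_re_gt _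
  have hd : DifferentiableOn ℂ (fun w => ∑' n, zT n w) U := by
    intro z hz
    let W : Set ℂ := U ∩ Metric.ball z 1
    have hWo : IsOpen W := hUo.inter Metric.isOpen_ball
    have : DifferentiableOn ℂ (fun w => ∑' n, zT n w) W := by
      refine Complex.differentiableOn_tsum_of_summable_norm
        (u := fun n : ℕ => (‖z‖ + 2) * (2 * (‖z‖ + 1) ^ ε * (n + 1 : ℝ) ^ (-(1 + ε / 2)))) ?_ ?_ hWo ?_
      · exact ((summable_zT_bound (by linarith)).mul_left _).mul_left _
      · intro n w hw
        unfold zT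
        have e1 : ((n + 1 : ℝ) : ℂ) ≠ 0 := by norm_cast
        have e2 : ((n + 2 : ℝ) : ℂ) ≠ 0 := by norm_cast
        refine DifferentiableAt.differentiableWithinAt ?_
        refine ((DifferentiableAt.const_cpow (by fun_prop) (Or.inl e1)).sub
          (DifferentiableAt.const_cpow (by fun_prop) (Or.inl e2))).sub
          (DifferentiableAt.mul (by fun_prop) (DifferentiableAt.const_cpow (by fun_prop) (Or.inl e2)))
      · intro n w hw
        have hwU : 1 - ε / 2 < w.re := hw.1
        have hwn : ‖w‖ ≤ ‖z‖ + 1 := by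
          have := hw.2; rw [Metric.mem_ball, dist_eq_norm] at this
          have := norm_le_norm_add_norm_sub' w z
          linarith
        refine (zT_bound n (by linarith) h0.le h1).trans ?_
        have hw1 : ‖w - 1‖ ≤ ‖z‖ + 2 := (norm_sub_le _ _).trans (by simp; linarith)
        gcongr
        · linarith
        · linarith
    exact ((this z ⟨hz, by simp⟩).differentiableAt (hWo.mem_nhds ⟨hz, by simp⟩)).differentiableWithinAt
  have hA : AnalyticOnNhd ℂ riemannZeta₁ U :=
    differentiable_riemannZeta₁.differentiableOn.analyticOnNhd hUo
  have hB : AnalyticOnNhd ℂ (fun w => w - ∑' n, zT n w) U :=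
    (differentiableOn_id.sub hd).analyticOnNhd hUo
  refine hA.eqOn_of_preconnected_of_eventuallyEq hB hUc.isPreconnected (z₀ := 2)
    (show 1 - ε / 2 < (2:ℂ).re by simp; linarith) ?_ hs
  have : {z : ℂ | 1 < z.re} ∈ nhds (2 : ℂ) :=
    (isOpen_lt continuous_const Complex.continuous_re).mem_nhds (by simp)
  filter_upwards [this] with z hz using zeta1_eq_of_one_lt hz

lemma zeta1_bound {ε : ℝ} (h0 : 0 < ε) (h1 : ε ≤ 1) : ∃ C : ℝ, 0 < C ∧ ∀ s : ℂ,
    1 - ε / 2 < s.re → s.re ≤ 3 → ‖riemannZeta₁ s‖ ≤ C * (1 + |s.im|) ^ (1 + ε) := by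
  set S0 := ∑' n : ℕ, (n + 1 : ℝ) ^ (-(1 + ε / 2)) with hS
  have hS0 : 0 ≤ S0 := tsum_nonneg (fun n => by positivity)
  refine ⟨4 + 4 * (2 * 4 * S0), by positivity, fun s hs hs3 => ?_⟩
  rw [zeta1_eq h0 h1 hs]
  set T := 1 + |s.im|
  have hT : 1 ≤ T := by simp [T]
  have hsn : ‖s‖ ≤ 4 * T := by
    refine (Complex.norm_le_abs_re_add_abs_im s).trans ?_
    rw [abs_of_nonneg (by linarith)]; simp only [T]; linarith [abs_nonneg s.im]
  have hs1n : ‖s - 1‖ ≤ 4 * T := by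
    refine (Complex.norm_le_abs_re_add_abs_im _).trans ?_
    have : |(s - 1).re| ≤ 2 := by rw [abs_le]; constructor <;> simp <;> linarith
    simp only [T, Complex.sub_im, Complex.one_im, sub_zero]; linarith [abs_nonneg s.im]
  have hTe : T ≤ T ^ (1 + ε) := by
    conv_lhs => rw [← Real.rpow_one T]
    exact Real.rpow_le_rpow_of_exponent_le hT (by linarith)
  have hb : ‖∑' n, zT n s‖ ≤ 4 * T * (2 * (4 * T ^ ε) * S0) := by
    have hsm := (((summable_zT_bound (show 1 < 1 + ε / 2 by linarith)).mul_left (2 * (4 * T ^ ε))).mul_left (4 * T))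
    have := tsum_of_norm_bounded (f := fun n => zT n s) hsm.hasSum (fun n => by
      refine (zT_bound n (by linarith) h0.le h1).trans ?_
      gcongr
      · calc ‖s‖ ^ ε ≤ (4 * T) ^ ε := by gcongr
          _ = 4 ^ ε * T ^ ε := Real.mul_rpow (by norm_num) (by linarith)
          _ ≤ 4 * T ^ ε := by
            gcongr
            calc (4:ℝ) ^ ε ≤ 4 ^ (1:ℝ) := Real.rpow_le_rpow_of_exponent_le (by norm_num) h1
              _ = 4 := by norm_num
      · linarith
      · linarith)
    refine this.trans (le_of_eq ?_)
    rw [tsum_mul_left, tsum_mul_left]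
  have hTT : T * T ^ ε = T ^ (1 + ε) := by rw [Real.rpow_add (by linarith), Real.rpow_one]
  calc ‖s - ∑' n, zT n s‖ ≤ ‖s‖ + ‖∑' n, zT n s‖ := norm_sub_le _ _
    _ ≤ 4 * T ^ (1 + ε) + 4 * T * (2 * (4 * T ^ ε) * S0) := by linarith
    _ = _ := by rw [← hTT]; ring

end

section
lemma zeta1_deriv_bound {ε : ℝ} (h0 : 0 < ε) (h1 : ε ≤ 1) : ∃ C : ℝ, 0 < C ∧ ∀ s : ℂ,
    1 - ε / 8 ≤ s.re → s.re ≤ 5/2 → ‖deriv riemannZeta₁ s‖ ≤ C * (1 + |s.im|) ^ (1 + ε) := by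
  obtain ⟨C, hC, hb⟩ := zeta1_bound h0 h1
  refine ⟨C * 4 / (ε / 8), by positivity, fun s hs hs2 => ?_⟩
  have := Complex.norm_deriv_le_of_forall_mem_sphere_norm_le (f := riemannZeta₁) (c := s)
    (R := ε / 8) (C := C * (4 * (1 + |s.im|) ^ (1 + ε))) (by positivity)
    differentiable_riemannZeta₁.diffContOnCl (fun z hz => by
      have hzs : ‖z - s‖ = ε / 8 := by simpa [dist_eq_norm] using hz
      have hre := Complex.abs_re_le_norm (z - s)
      have him := Complex.abs_im_le_norm (z - s)
      rw [hzs, Complex.sub_re, abs_le] at hre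
      rw [hzs, Complex.sub_im, abs_le] at him
      refine (hb z (by linarith) (by linarith)).trans ?_
      gcongr
      have hi : |z.im| ≤ |s.im| + 1 := by
        have := abs_sub_abs_le_abs_sub z.im s.im
        have h3 : |z.im - s.im| ≤ 1 := by rw [abs_le]; constructor <;> linarith
        linarith
      calc (1 + |z.im|) ^ (1 + ε) ≤ (2 * (1 + |s.im|)) ^ (1 + ε) := by
            gcongr; linarith [abs_nonneg s.im]
        _ = 2 ^ (1 + ε) * (1 + |s.im|) ^ (1 + ε) := Real.mul_rpow (by norm_num) (by positivity)
        _ ≤ 4 * (1 + |s.im|) ^ (1 + ε) := by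
          gcongr
          calc (2:ℝ) ^ (1 + ε) ≤ 2 ^ (2:ℝ) := Real.rpow_le_rpow_of_exponent_le (by norm_num) (by linarith)
            _ = 4 := by norm_num)
  refine this.trans (le_of_eq ?_)
  ring

lemma zeta1_mul {s : ℂ} (hs1 : s ≠ 1) : riemannZeta₁ s = (s - 1) * riemannZeta s := by
  rw [riemannZeta_eq_inv_sub_mul hs1]; field_simp [sub_ne_zero.mpr hs1]

lemma zeta1_ne_zero {s : ℂ} (hs : 1 ≤ s.re) : riemannZeta₁ s ≠ 0 := by
  by_cases h : s = 1
  · subst h; simp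
  · rw [zeta1_mul h]
    exact mul_ne_zero (sub_ne_zero.mpr h) (riemannZeta_ne_zero_of_one_le_re hs)

lemma zeta_341 {x : ℝ} (hx : 0 < x) (y : ℝ) :
    1 ≤ ‖riemannZeta (1 + x)‖ ^ 3 * ‖riemannZeta (1 + x + y * Complex.I)‖ ^ 4 *
      ‖riemannZeta (1 + x + (2 * y : ℝ) * Complex.I)‖ := by
  have := DirichletCharacter.norm_LFunction_product_ge_one (1 : DirichletCharacter ℂ 1) hx y
  rw [DirichletCharacter.LFunctionTrivChar, DirichletCharacter.LFunction_modOne_eq, norm_mul, norm_mul, norm_pow, norm_pow,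
    DirichletCharacter.LFunction_modOne_eq] at this
  convert this using 4
  · congr 2; ring
  · push_cast; ring

lemma zeta1_lower_off {ε : ℝ} (h0 : 0 < ε) (h1 : ε ≤ 1) : ∃ c : ℝ, 0 < c ∧ ∀ x t : ℝ,
    0 < x → x ≤ 1 → 1 ≤ |t| →
    c ^ 4 * x ^ 3 * (1 + |t|) ^ (4 - ε) ≤ ‖riemannZeta₁ (1 + x + t * Complex.I)‖ ^ 4 := by
  obtain ⟨C, hC, hb⟩ := zeta1_bound h0 h1
  have hc4 : 0 < 1 / (64 * C ^ 4) := by positivity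
  refine ⟨(1 / (64 * C ^ 4)) ^ (1 / 4 : ℝ), by positivity, fun x t hx hx1 ht => ?_⟩
  have e4 : ((1 / (64 * C ^ 4)) ^ (1 / 4 : ℝ)) ^ 4 = 1 / (64 * C ^ 4) := by
    rw [← Real.rpow_natCast, ← Real.rpow_mul hc4.le]; norm_num
  rw [e4]
  set T := 1 + |t|
  have hT : 2 ≤ T := by simp only [T]; linarith
  have h341 := zeta_341 hx t
  have z1 : riemannZeta (1 + x) = riemannZeta₁ (1 + x) / x := by
    have : (x:ℂ) ≠ 0 := by exact_mod_cast hx.ne'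
    rw [zeta1_mul (by simpa using this)]; field_simp; simp [mul_comm]
  have z2 : ∀ y : ℝ, riemannZeta (1 + x + y * Complex.I) = riemannZeta₁ (1 + x + y * Complex.I) / (x + y * Complex.I) := by
    intro y
    have : (x + y * Complex.I:ℂ) ≠ 0 := by
      intro h; have := congrArg Complex.re h; simp at this; linarith
    rw [zeta1_mul (by rw [add_assoc]; simpa using this)]; field_simp; ring
  rw [z1, z2, z2, norm_div, norm_div, norm_div] at h341
  set A := ‖riemannZeta₁ (1 + x + t * Complex.I)‖ 
  have n1 : ‖(x:ℂ)‖ = x := by simp [abs_of_pos hx]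
  have b1 : ‖riemannZeta₁ (1 + x)‖ ≤ C := by
    have := hb (1 + x) (by simp; linarith) (by simp; linarith)
    simpa using this
  have b2 : ‖riemannZeta₁ (1 + x + (2 * t : ℝ) * Complex.I)‖ ≤ C * (4 * T ^ (1 + ε)) := by
    refine (hb _ (by simp; linarith) (by simp; linarith)).trans ?_
    gcongr
    simp only [Complex.add_im, Complex.one_im, Complex.ofReal_im, Complex.mul_im, Complex.ofReal_re, Complex.I_im, Complex.I_re]
    have hh : |0 + 0 + (2 * t * 1 + 0 * 0)| = 2 * |t| := by rw [show 0 + 0 + (2 * t * 1 + 0 * 0) = 2 * t by ring, abs_mul]; norm_num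
    rw [hh]
    calc (1 + 2 * |t|) ^ (1 + ε) ≤ (2 * T) ^ (1 + ε) := by
          gcongr; simp only [T]; linarith
      _ = 2 ^ (1 + ε) * T ^ (1 + ε) := Real.mul_rpow (by norm_num) (by positivity)
      _ ≤ 4 * T ^ (1 + ε) := by
          gcongr
          calc (2:ℝ) ^ (1 + ε) ≤ 2 ^ (2:ℝ) := Real.rpow_le_rpow_of_exponent_le (by norm_num) (by linarith)
            _ = 4 := by norm_num
  have l1 : ∀ y : ℝ, |y| ≤ ‖(x + y * Complex.I:ℂ)‖ := by
    intro y; simpa using Complex.abs_im_le_norm (x + y * Complex.I:ℂ)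
  have l2 : T / 2 ≤ ‖(x + t * Complex.I:ℂ)‖ := le_trans (by simp only [T]; linarith) (l1 t)
  have l3 : T ≤ ‖(x + (2 * t : ℝ) * Complex.I:ℂ)‖ := by
    refine le_trans ?_ (l1 _)
    rw [abs_mul]; simp only [T]; norm_num; linarith
  have h2 : 1 ≤ (C / x) ^ 3 * (A / (T / 2)) ^ 4 * (C * (4 * T ^ (1 + ε)) / T) := by
    refine h341.trans ?_
    rw [n1]
    gcongr
  have hT0 : 0 < T := by linarith
  have : T ^ (4 - ε) * T ^ (1 + ε) = T ^ 5 := by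
    rw [← Real.rpow_add hT0, ← Real.rpow_natCast]; norm_num
  have hP : 0 < T ^ (1 + ε) := by positivity
  have h3 : x ^ 3 * T ^ 5 ≤ 64 * C ^ 4 * T ^ (1 + ε) * A ^ 4 := by
    have : (C / x) ^ 3 * (A / (T / 2)) ^ 4 * (C * (4 * T ^ (1 + ε)) / T) = 64 * C ^ 4 * T ^ (1 + ε) * A ^ 4 / (x ^ 3 * T ^ 5) := by
      field_simp; ring
    rw [this, le_div_iff₀ (by positivity)] at h2
    linarith
  rw [← this] at h3
  rw [show 1 / (64 * C ^ 4) * x ^ 3 * T ^ (4 - ε) = (x ^ 3 * (T ^ (4 - ε))) / (64 * C ^ 4) by ring, div_le_iff₀ (by positivity)]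
  refine le_of_mul_le_mul_right ?_ hP
  linarith

lemma zeta1_re_mvt {K : ℝ} {z w : ℂ} 
    (hK : ∀ s ∈ segment ℝ z w, ‖deriv riemannZeta₁ s‖ ≤ K) :
    ‖riemannZeta₁ w - riemannZeta₁ z‖ ≤ K * ‖w - z‖ :=
  (convex_segment z w).norm_image_sub_le_of_norm_deriv_le
    (fun x _ => differentiable_riemannZeta₁ x) hK (left_mem_segment ℝ z w) (right_mem_segment ℝ z w)

lemma zeta1_lower {ε : ℝ} (h0 : 0 < ε) (h1 : ε ≤ 1 / 7) : ∃ c : ℝ, 0 < c ∧ ∀ s : ℂ,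
    1 ≤ s.re → s.re ≤ 2 → c * (1 + |s.im|) ^ (1 - 7 * ε) ≤ ‖riemannZeta₁ s‖ := by
  obtain ⟨C, hC, hd⟩ := zeta1_deriv_bound h0 (by linarith)
  obtain ⟨c, hc, hl⟩ := zeta1_lower_off h0 (by linarith)
  have hcomp : IsCompact ((Set.Icc (1:ℝ) 2) ×ℂ (Set.Icc (-1:ℝ) 1)) := isCompact_Icc.reProdIm isCompact_Icc
  obtain ⟨m, hm, hmb⟩ : ∃ m : ℝ, 0 < m ∧ ∀ s ∈ ((Set.Icc (1:ℝ) 2) ×ℂ (Set.Icc (-1:ℝ) 1)), m ≤ ‖riemannZeta₁ s‖ := by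
    obtain ⟨s0, hs0, hmin⟩ := hcomp.exists_isMinOn ⟨1, by simp [Complex.mem_reProdIm]⟩
      (differentiable_riemannZeta₁.continuous.norm.continuousOn)
    refine ⟨‖riemannZeta₁ s0‖, norm_pos_iff.mpr (zeta1_ne_zero ?_), fun s hs => hmin hs⟩
    exact (Complex.mem_reProdIm.mp hs0).1.1
  set a := min 1 (c / (2 * C))
  have ha : 0 < a := by positivity
  have ha1 : a ≤ 1 := min_le_left _ _
  have ha2 : C * a ≤ c / 2 := by
    have : a ≤ c / (2 * C) := min_le_right _ _
    calc C * a ≤ C * (c / (2 * C)) := by gcongr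
      _ = c / 2 := by field_simp
  refine ⟨min (m / 2) (c * a ^ 3 / 2), by positivity, fun s hs1 hs2 => ?_⟩
  set T := 1 + |s.im|
  have hT1 : 1 ≤ T := by simp [T]
  have hT0 : 0 < T := by linarith
  by_cases ht : |s.im| ≤ 1
  · have h2 := hmb s (by rw [Complex.mem_reProdIm]; exact ⟨⟨hs1, hs2⟩, abs_le.mp ht⟩)
    refine le_trans ?_ h2
    calc _ ≤ m / 2 * T ^ (1:ℝ) := by
          gcongr
          · exact min_le_left _ _
          · linarith
      _ ≤ m / 2 * 2 := by gcongr; simp only [T, Real.rpow_one]; linarith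
      _ = m := by ring
  push Not at ht
  refine le_trans (mul_le_mul_of_nonneg_right (min_le_right _ _) (by positivity)) ?_
  set η := a ^ 4 * T ^ (-(8 * ε))
  have hη : 0 < η := by positivity
  have hη1 : η ≤ 1 := by
    have : T ^ (-(8 * ε)) ≤ 1 := Real.rpow_le_one_of_one_le_of_nonpos hT1 (by linarith)
    have : a ^ 4 ≤ 1 := pow_le_one₀ ha.le ha1
    calc η ≤ 1 * 1 := by simp only [η]; gcongr
      _ = 1 := by ring
  have off : ∀ x : ℝ, η ≤ x → x ≤ 1 → c * a ^ 3 * T ^ (1 - 7 * ε) ≤ ‖riemannZeta₁ (1 + x + s.im * Complex.I)‖ := by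
    intro x hx hx1
    have := hl x s.im (by linarith) hx1 ht.le
    refine le_of_pow_le_pow_left₀ (n := 4) (by norm_num) (norm_nonneg _) (le_trans ?_ this)
    calc (c * a ^ 3 * T ^ (1 - 7 * ε)) ^ 4 = c ^ 4 * (a ^ 4) ^ 3 * (T ^ (1 - 7 * ε)) ^ 4 := by ring
      _ = c ^ 4 * (a ^ 4) ^ 3 * T ^ (4 - 28 * ε) := by
        rw [← Real.rpow_natCast (T ^ _), ← Real.rpow_mul hT0.le]; congr 2; push_cast; ring
      _ ≤ c ^ 4 * (a ^ 4) ^ 3 * T ^ ((-(8 * ε)) * (3:ℕ) + (4 - ε)) := by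
        gcongr
        push_cast; linarith
      _ = c ^ 4 * η ^ 3 * T ^ (4 - ε) := by
        rw [Real.rpow_add hT0, Real.rpow_mul hT0.le, Real.rpow_natCast]; ring
      _ ≤ c ^ 4 * x ^ 3 * T ^ (4 - ε) := by gcongr
  have es : s = 1 + (s.re - 1 : ℝ) + s.im * Complex.I := by
    apply Complex.ext <;> simp
  by_cases hx : η ≤ s.re - 1
  · have := off (s.re - 1) hx (by linarith)
    rw [← es] at this
    refine le_trans ?_ this
    gcongr
    have : 0 < c * a ^ 3 := by positivity
    linarith
  push Not at hx
  set w : ℂ := 1 + (η : ℝ) + s.im * Complex.I with hw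
  have hseg : ∀ z ∈ segment ℝ s w, ‖deriv riemannZeta₁ z‖ ≤ C * T ^ (1 + ε) := by
    rintro z ⟨α, β, hα, hβ, hab, rfl⟩
    have hre : (α • s + β • w).re = α * s.re + β * (1 + η) := by simp [hw]; ring
    have him : (α • s + β • w).im = s.im := by
      simp [hw, ← add_mul, hab]
    have := hd (α • s + β • w) (by rw [hre]; nlinarith) (by rw [hre]; nlinarith)
    rwa [him] at this
  have hmv := zeta1_re_mvt hseg
  have hwn : ‖w - s‖ ≤ η := by
    have : w - s = ((η - (s.re - 1) : ℝ) : ℂ) := by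
      apply Complex.ext <;> simp [hw]; ring
    rw [this, Complex.norm_real, Real.norm_eq_abs, abs_of_nonneg (by linarith)]
    linarith
  have hmv2 : ‖riemannZeta₁ w - riemannZeta₁ s‖ ≤ c / 2 * a ^ 3 * T ^ (1 - 7 * ε) := by
    refine hmv.trans ?_
    calc C * T ^ (1 + ε) * ‖w - s‖ ≤ C * T ^ (1 + ε) * η := by gcongr
      _ = (C * a) * a ^ 3 * (T ^ (1 + ε) * T ^ (-(8 * ε))) := by simp only [η]; ring
      _ = (C * a) * a ^ 3 * T ^ (1 - 7 * ε) := by rw [← Real.rpow_add hT0]; ring_nf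
      _ ≤ _ := by gcongr
  have hoff := off η le_rfl hη1
  have htri : ‖riemannZeta₁ w‖ ≤ ‖riemannZeta₁ s‖ + ‖riemannZeta₁ w - riemannZeta₁ s‖ := norm_le_norm_add_norm_sub' _ _
  have : c * a ^ 3 * T ^ (1 - 7 * ε) ≤ ‖riemannZeta₁ s‖ + c / 2 * a ^ 3 * T ^ (1 - 7 * ε) := by
    linarith
  linarith

end

section
lemma moebL_bound (k : ℕ) : ∃ C : ℝ, 0 < C ∧ ∀ s : ℂ, 1 < s.re → s.re ≤ 2 →
    ‖LSeries (LSeries.logMul^[k] (fun n => (moebius n : ℂ))) s‖ ≤ C * (1 + |s.im|) ^ (1 / 2 : ℝ) := by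
  set ε : ℝ := 1 / (2 * (7 + 8 * k)) with hε
  have h0 : 0 < ε := by positivity
  have h1 : ε ≤ 1 / 14 := by
    rw [hε]; apply one_div_le_one_div_of_le (by norm_num)
    have : (0:ℝ) ≤ k := by positivity
    linarith
  obtain ⟨C, hC, hd⟩ := zeta1_deriv_bound h0 (by linarith)
  obtain ⟨c, hc, hl⟩ := zeta1_lower h0 (by linarith)
  set κ := min (ε / 8) (c / (8 * C))
  have hκ : 0 < κ := by positivity
  have hκ1 : κ ≤ ε / 8 := min_le_left _ _
  have hκ2 : C * 4 * κ ≤ c / 2 := by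
    have : κ ≤ c / (8 * C) := min_le_right _ _
    calc C * 4 * κ ≤ C * 4 * (c / (8 * C)) := by gcongr
      _ = c / 2 := by field_simp; norm_num
  refine ⟨k.factorial * (8 / c) / κ ^ k, by positivity, fun s hs1 hs2 => ?_⟩
  set T := 1 + |s.im| with hTdef
  have hT1 : 1 ≤ T := by simp [T]
  have hT0 : 0 < T := by linarith
  set r := κ * T ^ (-(8 * ε))
  have hr : 0 < r := by positivity
  have hrκ : r ≤ κ := by
    have : T ^ (-(8 * ε)) ≤ 1 := Real.rpow_le_one_of_one_le_of_nonpos hT1 (by linarith)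
    exact mul_le_of_le_one_right hκ.le this
  have hball : ∀ w ∈ Metric.closedBall s r, c / 2 * T ^ (1 - 7 * ε) ≤ ‖riemannZeta₁ w‖ ∧ ‖w - 1‖ ≤ 4 * T := by
    intro w hw
    rw [Metric.mem_closedBall, dist_eq_norm] at hw
    have hseg : ∀ z ∈ segment ℝ s w, ‖deriv riemannZeta₁ z‖ ≤ C * (4 * T ^ (1 + ε)) := by
      intro z hz
      have hz' : z ∈ Metric.closedBall s r := (convex_closedBall s r).segment_subset
        (Metric.mem_closedBall_self hr.le) (by rwa [Metric.mem_closedBall, dist_eq_norm]) hz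
      rw [Metric.mem_closedBall, dist_eq_norm] at hz'
      have hre := (Complex.abs_re_le_norm (z - s)).trans hz'
      have him := (Complex.abs_im_le_norm (z - s)).trans hz'
      rw [Complex.sub_re, abs_le] at hre
      rw [Complex.sub_im] at him
      refine (hd z (by linarith) (by linarith)).trans ?_
      gcongr
      have hi : |z.im| ≤ |s.im| + 1 := by
        have := abs_sub_abs_le_abs_sub z.im s.im
        linarith
      calc (1 + |z.im|) ^ (1 + ε) ≤ (2 * T) ^ (1 + ε) := by
            gcongr; linarith [abs_nonneg s.im]
        _ = 2 ^ (1 + ε) * T ^ (1 + ε) := Real.mul_rpow (by norm_num) (by positivity)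
        _ ≤ 4 * T ^ (1 + ε) := by
          gcongr
          calc (2:ℝ) ^ (1 + ε) ≤ 2 ^ (2:ℝ) := Real.rpow_le_rpow_of_exponent_le (by norm_num) (by linarith)
            _ = 4 := by norm_num
    have hmv := zeta1_re_mvt hseg
    have hmv2 : ‖riemannZeta₁ w - riemannZeta₁ s‖ ≤ c / 2 * T ^ (1 - 7 * ε) := by
      refine hmv.trans ?_
      calc C * (4 * T ^ (1 + ε)) * ‖w - s‖ ≤ C * (4 * T ^ (1 + ε)) * r := by gcongr
        _ = (C * 4 * κ) * (T ^ (1 + ε) * T ^ (-(8 * ε))) := by simp only [r]; ring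
        _ = (C * 4 * κ) * T ^ (1 - 7 * ε) := by rw [← Real.rpow_add hT0]; ring_nf
        _ ≤ _ := by gcongr
    have hls := hl s hs1.le hs2
    have htri : ‖riemannZeta₁ s‖ ≤ ‖riemannZeta₁ w‖ + ‖riemannZeta₁ w - riemannZeta₁ s‖ := by
      rw [norm_sub_rev]; exact norm_le_norm_add_norm_sub' _ _
    refine ⟨by simp only [T] at *; linarith, ?_⟩
    have : w - 1 = (w - s) + (s - 1) := by ring
    rw [this]
    refine (norm_add_le _ _).trans ?_
    have h2 : ‖s - 1‖ ≤ 1 + |s.im| := by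
      refine (Complex.norm_le_abs_re_add_abs_im _).trans ?_
      have : |(s - 1).re| ≤ 1 := by rw [abs_le]; constructor <;> simp <;> linarith
      simp only [Complex.sub_im, Complex.one_im, sub_zero]; linarith
    linarith
  set g : ℂ → ℂ := fun w => (w - 1) / riemannZeta₁ w
  have hne : ∀ w ∈ Metric.closedBall s r, riemannZeta₁ w ≠ 0 := by
    intro w hw h
    have := (hball w hw).1
    rw [h, norm_zero] at this
    have : 0 < c / 2 * T ^ (1 - 7 * ε) := by positivity
    linarith
  have hgd : DiffContOnCl ℂ g (Metric.ball s r) := by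
    apply DifferentiableOn.diffContOnCl
    rw [closure_ball s hr.ne']
    intro w hw
    exact ((differentiableAt_id.sub_const 1).div (differentiable_riemannZeta₁ w) (hne w hw)).differentiableWithinAt
  have hcau := Complex.norm_iteratedDeriv_le_of_forall_mem_sphere_norm_le (C := 8 / c * T ^ (7 * ε)) k hr hgd (by
    intro w hw
    obtain ⟨hb1, hb2⟩ := hball w (Metric.sphere_subset_closedBall hw)
    simp only [g, norm_div]
    calc ‖w - 1‖ / ‖riemannZeta₁ w‖ ≤ (4 * T) / (c / 2 * T ^ (1 - 7 * ε)) := by gcongr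
      _ = 8 / c * (T ^ (1:ℝ) / T ^ (1 - 7 * ε)) := by rw [Real.rpow_one]; field_simp; norm_num
      _ = _ := by rw [← Real.rpow_sub hT0]; ring_nf)
  have hev : LSeries (fun n => (moebius n : ℂ)) =ᶠ[nhds s] g := by
    have : {z : ℂ | 1 < z.re} ∈ nhds s :=
      (isOpen_lt continuous_const Complex.continuous_re).mem_nhds hs1
    filter_upwards [this] with z hz
    have hz : 1 < z.re := hz
    have h1' : z ≠ 1 := by rintro rfl; simp at hz
    have e := ArithmeticFunction.LSeries_zeta_mul_Lseries_moebius hz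
    rw [ArithmeticFunction.LSeries_zeta_eq_riemannZeta hz] at e
    have hz0 := riemannZeta_ne_zero_of_one_le_re hz.le
    simp only [g]
    rw [zeta1_mul h1']
    have := sub_ne_zero.mpr h1'
    field_simp
    linear_combination e
  have hdd := LSeries_iteratedDeriv (f := fun n => (moebius n : ℂ)) k (s := s) (by
    rw [ArithmeticFunction.abscissaOfAbsConv_moebius]; exact_mod_cast hs1)
  rw [hev.iteratedDeriv_eq] at hdd
  have : ‖LSeries (LSeries.logMul^[k] (fun n => (moebius n : ℂ))) s‖ = ‖iteratedDeriv k g s‖ := by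
    rw [hdd]; simp
  rw [this]
  refine hcau.trans (le_of_eq ?_)
  have hrk : r ^ k = κ ^ k * T ^ (-(8 * ε) * k) := by
    simp only [r]; rw [mul_pow, ← Real.rpow_natCast (T ^ _), ← Real.rpow_mul hT0.le]
  rw [hrk]
  have : T ^ (7 * ε) = T ^ (1 / 2 : ℝ) * T ^ (-(8 * ε) * k) := by
    rw [← Real.rpow_add hT0]
    congr 1
    rw [hε]; field_simp; ring
  rw [this]
  have : T ^ (-(8 * ε) * k) ≠ 0 := by positivity
  field_simp

end

section
open MeasureTheory in
lemma rieszM (s : ℂ) (hs : 1 ≤ s.re) : ‖1 / s - 1 / (s + 1)‖ ≤ 2 * (1 + ‖s.im‖) ^ (-2 : ℝ) := by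
  have hs0 : s ≠ 0 := by rintro rfl; simp at hs; linarith
  have hs1 : s + 1 ≠ 0 := by
    intro h; have := congrArg Complex.re h; simp at this; linarith
  have : 1 / s - 1 / (s + 1) = 1 / (s * (s + 1)) := by field_simp; ring
  rw [this, norm_div, norm_one, norm_mul, Real.rpow_neg (by positivity), div_le_iff₀ (by positivity)]
  set T := |s.im|
  have e : (1 + ‖s.im‖) ^ (2:ℝ) = (1 + T) ^ 2 := by simp [T]
  rw [e]
  have hsq : 1 + T ^ 2 ≤ ‖s‖ ^ 2 := by
    rw [← Complex.normSq_eq_norm_sq, Complex.normSq_apply]; simp only [T]; rw [sq_abs]; nlinarith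
  have hle : ‖s‖ ≤ ‖s + 1‖ := by
    apply le_of_sq_le_sq _ (norm_nonneg _)
    rw [← Complex.normSq_eq_norm_sq, ← Complex.normSq_eq_norm_sq, Complex.normSq_apply, Complex.normSq_apply]
    simp; nlinarith
  have h1 : (1 + T) ^ 2 ≤ 2 * (‖s‖ * ‖s + 1‖) := by
    have : ‖s‖ ^ 2 ≤ ‖s‖ * ‖s + 1‖ := by rw [sq]; gcongr
    nlinarith [sq_nonneg (1 - T)]
  have h2 : 0 < (1 + T) ^ 2 := by simp only [T]; positivity
  calc 1 = ((1 + T) ^ 2)⁻¹ * (1 + T) ^ 2 := (inv_mul_cancel₀ h2.ne').symm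
    _ ≤ ((1 + T) ^ 2)⁻¹ * (2 * (‖s‖ * ‖s + 1‖)) := by gcongr
    _ = _ := by ring

noncomputable def rieszF (u : ℝ) : ℂ :=
  (Set.Ioc (0:ℝ) 1).indicator (fun _ => (1:ℂ)) u - (Set.Ioc (0:ℝ) 1).indicator (fun t => (t:ℂ) ^ (1:ℂ)) u

lemma rieszF_eq {u : ℝ} (hu : 0 < u) : rieszF u = ((max (1 - u) 0 : ℝ) : ℂ) := by
  unfold rieszF
  by_cases h : u ≤ 1
  · have hm : u ∈ Set.Ioc (0:ℝ) 1 := ⟨hu, h⟩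
    rw [Set.indicator_of_mem hm, Set.indicator_of_mem hm, max_eq_left (by linarith)]; simp
  · rw [Set.indicator_of_notMem (by simp [h]), Set.indicator_of_notMem (by simp [h]), max_eq_right (by linarith)]; simp

lemma rieszF_mellin {s : ℂ} (hs : 0 < s.re) : HasMellin rieszF s (1 / s - 1 / (s + 1)) := by
  have h1 := hasMellin_one_Ioc hs
  have h2 := hasMellin_cpow_Ioc 1 (s := s) (by simp; linarith)
  have h3 := hasMellin_sub h1.1 h2.1
  rw [h1.2, h2.2] at h3
  exact h3

open MeasureTheory in
lemma riesz_inv {σ : ℝ} (hσ : 1 ≤ σ) {u : ℝ} (hu : 0 < u) :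
    Integrable (fun y : ℝ => (1 / (σ + y * Complex.I : ℂ) - 1 / (σ + y * Complex.I + 1))) ∧
    (1 / (2 * Real.pi) : ℂ) * ∫ y : ℝ, (u : ℂ) ^ (-(σ + y * Complex.I)) * (1 / (σ + y * Complex.I : ℂ) - 1 / (σ + y * Complex.I + 1))
      = ((max (1 - u) 0 : ℝ) : ℂ) := by
  have hint : Integrable (fun y : ℝ => (1 / (σ + y * Complex.I : ℂ) - 1 / (σ + y * Complex.I + 1))) := by
    have h1 : Integrable (fun y : ℝ => 2 * (1 + ‖y‖) ^ (-2 : ℝ)) :=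
      (integrable_one_add_norm (by simp)).const_mul 2
    refine h1.mono' ?_ (Filter.Eventually.of_forall (fun y => ?_))
    · apply Continuous.aestronglyMeasurable
      refine Continuous.sub (Continuous.div (by fun_prop) (by fun_prop) (fun y h => ?_)) 
        (Continuous.div (by fun_prop) (by fun_prop) (fun y h => ?_))
      · have := congrArg Complex.re h; simp at this; linarith
      · have := congrArg Complex.re h; simp at this; linarith
    · have := rieszM (σ + y * Complex.I) (by simp; linarith)
      simpa using this
  refine ⟨hint, ?_⟩
  have hm : ∀ y : ℝ, mellin rieszF (σ + y * Complex.I) = (1 / (σ + y * Complex.I : ℂ) - 1 / (σ + y * Complex.I + 1)) :=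
    fun y => (rieszF_mellin (by simp; linarith)).2
  have hcont : ContinuousAt rieszF u := by
    have : rieszF =ᶠ[nhds u] fun u => ((max (1 - u) 0 : ℝ) : ℂ) := by
      filter_upwards [lt_mem_nhds hu] with v hv using rieszF_eq hv
    refine ContinuousAt.congr ?_ this.symm
    fun_prop
  have := mellinInv_mellin_eq σ rieszF hu (rieszF_mellin (by simp; linarith)).1 (by
    unfold Complex.VerticalIntegrable
    simp_rw [hm]; exact hint) hcont
  rw [rieszF_eq hu, mellinInv] at this
  simp_rw [hm] at this
  rw [← this]
  simp

open MeasureTheory in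
lemma perron_riesz : ∃ K : ℝ, 0 < K ∧ ∀ (a : ℕ → ℂ) (σ x C : ℝ), 1 ≤ σ → 0 < x → 0 ≤ C →
    LSeriesSummable a σ →
    (∀ t : ℝ, ‖LSeries a (σ + t * Complex.I)‖ ≤ C * (1 + |t|) ^ (1 / 2 : ℝ)) →
    ‖∑ n ∈ Finset.Icc 1 ⌊x⌋₊, a n * ((1 - n / x : ℝ) : ℂ)‖ ≤ C * K * x ^ σ := by
  have hI : Integrable (fun y : ℝ => (1 + ‖y‖) ^ (-(3/2) : ℝ)) := integrable_one_add_norm (by norm_num)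
  have hIpos : 0 ≤ ∫ y : ℝ, (1 + ‖y‖) ^ (-(3/2) : ℝ) := integral_nonneg (fun y => by positivity)
  refine ⟨1 + 2 * ∫ y : ℝ, (1 + ‖y‖) ^ (-(3/2) : ℝ), by positivity, ?_⟩
  intro a σ x C hσ hx hC hsum hb
  set M : ℝ → ℂ := fun y => (1 / (σ + y * Complex.I : ℂ) - 1 / (σ + y * Complex.I + 1)) with hM
  have hMi : Integrable M := (riesz_inv hσ hx).1
  set F : ℕ → ℝ → ℂ := fun n y => LSeries.term a (σ + y * Complex.I) n * ((x:ℂ) ^ (σ + y * Complex.I : ℂ) * M y) with hF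
  have hxn : ∀ y : ℝ, ‖(x:ℂ) ^ (σ + y * Complex.I : ℂ)‖ = x ^ σ := by
    intro y; rw [Complex.norm_cpow_eq_rpow_re_of_pos hx]; simp
  have htn : ∀ n (y : ℝ), ‖LSeries.term a (σ + y * Complex.I) n‖ = ‖LSeries.term a σ n‖ := by
    intro n y
    rw [LSeries.norm_term_eq, LSeries.norm_term_eq]; simp
  have hFn : ∀ n y, ‖F n y‖ = ‖LSeries.term a σ n‖ * x ^ σ * ‖M y‖ := by
    intro n y; simp only [hF]; rw [norm_mul, norm_mul, htn, hxn]; ring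
  have hFi : ∀ n, Integrable (F n) := by
    intro n
    refine (hMi.norm.const_mul (‖LSeries.term a σ n‖ * x ^ σ)).mono' ?_ (Filter.Eventually.of_forall (fun y => (hFn n y).le))
    refine AEStronglyMeasurable.mul ?_ (AEStronglyMeasurable.mul ?_ hMi.aestronglyMeasurable)
    · apply Continuous.aestronglyMeasurable
      rcases Nat.eq_zero_or_pos n with rfl | hn
      · simp; exact continuous_const
      · have hn0 : (n : ℂ) ≠ 0 := by exact_mod_cast hn.ne'
        simp_rw [LSeries.term_of_ne_zero hn.ne']
        refine Continuous.div (by fun_prop) (Continuous.const_cpow (by fun_prop) (Or.inl hn0)) (fun y => ?_)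
        simp [Complex.cpow_eq_zero_iff, hn0]
    · apply Continuous.aestronglyMeasurable
      exact Continuous.const_cpow (by fun_prop) (Or.inl (by exact_mod_cast hx.ne'))
  have hFs : Summable (fun n => ∫ y, ‖F n y‖) := by
    simp_rw [hFn, integral_const_mul]
    exact (hsum.norm.mul_right _).mul_right _
  have hS := integral_tsum_of_summable_integral_norm hFi hFs
  have hterm : ∀ n : ℕ, (1 / (2 * Real.pi) : ℂ) * ∫ y, F n y = if n = 0 then 0 else a n * ((max (1 - n / x) 0 : ℝ) : ℂ) := by
    intro n
    split_ifs with h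
    · subst h; simp [hF]
    · have hn : 0 < (n:ℝ) := by exact_mod_cast Nat.pos_of_ne_zero h
      rw [← (riesz_inv hσ (show (0:ℝ) < n / x by positivity)).2, mul_left_comm (a n), ← integral_const_mul (a n)]
      congr 1
      refine integral_congr_ae (Filter.Eventually.of_forall (fun y => ?_))
      simp only [hF, hM]
      rw [LSeries.term_of_ne_zero h, Complex.ofReal_div, Complex.div_cpow_ofReal_nonneg hn.le hx.le] 
      rw [Complex.cpow_neg, Complex.cpow_neg]
      have : (n:ℂ) ^ (σ + y * Complex.I : ℂ) ≠ 0 := by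
        simp [Complex.cpow_eq_zero_iff, h]
      have : (x:ℂ) ^ (σ + y * Complex.I : ℂ) ≠ 0 := by
        simp [Complex.cpow_eq_zero_iff, hx.ne']
      push_cast
      field_simp
  have htot : (∑ n ∈ Finset.Icc 1 ⌊x⌋₊, a n * ((1 - n / x : ℝ) : ℂ)) = (1 / (2 * Real.pi) : ℂ) * ∑' n, ∫ y, F n y := by
    rw [← tsum_mul_left]
    simp_rw [hterm]
    rw [tsum_eq_sum (s := Finset.Icc 1 ⌊x⌋₊)]
    · refine Finset.sum_congr rfl (fun n hn => ?_)
      rw [Finset.mem_Icc] at hn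
      have : (n:ℝ) ≤ x := (Nat.le_floor_iff hx.le).mp hn.2
      rw [if_neg (by omega), max_eq_left]
      rw [sub_nonneg, div_le_one hx]; exact this
    · intro n hn
      split_ifs with h
      · rfl
      · have : ¬ (n ≤ ⌊x⌋₊) := fun h' => hn (Finset.mem_Icc.mpr ⟨Nat.pos_of_ne_zero h, h'⟩)
        rw [Nat.le_floor_iff hx.le, not_le] at this
        rw [max_eq_right]
        · simp
        · rw [sub_nonpos, one_le_div hx]; exact this.le
  rw [htot, hS, norm_mul]
  have hpi : ‖(1 / (2 * Real.pi) : ℂ)‖ ≤ 1 := by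
    rw [norm_div, norm_one, norm_mul, Complex.norm_real, Real.norm_eq_abs, abs_of_pos Real.pi_pos]
    have := Real.pi_gt_three
    rw [div_le_one (by simp; linarith)]
    simp; linarith
  have hbd : ‖∫ y, ∑' n, F n y‖ ≤ ∫ y : ℝ, C * x ^ σ * 2 * (1 + ‖y‖) ^ (-(3/2) : ℝ) := by
    refine norm_integral_le_of_norm_le (hI.const_mul _) (Filter.Eventually.of_forall (fun y => ?_))
    simp only [hF]
    rw [tsum_mul_right]
    change ‖LSeries a (σ + y * Complex.I) * _‖ ≤ _
    rw [norm_mul, norm_mul, hxn]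
    have h1 := rieszM (σ + y * Complex.I) (by simp; linarith)
    simp at h1
    have h1' : ‖M y‖ ≤ 2 * (1 + ‖y‖) ^ (-2 : ℝ) := by simpa [hM] using h1
    have e : (1 + ‖y‖) ^ (-(3/2) : ℝ) = (1 + |y|) ^ (1 / 2 : ℝ) * (1 + ‖y‖) ^ (-2 : ℝ) := by
      rw [Real.norm_eq_abs, ← Real.rpow_add (by positivity)]; norm_num
    rw [e]
    calc _ ≤ (C * (1 + |y|) ^ (1 / 2 : ℝ)) * (x ^ σ * (2 * (1 + ‖y‖) ^ (-2 : ℝ))) := by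
          gcongr
          exact hb y
      _ = _ := by ring
  rw [integral_const_mul] at hbd
  have hx0 : 0 ≤ C * x ^ σ := by positivity
  calc _ ≤ 1 * ‖∫ y, ∑' n, F n y‖ := by gcongr
    _ ≤ _ := by nlinarith

end

section
open Finset

lemma icc_one_eq (n : ℕ) : Finset.Icc 1 n = Finset.Ioc 0 n := by
  ext; simp [Nat.succ_le_iff]

lemma abel_antitone_aux (a w : ℕ → ℝ) (D : ℝ) (N k : ℕ)
    (hA : ∀ n, N ≤ n → n ≤ N + 1 + k → |∑ i ∈ Ioc N n, a i| ≤ D)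
    (hw : ∀ n, N < n → n < N + 1 + k → w (n + 1) ≤ w n) :
    |(∑ i ∈ Ioc N (N + 1 + k), a i * w i) - (∑ i ∈ Ioc N (N + 1 + k), a i) * w (N + 1 + k)| ≤ D * (w (N + 1) - w (N + 1 + k)) := by
  induction k with
  | zero => simp
  | succ k ih =>
    have ih' := ih (fun n h1 h2 => hA n h1 (by omega)) (fun n h1 h2 => hw n h1 (by omega))
    have e : N + 1 + (k + 1) = (N + 1 + k) + 1 := by ring
    rw [e, sum_Ioc_succ_top (by omega), sum_Ioc_succ_top (by omega)]
    have h1 := hA (N + 1 + k) (by omega) (by omega)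
    have h2 := hw (N + 1 + k) (by omega) (by omega)
    set A := ∑ i ∈ Ioc N (N + 1 + k), a i
    set B := ∑ i ∈ Ioc N (N + 1 + k), a i * w i
    have : B + a (N + 1 + k + 1) * w (N + 1 + k + 1) - (A + a (N + 1 + k + 1)) * w (N + 1 + k + 1) =
      (B - A * w (N + 1 + k)) + A * (w (N + 1 + k) - w (N + 1 + k + 1)) := by ring
    rw [this]
    refine (abs_add_le _ _).trans ?_
    rw [abs_mul, abs_of_nonneg (sub_nonneg.mpr h2)]
    have : |A| * (w (N + 1 + k) - w (N + 1 + k + 1)) ≤ D * (w (N + 1 + k) - w (N + 1 + k + 1)) :=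
      mul_le_mul_of_nonneg_right h1 (by linarith)
    linarith

lemma abel_antitone (a w : ℕ → ℝ) (D : ℝ) (hD : 0 ≤ D) (N M : ℕ)
    (hA : ∀ n, N ≤ n → n ≤ M → |∑ i ∈ Ioc N n, a i| ≤ D)
    (hw : ∀ n, N < n → n < M → w (n + 1) ≤ w n) (hw0 : ∀ n, N < n → n ≤ M → 0 ≤ w n) (hNM : N < M):
    |∑ i ∈ Ioc N M, a i * w i| ≤ D * w (N + 1) := by
  obtain ⟨k, rfl⟩ : ∃ k, M = N + 1 + k := ⟨M - N - 1, by omega⟩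
  have h := abel_antitone_aux a w D N k hA hw
  have h1 := hA (N + 1 + k) (by omega) le_rfl
  have h2 := hw0 (N + 1 + k) (by omega) le_rfl
  set A := ∑ i ∈ Ioc N (N + 1 + k), a i
  set B := ∑ i ∈ Ioc N (N + 1 + k), a i * w i
  have : |A * w (N + 1 + k)| ≤ D * w (N + 1 + k) := by
    rw [abs_mul, abs_of_nonneg h2]; gcongr
  have h3 := abs_sub_abs_le_abs_sub B (A * w (N + 1 + k))
  linarith

noncomputable def muLog (k n : ℕ) : ℝ := (moebius n : ℝ) * log n ^ k

lemma logMul_iter (k n : ℕ) : LSeries.logMul^[k] (fun n => (moebius n : ℂ)) n = (muLog k n : ℂ) := by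
  induction k with
  | zero => simp [muLog]
  | succ k ih =>
    rw [Function.iterate_succ_apply', LSeries.logMul, ih]
    unfold muLog
    push_cast
    ring

lemma abs_moebius_le (n : ℕ) : |(moebius n : ℝ)| ≤ 1 := by
  exact_mod_cast ArithmeticFunction.abs_moebius_le_one

lemma muLog_riesz (k : ℕ) : ∃ C : ℝ, 0 < C ∧ ∀ x : ℝ, 3 ≤ x →
    |∑ n ∈ Ioc 0 ⌊x⌋₊, muLog k n * (x - n)| ≤ C * x ^ 2 := by
  obtain ⟨C, hC, hb⟩ := moebL_bound k
  obtain ⟨K, hK, hp⟩ := perron_riesz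
  refine ⟨C * K * exp 1, by positivity, fun x hx => ?_⟩
  have hx0 : 0 < x := by linarith
  have hl1 : 1 ≤ log x := by
    rw [Real.le_log_iff_exp_le hx0]
    exact Real.exp_one_lt_d9.le.trans (by linarith)
  have hl0 : 0 < log x := by linarith
  have hinv : 0 < 1 / log x ∧ 1 / log x ≤ 1 := ⟨by positivity, by rw [div_le_one hl0]; exact hl1⟩
  have h := hp (LSeries.logMul^[k] (fun n => (moebius n : ℂ))) (1 + 1 / log x) x C
    (by linarith) hx0 hC.le ?_ ?_
  · simp_rw [logMul_iter] at h
    rw [icc_one_eq] at h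
    have e : x ^ (1 + 1 / log x) = x * exp 1 := by
      rw [Real.rpow_add hx0, Real.rpow_one, Real.rpow_def_of_pos hx0]
      congr 2; field_simp
    rw [e] at h
    have e2 : ∑ n ∈ Ioc 0 ⌊x⌋₊, muLog k n * (x - n) = x * ∑ n ∈ Ioc 0 ⌊x⌋₊, muLog k n * (1 - n / x) := by
      rw [mul_sum]; refine sum_congr rfl (fun n _ => ?_); field_simp
    rw [e2, abs_mul, abs_of_pos hx0]
    have e3 : ‖∑ n ∈ Ioc 0 ⌊x⌋₊, (muLog k n : ℂ) * ((1 - n / x : ℝ) : ℂ)‖ = |∑ n ∈ Ioc 0 ⌊x⌋₊, muLog k n * (1 - n / x)| := by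
      rw [← Real.norm_eq_abs, ← Complex.norm_real]; push_cast; rfl
    rw [e3] at h
    calc _ ≤ x * (C * K * (x * exp 1)) := by gcongr
      _ = _ := by ring
  · apply LSeriesSummable_of_abscissaOfAbsConv_lt_re
    rw [LSeries.absicssaOfAbsConv_logPowMul, ArithmeticFunction.abscissaOfAbsConv_moebius]
    rw [Complex.ofReal_re]
    exact_mod_cast (by linarith : 1 < 1 + 1 / log x)
  · intro t
    have := hb ((1 + 1 / log x : ℝ) + t * Complex.I) (by simpa using hl0) (by
      simp only [Complex.add_re, Complex.ofReal_re, Complex.mul_re, Complex.I_re, Complex.ofReal_im, Complex.I_im]; linarith)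
    simpa using this

lemma pow_log_le (k : ℕ) : ∃ C : ℝ, 0 < C ∧ ∀ x : ℝ, 1 ≤ x → log x ^ k ≤ C * x := by
  refine ⟨(k + 1 : ℝ) ^ k, by positivity, fun x hx => ?_⟩
  have h := Real.log_le_rpow_div (x := x) (by linarith) (ε := 1 / (k + 1)) (by positivity)
  calc log x ^ k ≤ (x ^ (1 / (k + 1) : ℝ) / (1 / (k + 1))) ^ k := by
        gcongr; exact Real.log_nonneg hx
    _ = (k + 1 : ℝ) ^ k * (x ^ (1 / (k + 1) : ℝ)) ^ k := by rw [div_div_eq_mul_div, div_one, mul_pow]; ring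
    _ ≤ (k + 1 : ℝ) ^ k * x := by
      gcongr
      rw [← Real.rpow_natCast, ← Real.rpow_mul (by linarith)]
      calc x ^ (1 / (k + 1) * k : ℝ) ≤ x ^ (1:ℝ) := by
            apply Real.rpow_le_rpow_of_exponent_le hx
            rw [div_mul_eq_mul_div, one_mul, div_le_one (by positivity)]; linarith
        _ = x := Real.rpow_one x

lemma muLog_sum (j : ℕ) : ∃ C : ℝ, 0 < C ∧ ∀ N : ℕ, 3 ≤ N →
    |∑ n ∈ Ioc 0 N, muLog (2 * j) n| ≤ C * N * log (2 * N) ^ j := by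
  obtain ⟨C, hC, hb⟩ := muLog_riesz (2 * j)
  obtain ⟨C1, hC1, hlog⟩ := pow_log_le (2 * j)
  refine ⟨5 * C + 1 + C1 * 2, by positivity, fun N hN => ?_⟩
  have hNr : (3:ℝ) ≤ N := by exact_mod_cast hN
  set l := log (2 * N) 
  have hl1 : 1 ≤ l := by
    rw [Real.le_log_iff_exp_le (by linarith)]
    exact Real.exp_one_lt_d9.le.trans (by linarith)
  have hlj : 1 ≤ l ^ j := one_le_pow₀ hl1
  set h := (N:ℝ) / l ^ j
  have hh0 : 0 < h := by positivity
  have hhN : h ≤ N := div_le_self (by linarith) hlj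
  set M := ⌊(N:ℝ) + h⌋₊
  have hMN : N ≤ M := Nat.le_floor (by linarith)
  have hM : (M:ℝ) ≤ N + h := Nat.floor_le (by linarith)
  have b1 := hb N hNr
  have b2 := hb (N + h) (by linarith)
  rw [Nat.floor_natCast] at b1
  rw [← sum_Ioc_consecutive _ (Nat.zero_le N) hMN] at b2
  have e : ∑ n ∈ Ioc 0 N, muLog (2 * j) n * ((N + h) - n) = (∑ n ∈ Ioc 0 N, muLog (2 * j) n * (N - n)) + h * ∑ n ∈ Ioc 0 N, muLog (2 * j) n := by
    rw [mul_sum, ← sum_add_distrib]; refine sum_congr rfl (fun n _ => by ring)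
  rw [e] at b2
  set S := ∑ n ∈ Ioc 0 N, muLog (2 * j) n
  set A := ∑ n ∈ Ioc 0 N, muLog (2 * j) n * (N - n)
  set E := ∑ n ∈ Ioc N M, muLog (2 * j) n * ((N + h) - n)
  have hE : |E| ≤ (h + 1) * (l ^ (2 * j) * h) := by
    calc |E| ≤ ∑ n ∈ Ioc N M, l ^ (2 * j) * h := by
          refine (abs_sum_le_sum_abs _ _).trans (sum_le_sum (fun n hn => ?_))
          rw [mem_Ioc] at hn
          have h1 : (N:ℝ) < n := by exact_mod_cast hn.1
          have h2 : (n:ℝ) ≤ M := by exact_mod_cast hn.2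
          have hn1 : (1:ℝ) ≤ n := by linarith
          rw [abs_mul, muLog, abs_mul]
          have h3 : |log n ^ (2 * j)| ≤ l ^ (2 * j) := by
            rw [abs_of_nonneg (by have := Real.log_nonneg hn1; positivity)]
            have hnl : log n ≤ l := Real.log_le_log (by linarith) (by linarith)
            exact pow_le_pow_left₀ (Real.log_nonneg hn1) hnl _
          have h4 : |(N + h) - (n:ℝ)| ≤ h := by rw [abs_of_nonneg (by linarith)]; linarith
          calc _ ≤ 1 * l ^ (2 * j) * h := by gcongr; exact abs_moebius_le n
            _ = _ := by ring
      _ = (M - N) * (l ^ (2 * j) * h) := by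
          rw [sum_const, Nat.card_Ioc, nsmul_eq_mul, Nat.cast_sub hMN]
      _ ≤ _ := by gcongr; linarith
  have hS : h * |S| ≤ 5 * C * N ^ 2 + (h + 1) * (l ^ (2 * j) * h) := by
    have : h * S = (A + h * S + E) - A - E := by ring
    have h5 : |h * S| ≤ |A + h * S + E| + |A| + |E| := by
      calc |h * S| = |(A + h * S + E) - A - E| := by rw [← this]
        _ ≤ |(A + h * S + E) - A| + |E| := abs_sub _ _
        _ ≤ _ := by gcongr; exact abs_sub _ _
    rw [abs_mul, abs_of_pos hh0] at h5
    have : C * (N + h) ^ 2 ≤ C * (2 * N) ^ 2 := by gcongr; linarith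
    nlinarith
  have hmain : |S| ≤ 5 * C * (N ^ 2 / h) + (h + 1) * l ^ (2 * j) := by
    have : h * |S| ≤ h * (5 * C * (N ^ 2 / h) + (h + 1) * l ^ (2 * j)) := by
      refine hS.trans (le_of_eq ?_); field_simp
    exact le_of_mul_le_mul_left this hh0
  have e1 : (N:ℝ) ^ 2 / h = N * l ^ j := by
    simp only [h]; field_simp
  have e2 : h * l ^ (2 * j) = N * l ^ j := by
    simp only [h]; rw [two_mul, pow_add]; field_simp
  have e3 : l ^ (2 * j) ≤ C1 * 2 * N * l ^ j := by
    have := hlog (2 * N) (by linarith)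
    calc l ^ (2 * j) ≤ C1 * (2 * N) * 1 := by linarith
      _ ≤ C1 * (2 * N) * l ^ j := by gcongr
      _ = _ := by ring
  rw [e1, add_mul, e2] at hmain
  linarith

lemma mu_block (j : ℕ) : ∃ C : ℝ, 0 < C ∧ ∀ N M : ℕ, 3 ≤ N → N ≤ M → M ≤ 2 * N →
    |∑ n ∈ Ioc N M, (moebius n : ℝ) / n| ≤ C / log N ^ j := by
  obtain ⟨C, hC, hb⟩ := muLog_sum j
  refine ⟨4 * C * 3 ^ j, by positivity, fun N M hN hNM hM => ?_⟩
  have hNr : (3:ℝ) ≤ N := by exact_mod_cast hN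
  have hMr : (M:ℝ) ≤ 2 * N := by exact_mod_cast hM
  have hl1 : 1 ≤ log N := by
    rw [Real.le_log_iff_exp_le (by linarith)]
    exact Real.exp_one_lt_d9.le.trans (by linarith)
  rcases hNM.eq_or_lt with rfl | hNM'
  · simp; positivity
  have hl4 : log (4 * N) ≤ 3 * log N := by
    have : log 4 ≤ 2 * log N := by
      rw [show (2:ℝ) * log N = log (N ^ 2) by simp]
      apply Real.log_le_log (by norm_num); nlinarith
    rw [Real.log_mul (by norm_num) (by linarith)]; linarith
  have hP : ∀ n : ℕ, N ≤ n → n ≤ M → |∑ i ∈ Ioc 0 n, muLog (2 * j) i| ≤ C * (2 * N) * (3 * log N) ^ j := by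
    intro n h1 h2
    have h1r : (N:ℝ) ≤ n := by exact_mod_cast h1
    have h2r : (n:ℝ) ≤ M := by exact_mod_cast h2
    refine (hb n (by omega)).trans ?_
    have hx1 : 0 ≤ log (2 * n) := Real.log_nonneg (by linarith)
    have hx2 : log (2 * n) ≤ 3 * log N :=
      le_trans (Real.log_le_log (by linarith) (by linarith)) hl4
    have hx3 : (n:ℝ) ≤ 2 * N := by linarith
    gcongr
  have hab := abel_antitone (muLog (2 * j)) (fun n => 1 / (n * log n ^ (2 * j)))
    (2 * (C * (2 * N) * (3 * log N) ^ j)) (by positivity) N M (by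
      intro n h1 h2
      have e := sum_Ioc_consecutive (muLog (2 * j)) (Nat.zero_le N) h1
      have : ∑ i ∈ Ioc N n, muLog (2 * j) i = (∑ i ∈ Ioc 0 n, muLog (2 * j) i) - ∑ i ∈ Ioc 0 N, muLog (2 * j) i := by linarith
      rw [this]
      refine (abs_sub _ _).trans ?_
      linarith [hP n h1 h2, hP N le_rfl hNM]) (by
      intro n h1 h2
      have h1r : (N:ℝ) ≤ n := by exact_mod_cast h1.le
      have hln : 0 < log n := Real.log_pos (by linarith)
      have : log n ≤ log (n + 1 : ℕ) := Real.log_le_log (by linarith) (by push_cast; linarith)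
      have hn0 : (0:ℝ) < n := by linarith
      apply one_div_le_one_div_of_le (by positivity)
      gcongr
      push_cast; linarith) (by
      intro n h1 h2
      have h1r : (N:ℝ) ≤ n := by exact_mod_cast h1.le
      have hln : 0 < log n := Real.log_pos (by linarith)
      positivity) hNM'
  have e : ∑ n ∈ Ioc N M, (moebius n : ℝ) / n = ∑ i ∈ Ioc N M, muLog (2 * j) i * (1 / (i * log i ^ (2 * j))) := by
    refine sum_congr rfl (fun n hn => ?_)
    rw [mem_Ioc] at hn
    have h1r : (N:ℝ) ≤ n := by exact_mod_cast hn.1.le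
    have hln : 0 < log n := Real.log_pos (by linarith)
    unfold muLog
    field_simp
  rw [e]
  refine hab.trans ?_
  calc _ ≤ 2 * (C * (2 * N) * (3 * log N) ^ j) * (1 / (N * log N ^ (2 * j))) := by
        have : log N ≤ log (N + 1 : ℕ) := Real.log_le_log (by linarith) (by push_cast; linarith)
        gcongr
        push_cast; linarith
    _ = _ := by rw [two_mul j, pow_add, mul_pow]; field_simp; ring

lemma mu_tail (j : ℕ) : ∃ C : ℝ, 0 < C ∧ ∀ N M : ℕ, 3 ≤ N → N ≤ M →
    |∑ n ∈ Ioc N M, (moebius n : ℝ) / n| ≤ C / log N ^ j := by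
  obtain ⟨C, hC, hb⟩ := mu_block (j + 2)
  have hs : Summable (fun i : ℕ => 1 / (1 + i * log 2) ^ 2) := by
    have h2 : 0 < log 2 := Real.log_pos (by norm_num)
    have h := (summable_nat_add_iff 1).mpr (Real.summable_one_div_nat_pow.mpr (show 1 < 2 by norm_num))
    refine Summable.of_nonneg_of_le (fun i => by positivity) (fun i => ?_) (h.mul_left (1 / log 2 ^ 2))
    rw [div_mul_div_comm, one_mul, ← mul_pow]
    have : log 2 ≤ 1 := by linarith [Real.log_two_lt_d9]
    gcongr
    push_cast
    nlinarith
  have hsn : 0 ≤ ∑' i : ℕ, 1 / (1 + i * log 2) ^ 2 := tsum_nonneg (fun i => by positivity)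
  refine ⟨C * (1 + ∑' i : ℕ, 1 / (1 + i * log 2) ^ 2), by positivity, fun N M hN hNM => ?_⟩
  have hNr : (3:ℝ) ≤ N := by exact_mod_cast hN
  have hl1 : 1 ≤ log N := by
    rw [Real.le_log_iff_exp_le (by linarith)]
    exact Real.exp_one_lt_d9.le.trans (by linarith)
  have key : ∀ i : ℕ, ∀ M : ℕ, N ≤ M → M ≤ 2 ^ i * N → |∑ n ∈ Ioc N M, (moebius n : ℝ) / n| ≤
      ∑ l ∈ range i, C / log N ^ j * (1 / (1 + l * log 2) ^ 2) := by
    intro i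
    induction i with
    | zero =>
      intro M h1 h2
      have : M = N := by omega
      subst this; simp
    | succ i ih =>
      intro M h1 h2
      rw [sum_range_succ]
      have h2l : 0 < log 2 := Real.log_pos (by norm_num)
      have hnn : 0 ≤ C / log N ^ j * (1 / (1 + i * log 2) ^ 2) := by positivity
      by_cases h : M ≤ 2 ^ i * N
      · linarith [ih M h1 h]
      · push Not at h
        have hNN : N ≤ 2 ^ i * N := Nat.le_mul_of_pos_left N (by positivity)
        rw [← sum_Ioc_consecutive _ hNN h.le]
        refine (abs_add_le _ _).trans (add_le_add (ih _ hNN le_rfl) ?_)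
        refine (hb (2 ^ i * N) M (by omega) h.le (by rw [pow_succ] at h2; linarith)).trans ?_
        have e : log ((2 ^ i * N : ℕ) : ℝ) = i * log 2 + log N := by
          push_cast; rw [Real.log_mul (by positivity) (by linarith), Real.log_pow]
        rw [e, pow_add, div_mul_div_comm, mul_one]
        have : 0 ≤ i * log 2 := by positivity
        have g1 : log N ≤ i * log 2 + log N := by linarith
        have g2 : 1 + i * log 2 ≤ i * log 2 + log N := by linarith
        exact div_le_div_of_nonneg_left hC.le (by positivity)
          (mul_le_mul (pow_le_pow_left₀ (by linarith) g1 _) (pow_le_pow_left₀ (by linarith) g2 _) (by positivity) (by positivity))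
  have hi : M ≤ 2 ^ M * N := by
    calc M ≤ 2 ^ M := Nat.lt_two_pow_self.le
      _ ≤ _ := Nat.le_mul_of_pos_right _ (by omega)
  refine (key M M hNM hi).trans ?_
  rw [← mul_sum]
  have := hs.sum_le_tsum (range M) (fun i _ => by positivity)
  calc _ ≤ C / log N ^ j * (1 + ∑' i : ℕ, 1 / (1 + i * log 2) ^ 2) := by
        gcongr; linarith
    _ = _ := by ring

end

section
open Finset

noncomputable def mM (t : ℝ) : ℝ := ∑ n ∈ Ioc 0 ⌊t⌋₊, (moebius n : ℝ) / n

lemma mM_limit (j : ℕ) : ∃ l C : ℝ, 0 < C ∧ ∀ t : ℝ, 1 ≤ t → |mM t - l| ≤ C / (1 + log t) ^ (j + 1) := by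
  obtain ⟨C, hC, hb⟩ := mu_tail (j + 1)
  have hcau : CauchySeq (fun N : ℕ => mM N) := by
    have ht : Filter.Tendsto (fun N : ℕ => 2 * (C / log ((N + 3 : ℕ) : ℝ) ^ (j + 1))) Filter.atTop (nhds 0) := by
      have h1 : Filter.Tendsto (fun N : ℕ => log ((N + 3 : ℕ) : ℝ)) Filter.atTop Filter.atTop :=
        Real.tendsto_log_atTop.comp (tendsto_natCast_atTop_atTop.comp (Filter.tendsto_add_atTop_nat 3))
      have h2 := (Filter.tendsto_pow_atTop (n := j + 1) (by omega)).comp h1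
      have h3 := (tendsto_const_nhds (x := C)).div_atTop h2
      simpa using h3.const_mul 2
    have : CauchySeq (fun N : ℕ => mM (N + 3 : ℕ)) := by
      apply cauchySeq_of_le_tendsto_0 _ _ ht
      intro n m N hn hm
      have key : ∀ n, N ≤ n → |mM ((n + 3 : ℕ) : ℝ) - mM ((N + 3 : ℕ) : ℝ)| ≤ C / log ((N + 3 : ℕ) : ℝ) ^ (j + 1) := by
        intro n hn
        have := hb (N + 3) (n + 3) (by omega) (by omega)
        unfold mM
        rw [Nat.floor_natCast, Nat.floor_natCast, ← sum_Ioc_consecutive _ (Nat.zero_le (N + 3)) (show N + 3 ≤ n + 3 by omega)]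
        simpa using this
      rw [Real.dist_eq]
      have h1 := key n hn
      have h2 := key m hm
      rw [abs_sub_comm] at h2
      have := abs_sub_le (mM ((n + 3 : ℕ) : ℝ)) (mM ((N + 3 : ℕ) : ℝ)) (mM ((m + 3 : ℕ) : ℝ))
      linarith
    exact (cauchySeq_shift (u := fun N : ℕ => mM N) 3).mp this
  obtain ⟨l, hl⟩ := cauchySeq_tendsto_of_complete hcau
  have hN : ∀ N : ℕ, 3 ≤ N → |mM N - l| ≤ C / log N ^ (j + 1) := by
    intro N h3
    have hl2 : Filter.Tendsto (fun M : ℕ => |mM N - mM M|) Filter.atTop (nhds |mM N - l|) :=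
      (tendsto_const_nhds.sub hl).abs
    refine le_of_tendsto hl2 ?_
    filter_upwards [Filter.eventually_ge_atTop N] with M hM
    have := hb N M h3 hM
    unfold mM
    rw [Nat.floor_natCast, Nat.floor_natCast, ← sum_Ioc_consecutive _ (Nat.zero_le N) hM, abs_sub_comm]
    simpa using this
  refine ⟨l, (C + 2 + |l|) * 3 ^ (j + 1), by positivity, fun t ht => ?_⟩
  have hlt := Real.log_nonneg ht
  by_cases h3 : 3 ≤ t
  · set N := ⌊t⌋₊
    have hN3 : 3 ≤ N := Nat.le_floor (by exact_mod_cast h3)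
    have hNr : (3:ℝ) ≤ N := by exact_mod_cast hN3
    have hmt : mM t = mM N := by unfold mM; rw [Nat.floor_natCast]
    have hl1 : 1 ≤ log N := by
      rw [Real.le_log_iff_exp_le (by linarith)]
      exact Real.exp_one_lt_d9.le.trans (by linarith)
    have ht2 : t ≤ 2 * N := by
      have := Nat.lt_floor_add_one t
      simp only [N] at *; linarith
    have : 1 + log t ≤ 3 * log N := by
      have h1 := Real.log_le_log (by linarith) ht2
      rw [Real.log_mul (by norm_num) (by linarith)] at h1
      have := Real.log_two_lt_d9
      linarith
    rw [hmt]
    refine (hN N hN3).trans ?_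
    rw [div_le_div_iff₀ (by positivity) (by positivity)]
    calc C * (1 + log t) ^ (j + 1) ≤ (C + 2 + |l|) * (3 * log N) ^ (j + 1) := by
          gcongr
          have := abs_nonneg l
          linarith
      _ = _ := by rw [mul_pow]; ring
  · push Not at h3
    have hf : ⌊t⌋₊ ≤ 2 := by
      have : ⌊t⌋₊ < 3 := (Nat.floor_lt (by linarith)).mpr (by exact_mod_cast h3)
      omega
    have hm : |mM t| ≤ 2 := by
      unfold mM
      refine (abs_sum_le_sum_abs _ _).trans ?_
      calc _ ≤ ∑ n ∈ Ioc 0 ⌊t⌋₊, (1:ℝ) := by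
            refine sum_le_sum (fun n hn => ?_)
            rw [mem_Ioc] at hn
            have : (1:ℝ) ≤ n := by exact_mod_cast hn.1
            rw [abs_div, Nat.abs_cast, div_le_one (by linarith)]
            exact (abs_moebius_le n).trans this
        _ ≤ 2 := by simp; exact_mod_cast hf
    have h1 : |mM t - l| ≤ 2 + |l| := (abs_sub _ _).trans (by linarith)
    refine h1.trans ?_
    rw [le_div_iff₀ (by positivity)]
    have hlog : 1 + log t ≤ 3 := by
      have := Real.log_le_sub_one_of_pos (show 0 < t by linarith)
      linarith
    have := abs_nonneg l
    gcongr
    linarith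

open MeasureTheory

lemma logpow_integrable (A : ℕ) (hA : 0 < A) {y : ℝ} (hy : 1 ≤ y) :
    IntegrableOn (fun t : ℝ => 1 / (1 + log t) ^ (A + 1) * t⁻¹) (Set.Ioi y) ∧
    ∫ t in Set.Ioi y, 1 / (1 + log t) ^ (A + 1) * t⁻¹ ≤ 1 / (1 + log y) ^ A := by
  have hd : ∀ t ∈ Set.Ici y, HasDerivAt (fun t : ℝ => -(1 / A : ℝ) * ((1 + log t) ^ A)⁻¹) (1 / (1 + log t) ^ (A + 1) * t⁻¹) t := by
    intro t ht
    have ht : y ≤ t := ht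
    have hl := Real.log_nonneg (hy.trans ht)
    have h1 := ((((Real.hasDerivAt_log (show t ≠ 0 by linarith)).const_add 1).pow A).inv (by simp only [Pi.pow_apply]; positivity)).const_mul (-(1 / A : ℝ))
    refine h1.congr_deriv ?_
    obtain ⟨B, rfl⟩ : ∃ B, A = B + 1 := ⟨A - 1, by omega⟩
    have : (1 + log t) ≠ 0 := by positivity
    simp only [Pi.pow_apply, Nat.add_sub_cancel]
    push_cast
    field_simp
    ring
  have hnn : ∀ t ∈ Set.Ioi y, 0 ≤ 1 / (1 + log t) ^ (A + 1) * t⁻¹ := by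
    intro t ht
    have ht : y < t := ht
    have hl := Real.log_nonneg (hy.trans ht.le)
    have : 0 < t := by linarith
    positivity
  have ht : Filter.Tendsto (fun t : ℝ => -(1 / A : ℝ) * ((1 + log t) ^ A)⁻¹) Filter.atTop (nhds 0) := by
    have h1 : Filter.Tendsto (fun t : ℝ => 1 + log t) Filter.atTop Filter.atTop :=
      Filter.tendsto_atTop_add_const_left _ _ Real.tendsto_log_atTop
    have h2 := ((Filter.tendsto_pow_atTop (n := A) (by omega)).comp h1).inv_tendsto_atTop
    simpa using h2.const_mul (-(1 / A : ℝ))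
  refine ⟨integrableOn_Ioi_deriv_of_nonneg' hd hnn ht, ?_⟩
  rw [integral_Ioi_of_hasDerivAt_of_nonneg' hd hnn ht]
  have hl := Real.log_nonneg hy
  have hA1 : (1:ℝ) ≤ A := by exact_mod_cast hA
  rw [zero_sub, neg_mul, neg_neg, ← one_div, div_mul_div_comm, one_mul]
  apply one_div_le_one_div_of_le (by positivity)
  have : 0 ≤ (1 + log y) ^ A := by positivity
  nlinarith

lemma mM_measurable : Measurable mM := by
  have : Measurable (fun n : ℕ => ∑ n ∈ Ioc 0 n, (moebius n : ℝ) / n) := measurable_from_nat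
  exact this.comp Nat.measurable_floor

lemma mM_lseries {s : ℝ} (hs : 0 < s) :
    ((∫ t in Set.Ioi (1:ℝ), mM t * t ^ (-(s + 1)) : ℝ) : ℂ) = 1 / riemannZeta₁ (1 + s) := by
  have h1s : 1 < (1 + s : ℂ).re := by simp; exact hs
  obtain ⟨l, C, hC, hl⟩ := mM_limit 0
  set f : ℕ → ℂ := fun n => (moebius n : ℂ) / n
  have hterm : ∀ n, LSeries.term f s n = LSeries.term (fun n => (moebius n : ℂ)) (1 + s) n := by
    intro n
    rcases Nat.eq_zero_or_pos n with rfl | hn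
    · simp
    · have hn0 : (n:ℂ) ≠ 0 := by exact_mod_cast hn.ne'
      rw [LSeries.term_of_ne_zero hn.ne', LSeries.term_of_ne_zero hn.ne', Complex.cpow_add _ _ hn0, Complex.cpow_one]
      simp only [f]
      rw [div_div]
  have hsm : LSeriesSummable f s := by
    have : LSeriesSummable (fun n => (moebius n : ℂ)) (1 + s) := by
      apply LSeriesSummable_of_abscissaOfAbsConv_lt_re
      rw [ArithmeticFunction.abscissaOfAbsConv_moebius]; exact_mod_cast h1s
    exact this.congr (fun n => (hterm n).symm)
  have hls : LSeries f s = 1 / riemannZeta (1 + s) := by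
    have : LSeries f s = LSeries (fun n => (moebius n : ℂ)) (1 + s) := tsum_congr hterm
    rw [this]
    have e := ArithmeticFunction.LSeries_zeta_mul_Lseries_moebius h1s
    rw [ArithmeticFunction.LSeries_zeta_eq_riemannZeta h1s] at e
    have hz0 := riemannZeta_ne_zero_of_one_le_re h1s.le
    rw [eq_div_iff hz0, mul_comm]; exact e
  have hsum : ∀ t : ℝ, ∑ k ∈ Icc 1 ⌊t⌋₊, f k = ((mM t : ℝ) : ℂ) := by
    intro t; rw [icc_one_eq]; unfold mM; push_cast; rfl
  have hI := LSeries_eq_mul_integral f (le_refl 0) (s := s) (by simpa using hs) hsm (by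
    simp only [Real.rpow_zero]
    apply Asymptotics.IsBigO.of_bound (C + |l|)
    filter_upwards [Filter.eventually_ge_atTop 1] with n hn
    have hn1 : (1:ℝ) ≤ n := by exact_mod_cast hn
    have := hsum n
    rw [Nat.floor_natCast] at this
    rw [this, Complex.norm_real, Real.norm_eq_abs, norm_one, mul_one]
    have h2 := hl n hn1
    have h3 : C / (1 + log n) ^ (0 + 1) ≤ C := by
      apply div_le_self hC.le
      have := Real.log_nonneg hn1
      simp; exact this
    have := abs_sub_abs_le_abs_sub (mM n) l
    linarith)
  have hs0 : (s:ℂ) ≠ 0 := by exact_mod_cast hs.ne'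
  have hint : (∫ t in Set.Ioi (1:ℝ), (∑ k ∈ Icc 1 ⌊t⌋₊, f k) * (t:ℂ) ^ (-((s:ℂ) + 1))) = ((∫ t in Set.Ioi (1:ℝ), mM t * t ^ (-(s + 1)) : ℝ) : ℂ) := by
    rw [← integral_complex_ofReal]
    refine setIntegral_congr_fun measurableSet_Ioi (fun t ht => ?_)
    have ht : 1 < t := ht
    rw [hsum t]
    push_cast
    rw [Complex.ofReal_cpow (by linarith)]
    push_cast
    rfl
  rw [hint, hls] at hI
  rw [zeta1_mul (by simpa using hs0), show (1 + (s:ℂ) - 1) = s by ring]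
  rw [mul_comm (s:ℂ), ← div_div, hI]
  field_simp

end

section
open Finset MeasureTheory

lemma mM_main (j : ℕ) (hj : 0 < j) : ∃ C : ℝ, 0 < C ∧ (∀ t : ℝ, 1 ≤ t → |mM t| ≤ C / (1 + log t) ^ (j + 1)) ∧
    IntegrableOn (fun t => mM t * t⁻¹) (Set.Ioi 1) ∧ ∫ t in Set.Ioi (1:ℝ), mM t * t⁻¹ = 1 := by
  obtain ⟨l, C, hC, hl⟩ := mM_limit j
  obtain ⟨hi, -⟩ := logpow_integrable j hj (le_refl 1)
  set bd : ℝ → ℝ := fun t => C * (1 / (1 + log t) ^ (j + 1) * t⁻¹)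
  have hbd : IntegrableOn bd (Set.Ioi 1) := hi.const_mul C
  have hr : ∀ s : ℝ, 0 ≤ s → ∀ t : ℝ, 1 < t → ‖(mM t - l) * t ^ (-(s + 1))‖ ≤ bd t := by
    intro s hs t ht
    have hlt := Real.log_nonneg ht.le
    rw [norm_mul, Real.norm_eq_abs, Real.norm_of_nonneg (by positivity)]
    have h1 : t ^ (-(s + 1)) ≤ t⁻¹ := by
      rw [← Real.rpow_neg_one]
      exact Real.rpow_le_rpow_of_exponent_le ht.le (by linarith)
    calc _ ≤ C / (1 + log t) ^ (j + 1) * t⁻¹ := by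
          have := hl t ht.le
          gcongr
      _ = bd t := by simp only [bd]; ring
  have hmeas : ∀ s : ℝ, Measurable (fun t : ℝ => (mM t - l) * t ^ (-(s + 1))) := by
    intro s
    exact (mM_measurable.sub_const l).mul (measurable_id.pow_const _)
  have hint : ∀ s : ℝ, 0 ≤ s → IntegrableOn (fun t : ℝ => (mM t - l) * t ^ (-(s + 1))) (Set.Ioi 1) := by
    intro s hs
    refine Integrable.mono' hbd (hmeas s).aestronglyMeasurable ?_
    filter_upwards [ae_restrict_mem measurableSet_Ioi] with t ht
    exact hr s hs t ht
  set J := ∫ t in Set.Ioi (1:ℝ), (mM t - l) * t ^ (-((0:ℝ) + 1))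
  have hlim : Filter.Tendsto (fun s : ℝ => ∫ t in Set.Ioi (1:ℝ), (mM t - l) * t ^ (-(s + 1))) (nhdsWithin 0 (Set.Ioi 0)) (nhds J) := by
    refine tendsto_integral_filter_of_dominated_convergence bd ?_ ?_ hbd ?_
    · exact Filter.Eventually.of_forall (fun s => (hmeas s).aestronglyMeasurable)
    · filter_upwards [self_mem_nhdsWithin] with s hs
      filter_upwards [ae_restrict_mem measurableSet_Ioi] with t ht
      exact hr s (le_of_lt hs) t ht
    · filter_upwards [ae_restrict_mem measurableSet_Ioi] with t ht
      have ht : (1:ℝ) < t := ht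
      have hc : Continuous (fun s : ℝ => (mM t - l) * t ^ (-(s + 1))) := by
        have : t ≠ 0 := by linarith
        exact continuous_const.mul (Continuous.rpow continuous_const (by fun_prop) (fun s => Or.inl this))
      exact (hc.tendsto 0).mono_left nhdsWithin_le_nhds
  set g : ℝ → ℝ := fun s => (1 / riemannZeta₁ (1 + (s:ℂ))).re
  have hg : Filter.Tendsto g (nhdsWithin 0 (Set.Ioi 0)) (nhds 1) := by
    have h1 : ContinuousAt (fun s : ℝ => (1 / riemannZeta₁ (1 + (s:ℂ))).re) 0 := by
      apply Complex.continuous_re.continuousAt.comp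
      apply ContinuousAt.div continuousAt_const
      · have : Continuous (fun s : ℝ => riemannZeta₁ (1 + (s:ℂ))) :=
          differentiable_riemannZeta₁.continuous.comp (by fun_prop)
        exact this.continuousAt
      · exact zeta1_ne_zero (by simp)
    have h2 := h1.tendsto
    simp only [Complex.ofReal_zero, add_zero, riemannZeta₁_one, div_one, Complex.one_re] at h2
    exact h2.mono_left nhdsWithin_le_nhds
  have heq : ∀ s : ℝ, 0 < s → (∫ t in Set.Ioi (1:ℝ), (mM t - l) * t ^ (-(s + 1))) = g s - l / s := by
    intro s hs
    have h1 : g s = ∫ t in Set.Ioi (1:ℝ), mM t * t ^ (-(s + 1)) := by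
      simp only [g]
      rw [← mM_lseries hs, Complex.ofReal_re]
    have hp : IntegrableOn (fun t : ℝ => l * t ^ (-(s + 1))) (Set.Ioi 1) :=
      (integrableOn_Ioi_rpow_of_lt (by linarith) (by norm_num)).const_mul l
    have h2 : (∫ t in Set.Ioi (1:ℝ), mM t * t ^ (-(s + 1))) = (∫ t in Set.Ioi (1:ℝ), (mM t - l) * t ^ (-(s + 1))) + ∫ t in Set.Ioi (1:ℝ), l * t ^ (-(s + 1)) := by
      rw [← integral_add (hint s hs.le) hp]
      refine integral_congr_ae (Filter.Eventually.of_forall (fun t => ?_))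
      simp only
      ring
    have h3 : ∫ t in Set.Ioi (1:ℝ), l * t ^ (-(s + 1)) = l / s := by
      rw [integral_const_mul, integral_Ioi_rpow_of_lt (by linarith) (by norm_num), Real.one_rpow]
      field_simp
      ring_nf
      field_simp
    rw [h1, h2, h3]; ring
  have hlim2 : Filter.Tendsto (fun s : ℝ => g s - l / s) (nhdsWithin 0 (Set.Ioi 0)) (nhds J) := by
    refine hlim.congr' ?_
    filter_upwards [self_mem_nhdsWithin] with s hs
    exact heq s hs
  have hs0 : Filter.Tendsto (fun s : ℝ => s) (nhdsWithin 0 (Set.Ioi 0)) (nhds 0) :=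
    (continuous_id.tendsto 0).mono_left nhdsWithin_le_nhds
  have hl0 : l = 0 := by
    have h1 := hs0.mul hlim2
    have h2 : Filter.Tendsto (fun s : ℝ => s * g s - l) (nhdsWithin 0 (Set.Ioi 0)) (nhds (0 * J)) := by
      refine h1.congr' ?_
      filter_upwards [self_mem_nhdsWithin] with s hs
      have hs : 0 < s := hs
      field_simp
    have h3 := (hs0.mul hg).sub_const l
    have := tendsto_nhds_unique h2 h3
    linarith
  subst hl0
  have hJ : J = 1 := by
    refine tendsto_nhds_unique hlim2 ?_
    simpa using hg
  have hrw : ∀ t : ℝ, (mM t - 0) * t ^ (-((0:ℝ) + 1)) = mM t * t⁻¹ := by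
    intro t; rw [zero_add, Real.rpow_neg_one, sub_zero]
  refine ⟨C, hC, fun t ht => by simpa using hl t ht, ?_, ?_⟩
  · have := hint 0 le_rfl
    simpa only [hrw] using this
  · refine Eq.trans ?_ hJ
    simp only [J, hrw]

noncomputable def fM (y : ℝ) : ℝ := ∑ n ∈ Ioc 0 ⌊y⌋₊, (moebius n : ℝ) / n * log (y / n)

lemma sum_icc_zero (c : ℕ → ℝ) (hc : c 0 = 0) (n : ℕ) : ∑ k ∈ Icc 0 n, c k = ∑ k ∈ Ioc 0 n, c k := by
  rw [Icc_eq_cons_Ioc (Nat.zero_le _), sum_cons, hc, zero_add]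

lemma fM_eq {y : ℝ} (hy : 1 ≤ y) : fM y = ∫ t in Set.Ioc 1 y, mM t * t⁻¹ := by
  set c : ℕ → ℝ := fun n => (moebius n : ℝ) / n
  have hc0 : c 0 = 0 := by simp [c]
  have hd : ∀ t : ℝ, deriv (fun t => log y - log t) t = -t⁻¹ := by
    intro t; rw [deriv_const_sub, Real.deriv_log]
  have h := sum_mul_eq_sub_integral_mul₀ (f := fun t => log y - log t) (c := c) hc0 y
    (by
      intro t ht
      have : t ≠ 0 := by linarith [ht.1]
      exact (differentiableAt_const _).sub (Real.differentiableAt_log this))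
    (by
      rw [show deriv (fun t => log y - log t) = fun t => -t⁻¹ from funext hd]
      apply ContinuousOn.integrableOn_Icc
      apply ContinuousOn.neg
      apply continuousOn_id.inv₀
      intro t ht
      have : t ≠ 0 := by linarith [ht.1]
      exact this)
  simp only [sub_self, zero_mul, zero_sub, hd] at h
  have h1 : fM y = ∑ k ∈ Icc 0 ⌊y⌋₊, (log y - log k) * c k := by
    rw [sum_icc_zero (fun k => (log y - log k) * c k) (by simp [hc0])]
    unfold fM
    refine sum_congr rfl (fun n hn => ?_)
    rw [mem_Ioc] at hn
    have hn0 : (n:ℝ) ≠ 0 := by exact_mod_cast (by omega : n ≠ 0)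
    rw [Real.log_div (by linarith) hn0]
    simp only [c]; ring
  rw [h1, h, ← integral_neg]
  refine integral_congr_ae (Filter.Eventually.of_forall (fun t => ?_))
  simp only
  rw [sum_icc_zero _ hc0]
  unfold mM
  ring

lemma mf_bound (j : ℕ) (hj : 0 < j) : ∃ C : ℝ, 0 < C ∧ ∀ t : ℝ,
    |mM t| ≤ C / (20 + log (max 1 t)) ^ j ∧ |fM t - 1| ≤ C / (20 + log (max 1 t)) ^ j := by
  obtain ⟨C, hC, hm, hI, hJ⟩ := mM_main j hj
  refine ⟨(C + 1) * 20 ^ j, by positivity, ?_⟩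
  have hconv : ∀ t : ℝ, 1 ≤ t → ∀ D ≤ C + 1, D / (1 + log t) ^ j ≤ (C + 1) * 20 ^ j / (20 + log t) ^ j := by
    intro t ht D hD
    have := Real.log_nonneg ht
    rw [div_le_div_iff₀ (by positivity) (by positivity)]
    calc D * (20 + log t) ^ j ≤ (C + 1) * (20 * (1 + log t)) ^ j := by
          gcongr
          linarith
      _ = _ := by rw [mul_pow]; ring
  intro t
  by_cases ht : 1 ≤ t
  · rw [max_eq_right ht]
    have hl := Real.log_nonneg ht
    constructor
    · refine (hm t ht).trans (le_trans ?_ (hconv t ht C (by linarith)))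
      gcongr
      · linarith
      · omega
    · refine le_trans ?_ (hconv t ht C (by linarith))
      have hsp : (∫ x in Set.Ioi (1:ℝ), mM x * x⁻¹) = (∫ x in Set.Ioc 1 t, mM x * x⁻¹) + ∫ x in Set.Ioi t, mM x * x⁻¹ := by
        rw [← setIntegral_union (Set.Ioc_disjoint_Ioi le_rfl) measurableSet_Ioi (hI.mono_set Set.Ioc_subset_Ioi_self) (hI.mono_set (Set.Ioi_subset_Ioi ht)), Set.Ioc_union_Ioi_eq_Ioi ht]
      rw [fM_eq ht]
      have : (∫ x in Set.Ioc 1 t, mM x * x⁻¹) - 1 = -∫ x in Set.Ioi t, mM x * x⁻¹ := by linarith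
      rw [this, abs_neg]
      obtain ⟨h1, h2⟩ := logpow_integrable j hj ht
      have h3 : ‖∫ x in Set.Ioi t, mM x * x⁻¹‖ ≤ ∫ x in Set.Ioi t, C * (1 / (1 + log x) ^ (j + 1) * x⁻¹) := by
        refine norm_integral_le_of_norm_le (h1.const_mul C) ?_
        filter_upwards [ae_restrict_mem measurableSet_Ioi] with x hx
        have hx : t < x := hx
        have hx0 : 0 < x := by linarith
        rw [norm_mul, Real.norm_eq_abs, Real.norm_of_nonneg (by positivity), ← mul_assoc]
        have := hm x (by linarith)
        rw [mul_one_div]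
        gcongr
      rw [integral_const_mul, Real.norm_eq_abs] at h3
      refine h3.trans ?_
      calc _ ≤ C * (1 / (1 + log t) ^ j) := by gcongr
        _ = _ := by rw [mul_one_div]
  · have hf : ⌊t⌋₊ = 0 := Nat.floor_eq_zero.mpr (by linarith)
    rw [max_eq_left (by linarith), Real.log_one, add_zero, mul_div_assoc, div_self (by positivity)]
    unfold mM fM
    rw [hf]
    simp; constructor <;> linarith

lemma f2M_bound : ∃ C : ℝ, 0 < C ∧ ∀ y : ℝ, 1 ≤ y →
    |(∑ n ∈ Ioc 0 ⌊y⌋₊, (moebius n : ℝ) / n * log (y / n) ^ 2) - 2 * log y| ≤ C := by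
  obtain ⟨C, hC, hm, hI, hJ⟩ := mM_main 2 (by norm_num)
  obtain ⟨C', hC', hmf⟩ := mf_bound 1 (by norm_num)
  obtain ⟨hi, hib⟩ := logpow_integrable 1 (by norm_num) (le_refl 1)
  refine ⟨2 * C' + 2 * C, by positivity, fun y hy => ?_⟩
  set c : ℕ → ℝ := fun n => (moebius n : ℝ) / n
  have hc0 : c 0 = 0 := by simp [c]
  have hdd : ∀ t : ℝ, t ≠ 0 → HasDerivAt (fun t => (log y - log t) ^ 2) (2 * (log y - log t) * (-t⁻¹)) t := by
    intro t ht
    have := (((Real.hasDerivAt_log ht).const_sub (log y)).pow 2)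
    refine this.congr_deriv ?_
    simp
  have h := sum_mul_eq_sub_integral_mul₀ (f := fun t => (log y - log t) ^ 2) (c := c) hc0 y
    (by
      intro t ht
      have : t ≠ 0 := by linarith [ht.1]
      exact (hdd t this).differentiableAt)
    (by
      have : ContinuousOn (fun t : ℝ => 2 * (log y - log t) * (-t⁻¹)) (Set.Icc 1 y) := by
        have hne : ∀ t ∈ Set.Icc 1 y, t ≠ 0 := fun t ht => by linarith [ht.1]
        exact (continuousOn_const.mul (continuousOn_const.sub (continuousOn_id.log hne))).mul (continuousOn_id.inv₀ hne).neg
      refine this.integrableOn_Icc.congr_fun (fun t ht => ?_) measurableSet_Icc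
      have : t ≠ 0 := by linarith [ht.1]
      exact (hdd t this).deriv.symm)
  simp only [sub_self, zero_mul, zero_sub, ne_eq, OfNat.ofNat_ne_zero, not_false_eq_true, zero_pow] at h
  have h1 : (∑ n ∈ Ioc 0 ⌊y⌋₊, (moebius n : ℝ) / n * log (y / n) ^ 2) = ∑ k ∈ Icc 0 ⌊y⌋₊, (log y - log k) ^ 2 * c k := by
    rw [sum_icc_zero (fun k => (log y - log k) ^ 2 * c k) (by simp [hc0])]
    refine sum_congr rfl (fun n hn => ?_)
    rw [mem_Ioc] at hn
    have hn0 : (n:ℝ) ≠ 0 := by exact_mod_cast (by omega : n ≠ 0)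
    rw [Real.log_div (by linarith) hn0]
    simp only [c]; ring
  have hIy := hI.mono_set (Set.Ioc_subset_Ioi_self : Set.Ioc 1 y ⊆ Set.Ioi 1)
  have hi2 : IntegrableOn (fun t => C * (1 / (1 + log t) ^ (1 + 1) * t⁻¹)) (Set.Ioi 1) := hi.const_mul C
  have hbd : ∀ t : ℝ, 1 < t → ‖log t * (mM t * t⁻¹)‖ ≤ C * (1 / (1 + log t) ^ (1 + 1) * t⁻¹) := by
    intro t ht
    have hl := Real.log_nonneg ht.le
    rw [norm_mul, norm_mul, Real.norm_of_nonneg hl, Real.norm_eq_abs, Real.norm_of_nonneg (by positivity)]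
    have h2 := hm t ht.le
    calc log t * (|mM t| * t⁻¹) ≤ (1 + log t) * (C / (1 + log t) ^ (2 + 1) * t⁻¹) := by
          gcongr; linarith
      _ = _ := by
        field_simp
        ring
  have hIl : IntegrableOn (fun t => log t * (mM t * t⁻¹)) (Set.Ioi 1) := by
    refine Integrable.mono' hi2 ?_ ?_
    · exact (Real.measurable_log.mul (mM_measurable.mul measurable_inv)).aestronglyMeasurable
    · filter_upwards [ae_restrict_mem measurableSet_Ioi] with t ht
      exact hbd t ht
  have h3 : (∑ n ∈ Ioc 0 ⌊y⌋₊, (moebius n : ℝ) / n * log (y / n) ^ 2) =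
      2 * log y * fM y - 2 * ∫ t in Set.Ioc 1 y, log t * (mM t * t⁻¹) := by
    rw [h1, h, fM_eq hy, ← integral_const_mul, ← integral_const_mul, ← integral_sub (hIy.const_mul _) ((hIl.mono_set Set.Ioc_subset_Ioi_self).const_mul _), ← integral_neg]
    refine setIntegral_congr_fun measurableSet_Ioc (fun t ht => ?_)
    have : t ≠ 0 := by linarith [ht.1]
    rw [(hdd t this).deriv, sum_icc_zero _ hc0]
    unfold mM
    ring
  have h4 : |∫ t in Set.Ioc 1 y, log t * (mM t * t⁻¹)| ≤ C := by
    have h5 : ‖∫ t in Set.Ioc 1 y, log t * (mM t * t⁻¹)‖ ≤ ∫ t in Set.Ioc 1 y, C * (1 / (1 + log t) ^ (1 + 1) * t⁻¹) := by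
      refine norm_integral_le_of_norm_le (hi2.mono_set Set.Ioc_subset_Ioi_self) ?_
      filter_upwards [ae_restrict_mem measurableSet_Ioc] with t ht
      exact hbd t ht.1
    have h6 : ∫ t in Set.Ioc 1 y, C * (1 / (1 + log t) ^ (1 + 1) * t⁻¹) ≤ ∫ t in Set.Ioi 1, C * (1 / (1 + log t) ^ (1 + 1) * t⁻¹) := by
      refine setIntegral_mono_set hi2 ?_ (Filter.Eventually.of_forall (Set.Ioc_subset_Ioi_self))
      filter_upwards [ae_restrict_mem measurableSet_Ioi] with t ht
      exact (norm_nonneg _).trans (hbd t ht)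
    rw [integral_const_mul (μ := volume.restrict (Set.Ioi 1))] at h6
    rw [Real.log_one] at hib
    rw [Real.norm_eq_abs] at h5
    have : C * (∫ t in Set.Ioi (1:ℝ), 1 / (1 + log t) ^ (1 + 1) * t⁻¹) ≤ C * 1 := by
      gcongr
      simpa using hib
    linarith
  have hl := Real.log_nonneg hy
  have h5 := (hmf y).2
  rw [max_eq_right hy, pow_one] at h5
  have h6 : log y * |fM y - 1| ≤ C' := by
    rw [le_div_iff₀ (by positivity)] at h5
    have := abs_nonneg (fM y - 1)
    nlinarith
  rw [h3, show 2 * log y * fM y - 2 * (∫ t in Set.Ioc 1 y, log t * (mM t * t⁻¹)) - 2 * log y = 2 * (log y * (fM y - 1)) - 2 * ∫ t in Set.Ioc 1 y, log t * (mM t * t⁻¹) by ring]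
  refine (abs_sub _ _).trans ?_
  rw [abs_mul, abs_mul, abs_mul, abs_of_nonneg hl, abs_two]
  linarith

end

section
open Finset

noncomputable def SK (φ : ℝ → ℝ) (k : ℕ) (y : ℝ) : ℝ :=
  ∑ n ∈ Ioc 0 ⌊y⌋₊, if n.Coprime k then (moebius n : ℝ) / n * φ (y / n) else 0

lemma SK_rec (φ : ℝ → ℝ) {p k : ℕ} (hp : p.Prime) (hpk : p.Coprime k) (y : ℝ) :
    SK φ (p * k) y = SK φ k y + SK φ (p * k) (y / p) / p := by
  have hp0 : (p:ℝ) ≠ 0 := by exact_mod_cast hp.ne_zero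
  unfold SK
  set N := ⌊y⌋₊
  have hfl : ⌊y / p⌋₊ = N / p := Nat.floor_div_natCast y p
  rw [hfl]
  have hsplit : ∑ n ∈ Ioc 0 N, (if n.Coprime k then (moebius n : ℝ) / n * φ (y / n) else 0)
      = (∑ n ∈ Ioc 0 N, if n.Coprime (p * k) then (moebius n : ℝ) / n * φ (y / n) else 0)
        + ∑ n ∈ (Ioc 0 N).filter (fun n => p ∣ n), if n.Coprime k then (moebius n : ℝ) / n * φ (y / n) else 0 := by
    rw [sum_filter, ← sum_add_distrib]
    refine sum_congr rfl (fun n hn => ?_)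
    by_cases hpn : p ∣ n
    · have : ¬ n.Coprime (p * k) := fun h => by
        have h2 := Nat.Coprime.coprime_mul_right_right h
        have := (Nat.Prime.coprime_iff_not_dvd hp).mp h2.symm
        exact this hpn
      simp only [this, hpn, if_true, if_false, add_zero, zero_add]
    · have h1 : n.Coprime p := ((Nat.Prime.coprime_iff_not_dvd hp).mpr hpn).symm
      have : n.Coprime (p * k) ↔ n.Coprime k := by
        rw [Nat.coprime_mul_iff_right]; tauto
      simp only [this, hpn, if_true, if_false, add_zero, zero_add]
  rw [hsplit]
  have himg : (Ioc 0 N).filter (fun n => p ∣ n) = (Ioc 0 (N / p)).image (fun m => p * m) := by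
    ext n
    simp only [mem_filter, mem_Ioc, mem_image]
    constructor
    · rintro ⟨⟨h1, h2⟩, m, rfl⟩
      refine ⟨m, ⟨Nat.pos_of_mul_pos_left h1, ?_⟩, rfl⟩
      rw [Nat.le_div_iff_mul_le hp.pos]; linarith
    · rintro ⟨m, ⟨h1, h2⟩, rfl⟩
      rw [Nat.le_div_iff_mul_le hp.pos] at h2
      refine ⟨⟨Nat.mul_pos hp.pos h1, by linarith⟩, dvd_mul_right _ _⟩
  rw [himg, sum_image (by intro a _ b _ h; exact Nat.eq_of_mul_eq_mul_left hp.pos h), add_assoc, eq_comm, add_eq_left, sum_div, ← sum_add_distrib]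
  refine sum_eq_zero (fun m hm => ?_)
  rw [mem_Ioc] at hm
  have hm0 : (m:ℝ) ≠ 0 := by exact_mod_cast hm.1.ne'
  by_cases hpm : p ∣ m
  · have h1 : ¬ m.Coprime (p * k) := fun h => by
      have h2 := Nat.Coprime.coprime_mul_right_right h
      exact (Nat.Prime.coprime_iff_not_dvd hp).mp h2.symm hpm
    have h2 : moebius (p * m) = 0 := by
      apply ArithmeticFunction.moebius_eq_zero_of_not_squarefree
      intro h
      obtain ⟨r, rfl⟩ := hpm
      have := h p ⟨r, by ring⟩
      exact hp.one_lt.ne' (Nat.isUnit_iff.mp this)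
    simp [h1, h2]
  · have hc : p.Coprime m := (Nat.Prime.coprime_iff_not_dvd hp).mpr hpm
    have h2 : moebius (p * m) = - moebius m := by
      rw [ArithmeticFunction.isMultiplicative_moebius.map_mul_of_coprime hc, ArithmeticFunction.moebius_apply_prime hp]; ring
    have h3 : (p * m).Coprime k ↔ m.Coprime (p * k) := by
      rw [Nat.coprime_mul_iff_left, Nat.coprime_mul_iff_right]
      have := hc.symm
      tauto
    rw [h2]
    simp only [h3]
    by_cases h4 : m.Coprime (p * k)
    · rw [if_pos h4, if_pos h4]
      push_cast
      rw [div_div y]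
      field_simp
      ring
    · simp [h4]

lemma rec_bound (E B : ℝ → ℝ) (p : ℕ) (hp : 2 ≤ p) (c η : ℝ) (hc : 0 ≤ c)
    (hB : ∀ y, B (y / p) / p ≤ η * B y)
    (hE : ∀ y, 1 ≤ y → |E y - E (y / p) / p| ≤ c * (1 - η) * B y)
    (h0 : ∀ y, y < 1 → |E y| ≤ c * B y) (y : ℝ) : |E y| ≤ c * B y := by
  have hp0 : (0:ℝ) < p := by exact_mod_cast (by omega : 0 < p)
  have hp2 : (2:ℝ) ≤ p := by exact_mod_cast hp
  have key : ∀ n : ℕ, ∀ y : ℝ, y < 2 ^ n → |E y| ≤ c * B y := by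
    intro n
    induction n with
    | zero => intro y hy; exact h0 y (by simpa using hy)
    | succ n ih =>
      intro y hy
      by_cases h1 : y < 1
      · exact h0 y h1
      · push Not at h1
        have h2 := ih (y / p) (by
          rw [div_lt_iff₀ hp0]
          rw [pow_succ] at hy
          have : (0:ℝ) < 2 ^ n := by positivity
          nlinarith)
        have h3 := hE y h1
        have h4 : |E y| ≤ |E y - E (y / p) / p| + |E (y / p) / p| := by
          have := abs_add_le (E y - E (y / p) / p) (E (y / p) / p)
          simpa using this
        have h5 : |E (y / p) / p| ≤ c * (η * B y) := by
          rw [abs_div, Nat.abs_cast]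
          calc |E (y / p)| / p ≤ c * B (y / p) / p := by gcongr
            _ = c * (B (y / p) / p) := by ring
            _ ≤ _ := by
              have := hB y
              gcongr
        linarith
  obtain ⟨n, hn⟩ := pow_unbounded_of_one_lt y (show (1:ℝ) < 2 by norm_num)
  exact key n y hn

end

section
open Finset

noncomputable def cK (k : ℕ) : ℝ := ∏ p ∈ k.primeFactors, (1 - 1 / Real.sqrt p)⁻¹

lemma sqrt_prime_lt {p : ℕ} (hp : 2 ≤ p) : 0 < 1 - 1 / Real.sqrt p ∧ 1 < Real.sqrt p := by
  have hp2 : (2:ℝ) ≤ p := by exact_mod_cast hp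
  have h1 : 1 < Real.sqrt p := by
    rw [Real.lt_sqrt (by norm_num)]; linarith
  refine ⟨?_, h1⟩
  rw [sub_pos, div_lt_one (by linarith)]; exact h1

lemma one_le_cK (k : ℕ) : 1 ≤ cK k := by
  unfold cK
  have : ∏ p ∈ k.primeFactors, (1:ℝ) ≤ ∏ p ∈ k.primeFactors, (1 - 1 / Real.sqrt p)⁻¹ := by
    apply Finset.prod_le_prod (fun p _ => zero_le_one)
    intro p hp
    obtain ⟨h1, h2⟩ := sqrt_prime_lt (Nat.prime_of_mem_primeFactors hp).two_le
    rw [one_le_inv₀ h1]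
    have : 0 < 1 / Real.sqrt p := by positivity
    linarith
  simpa using this

lemma cK_mul {p k : ℕ} (hp : p.Prime) (hpk : p.Coprime k) : cK (p * k) = cK k / (1 - 1 / Real.sqrt p) := by
  unfold cK
  rw [hpk.primeFactors_mul, prod_union hpk.disjoint_primeFactors, hp.primeFactors, prod_singleton]
  exact mul_comm _ _

noncomputable def gK (k : ℕ) : ℝ := (k : ℝ) / (k.totient : ℝ)

lemma gK_mul {p k : ℕ} (hp : p.Prime) (hpk : p.Coprime k) : gK (p * k) = gK k + gK (p * k) / p := by
  have h2 : (2:ℝ) ≤ p := by exact_mod_cast hp.two_le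
  unfold gK
  rcases Nat.eq_zero_or_pos k with rfl | hk
  · simp
  rw [Nat.totient_mul hpk, Nat.totient_prime hp]
  have h1 : ((p - 1 : ℕ) : ℝ) = p - 1 := by rw [Nat.cast_sub hp.one_le]; simp
  push_cast
  rw [h1]
  have h3 : (p:ℝ) - 1 ≠ 0 := by linarith
  have h4 : (k.totient : ℝ) ≠ 0 := by exact_mod_cast (Nat.totient_pos.mpr hk).ne'
  field_simp
  ring

lemma gK_nonneg (k : ℕ) : 0 ≤ gK k := by unfold gK; positivity

lemma gK_le_cK (k : ℕ) (hk : Squarefree k) : gK k ≤ cK k := by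
  induction k using induction_on_primes with
  | zero => simp at hk
  | one => simp [gK, cK]
  | prime_mul p a hp ih =>
    rw [Nat.squarefree_mul_iff] at hk
    have h := ih hk.2.2
    rw [cK_mul hp hk.1]
    obtain ⟨h1, h2⟩ := sqrt_prime_lt hp.two_le
    rw [le_div_iff₀ h1]
    have h3 := gK_mul hp hk.1
    have h4 : 1 / (p:ℝ) ≤ 1 / Real.sqrt p := by
      apply one_div_le_one_div_of_le (by linarith)
      have := Real.mul_self_sqrt (Nat.cast_nonneg (α := ℝ) p)
      nlinarith
    have h5 := gK_nonneg (p * a)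
    have h6 : gK (p * a) / p = gK (p * a) * (1 / p) := by ring
    nlinarith

noncomputable def bB (y : ℝ) : ℝ := 1 / (20 + log (max 1 y)) ^ 10

lemma bB_pos (y : ℝ) : 0 < bB y := by
  have := Real.log_nonneg (le_max_left 1 y)
  unfold bB; positivity

lemma bB_div (y : ℝ) {p : ℕ} (hp : 2 ≤ p) : bB (y / p) / p ≤ 1 / Real.sqrt p * bB y := by
  have hp2 : (2:ℝ) ≤ p := by exact_mod_cast hp
  have hp0 : (0:ℝ) < p := by linarith
  have hs : Real.sqrt p * Real.sqrt p = p := Real.mul_self_sqrt hp0.le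
  have hs0 := (sqrt_prime_lt hp).2
  set a := 20 + log (max 1 (y / p))
  have ha : 20 ≤ a := by
    have := Real.log_nonneg (le_max_left 1 (y / p))
    simp only [a]; linarith
  have hlp : 0 ≤ log p := Real.log_nonneg (by linarith)
  have h1 : 20 + log (max 1 y) ≤ a + log p := by
    have : log (max 1 y) ≤ log (max 1 (y / p) * p) := by
      apply Real.log_le_log (by positivity)
      apply max_le
      · nlinarith [le_max_left 1 (y / p)]
      · have := le_max_right 1 (y / p)
        rw [div_le_iff₀ hp0] at this
        exact this
    rw [Real.log_mul (by positivity) hp0.ne'] at this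
    simp only [a]; linarith
  have h2 : (20 + log (max 1 y)) ^ 10 ≤ a ^ 10 * Real.sqrt p := by
    have hnn := Real.log_nonneg (le_max_left 1 y)
    calc (20 + log (max 1 y)) ^ 10 ≤ (a * (1 + log p / 20)) ^ 10 := by
          gcongr
          nlinarith
      _ ≤ (a * exp (log p / 20)) ^ 10 := by
          gcongr
          linarith [Real.add_one_le_exp (log p / 20)]
      _ = a ^ 10 * Real.sqrt p := by
          rw [mul_pow, ← Real.exp_nat_mul, Real.sqrt_eq_rpow, Real.rpow_def_of_pos hp0]
          congr 2
          push_cast; ring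
  unfold bB
  have hnn := Real.log_nonneg (le_max_left 1 y)
  rw [div_div, div_mul_div_comm, one_mul]
  apply one_div_le_one_div_of_le (by positivity)
  calc Real.sqrt p * (20 + log (max 1 y)) ^ 10 ≤ Real.sqrt p * (a ^ 10 * Real.sqrt p) := by gcongr
    _ = a ^ 10 * (Real.sqrt p * Real.sqrt p) := by ring
    _ = a ^ 10 * p := by rw [hs]

noncomputable def ind1 (z : ℝ) : ℝ := if 1 ≤ z then 1 else 0
noncomputable def lgp (z : ℝ) : ℝ := if 1 ≤ z then log z else 0

lemma SK_lt_one (φ : ℝ → ℝ) (k : ℕ) {y : ℝ} (hy : y < 1) : SK φ k y = 0 := by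
  unfold SK
  rw [Nat.floor_eq_zero.mpr hy]; simp

lemma one_le_div_of_mem {n : ℕ} {y : ℝ} (hn : n ∈ Ioc 0 ⌊y⌋₊) : 1 ≤ y / n := by
  rw [mem_Ioc] at hn
  have h0 : (0:ℝ) < n := by exact_mod_cast hn.1
  rw [le_div_iff₀ h0, one_mul]
  exact (Nat.le_floor_iff' hn.1.ne').mp hn.2

lemma SK_ind (y : ℝ) : SK ind1 1 y = mM y := by
  unfold SK mM
  refine sum_congr rfl (fun n hn => ?_)
  rw [if_pos (Nat.coprime_one_right n), ind1, if_pos (one_le_div_of_mem hn), mul_one]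

lemma SK_lgp (y : ℝ) : SK lgp 1 y = fM y := by
  unfold SK fM
  refine sum_congr rfl (fun n hn => ?_)
  rw [if_pos (Nat.coprime_one_right n), lgp, if_pos (one_le_div_of_mem hn)]

lemma SK_bound : ∃ C : ℝ, 0 < C ∧ ∀ k : ℕ, Squarefree k → ∀ y : ℝ,
    |SK ind1 k y| ≤ cK k * (C * bB y) ∧ |SK lgp k y - gK k| ≤ cK k * (C * bB y) := by
  obtain ⟨C, hC, hb⟩ := mf_bound 10 (by norm_num)
  refine ⟨C, hC, fun k hk => ?_⟩
  have hB : ∀ p : ℕ, 2 ≤ p → ∀ y : ℝ, C * bB (y / p) / p ≤ 1 / Real.sqrt p * (C * bB y) := by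
    intro p hp y
    have := bB_div y hp
    calc C * bB (y / p) / p = C * (bB (y / p) / p) := by ring
      _ ≤ C * (1 / Real.sqrt p * bB y) := by gcongr
      _ = _ := by ring
  have hC1 : ∀ y : ℝ, y < 1 → 1 ≤ C * bB y := by
    intro y hy
    have := (hb y).2
    unfold fM at this
    rw [Nat.floor_eq_zero.mpr hy] at this
    simp at this
    unfold bB
    simpa [div_eq_mul_inv] using this
  induction k using induction_on_primes with
  | zero => simp at hk
  | one =>
    intro y
    have h1 := hb y
    rw [SK_ind, SK_lgp]
    simp only [cK, gK, bB]
    simp only [div_eq_mul_inv] at h1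
    simpa [div_eq_mul_inv] using h1
  | prime_mul p a hp ih =>
    rw [Nat.squarefree_mul_iff] at hk
    have h := ih hk.2.2
    obtain ⟨h1, h2⟩ := sqrt_prime_lt hp.two_le
    have hc := cK_mul hp hk.1
    have hc1 := one_le_cK (p * a)
    have hca : cK (p * a) * (1 - 1 / Real.sqrt p) = cK a := by rw [hc, div_mul_cancel₀ _ h1.ne']
    intro y
    constructor
    · apply rec_bound (fun y => SK ind1 (p * a) y) (fun y => C * bB y) p hp.two_le (cK (p * a)) (1 / Real.sqrt p) (by linarith) (hB p hp.two_le)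
      · intro y hy
        rw [hca]
        have := SK_rec ind1 hp hk.1 y
        rw [this, add_sub_cancel_right]
        exact (h y).1
      · intro y hy
        rw [SK_lt_one _ _ hy, abs_zero]
        have := bB_pos y
        positivity
    · apply rec_bound (fun y => SK lgp (p * a) y - gK (p * a)) (fun y => C * bB y) p hp.two_le (cK (p * a)) (1 / Real.sqrt p) (by linarith) (hB p hp.two_le)
      · intro y hy
        rw [hca]
        have h3 := SK_rec lgp hp hk.1 y
        have h4 := gK_mul hp hk.1
        have : SK lgp (p * a) y - gK (p * a) - (SK lgp (p * a) (y / p) - gK (p * a)) / p = SK lgp a y - gK a := by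
          rw [sub_div]; linarith
        rw [this]
        exact (h y).2
      · intro y hy
        rw [SK_lt_one _ _ hy, zero_sub, abs_neg, abs_of_nonneg (gK_nonneg _)]
        have h5 := gK_le_cK (p * a) (by rw [Nat.squarefree_mul_iff]; exact hk)
        have := hC1 y hy
        nlinarith

lemma SK2_bound : ∃ C : ℝ, 0 < C ∧ ∀ k : ℕ, Squarefree k → ∀ y : ℝ,
    |SK (fun z => lgp z ^ 2) k y - 2 * gK k * lgp y| ≤ cK k * C := by
  obtain ⟨C, hC, hb⟩ := f2M_bound
  refine ⟨C + 8, by positivity, fun k hk => ?_⟩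
  induction k using induction_on_primes with
  | zero => simp at hk
  | one =>
    intro y
    have h1 : cK 1 = 1 := by simp [cK]
    have h2 : gK 1 = 1 := by simp [gK]
    rw [h1, h2, one_mul, mul_one]
    by_cases hy : 1 ≤ y
    · refine le_trans ?_ ((hb y hy).trans (by linarith))
      apply le_of_eq
      rw [lgp, if_pos hy]
      congr 2
      unfold SK
      refine sum_congr rfl (fun n hn => ?_)
      rw [if_pos (Nat.coprime_one_right n)]
      simp only [lgp]
      rw [if_pos (one_le_div_of_mem hn)]
    · rw [lgp, if_neg hy, SK_lt_one _ _ (by linarith)]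
      simp; linarith
  | prime_mul p a hp ih =>
    have hk0 := hk
    rw [Nat.squarefree_mul_iff] at hk
    have h := ih hk.2.2
    obtain ⟨h1, h2⟩ := sqrt_prime_lt hp.two_le
    have hc := cK_mul hp hk.1
    have hc1 := one_le_cK (p * a)
    have hca : cK (p * a) * (1 - 1 / Real.sqrt p) = cK a := by rw [hc, div_mul_cancel₀ _ h1.ne']
    have hp2 : (2:ℝ) ≤ p := by exact_mod_cast hp.two_le
    have hp0 : (0:ℝ) < p := by linarith
    have hs : Real.sqrt p * Real.sqrt p = p := Real.mul_self_sqrt hp0.le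
    have hlp : log p ≤ Real.sqrt p := by
      have := Real.log_le_sub_one_of_pos (show 0 < Real.sqrt p / 2 by positivity)
      have e : log p = 2 * log (Real.sqrt p) := by rw [Real.log_sqrt hp0.le]; ring
      rw [Real.log_div (by positivity) (by norm_num)] at this
      have := Real.log_two_lt_d9
      linarith
    have hlp0 : 0 ≤ log p := Real.log_nonneg (by linarith)
    intro y
    refine rec_bound (fun y => SK (fun z => lgp z ^ 2) (p * a) y - 2 * gK (p * a) * lgp y) (fun _ => C + 8) p hp.two_le (cK (p * a)) (1 / p) (by linarith) ?_ ?_ ?_ y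
    · intro y; apply le_of_eq; ring
    · intro y hy
      have h3 := SK_rec (fun z => lgp z ^ 2) hp hk.1 y
      have h4 := gK_mul hp hk.1
      have h5 := h y
      have h6 : SK (fun z => lgp z ^ 2) (p * a) y - 2 * gK (p * a) * lgp y - (SK (fun z => lgp z ^ 2) (p * a) (y / p) - 2 * gK (p * a) * lgp (y / p)) / p
          = (SK (fun z => lgp z ^ 2) a y - 2 * gK a * lgp y) + 2 * (gK (p * a) / p) * (lgp (y / p) - lgp y) := by
        have : gK a = gK (p * a) - gK (p * a) / p := by linarith
        rw [h3, this]
        ring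
      have h7 : |lgp (y / p) - lgp y| ≤ log p := by
        rw [lgp, lgp, if_pos hy]
        have hly := Real.log_nonneg hy
        split_ifs with h8
        · rw [Real.log_div (by linarith) hp0.ne']
          rw [show log y - log p - log y = - log p by ring, abs_neg, abs_of_nonneg hlp0]
        · rw [zero_sub, abs_neg, abs_of_nonneg hly]
          apply Real.log_le_log (by linarith)
          push Not at h8
          rw [div_lt_one hp0] at h8; exact h8.le
      rw [h6]
      have hg := gK_nonneg (p * a)
      have hgc := gK_le_cK (p * a) hk0
      have h8 : |2 * (gK (p * a) / p) * (lgp (y / p) - lgp y)| ≤ 2 * (gK (p * a) / p) * log p := by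
        rw [abs_mul, abs_of_nonneg (by positivity)]
        gcongr
      refine (abs_add_le _ _).trans ((add_le_add h5 h8).trans ?_)
      have hs14 : (1.4:ℝ) ≤ Real.sqrt p := by
        apply Real.le_sqrt_of_sq_le
        norm_num; linarith
      rw [← hca]
      set s := Real.sqrt p
      set c := cK (p * a)
      have hi : 1 / s ≤ 1 / 1.4 := one_div_le_one_div_of_le (by norm_num) hs14
      have hi0 : 0 < 1 / s := by positivity
      have hpi : 1 / (p:ℝ) = 1 / s * (1 / s) := by rw [← hs]; field_simp
      have e1 : 2 * (gK (p * a) / p) * log p ≤ c * (2 * (1 / s)) := by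
        calc 2 * (gK (p * a) / p) * log p = 2 * (gK (p * a)) * (1 / p * log p) := by ring
          _ ≤ 2 * c * (1 / p * s) := by gcongr
          _ = 2 * c * (1 / s) := by
            rw [hpi]; field_simp
          _ = _ := by ring
      refine (add_le_add_right e1 _).trans ?_
      rw [hpi, mul_assoc, mul_assoc, ← mul_add]
      have hcp : 0 ≤ c := by linarith
      apply mul_le_mul_of_nonneg_left _ hcp
      norm_num at hi
      have : 0 ≤ (1 / s) * ((C + 8) * (1 - 1 / s) - 2) := by
        apply mul_nonneg hi0.le
        have : 0 ≤ C * (1 - 1 / s) := by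
          apply mul_nonneg hC.le
          rw [one_div]; linarith
        rw [one_div] at this ⊢
        nlinarith
      nlinarith
    · intro y hy
      rw [SK_lt_one _ _ hy, lgp, if_neg (by linarith)]
      simp only [mul_zero, sub_zero, abs_zero]
      positivity

end

section
open Finset

lemma sum_divisors_prime_mul' {p a : ℕ} (hp : p.Prime) (ha : a ≠ 0) (hpa : p.Coprime a) (f : ℕ → ℝ) :
    ∑ d ∈ (p * a).divisors, f d = ∑ d ∈ a.divisors, f d + ∑ d ∈ a.divisors, f (p * d) := by
  have h1 : (p * a).divisors = a.divisors ∪ a.divisors.image (fun d => p * d) := by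
    ext d
    simp only [mem_union, Nat.mem_divisors, mem_image]
    constructor
    · rintro ⟨h, -⟩
      by_cases hpd : p ∣ d
      · obtain ⟨e, rfl⟩ := hpd
        right
        exact ⟨e, ⟨Nat.dvd_of_mul_dvd_mul_left hp.pos h, ha⟩, rfl⟩
      · left
        have : d.Coprime p := ((Nat.Prime.coprime_iff_not_dvd hp).mpr hpd).symm
        exact ⟨this.dvd_of_dvd_mul_left h, ha⟩
    · rintro (⟨h, -⟩ | ⟨e, ⟨h, -⟩, rfl⟩)
      · exact ⟨h.mul_left p, mul_ne_zero hp.ne_zero ha⟩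
      · exact ⟨mul_dvd_mul_left p h, mul_ne_zero hp.ne_zero ha⟩
  have hdis : Disjoint a.divisors (a.divisors.image (fun d => p * d)) := by
    rw [disjoint_left]
    intro d hd hd2
    rw [mem_image] at hd2
    obtain ⟨e, _, rfl⟩ := hd2
    have : p ∣ a := (dvd_mul_right p e).trans (Nat.dvd_of_mem_divisors hd)
    exact (Nat.Prime.coprime_iff_not_dvd hp).mp hpa this
  rw [h1, sum_union hdis, sum_image (by intro x _ y _ h; exact Nat.eq_of_mul_eq_mul_left hp.pos h)]

lemma coprime_of_mem_div {p a d : ℕ} (hpa : p.Coprime a) (hd : d ∈ a.divisors) : p.Coprime d :=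
  hpa.coprime_dvd_right (Nat.dvd_of_mem_divisors hd)

lemma prod_pf_mul {p d : ℕ} (hp : p.Prime) (hpd : p.Coprime d) (h : ℕ → ℝ) :
    ∏ r ∈ (p * d).primeFactors, h r = h p * ∏ r ∈ d.primeFactors, h r := by
  rw [hpd.primeFactors_mul, prod_union hpd.disjoint_primeFactors, hp.primeFactors, prod_singleton]

lemma prod_one_add_div (h : ℕ → ℝ) (k : ℕ) (hk : Squarefree k) :
    ∏ p ∈ k.primeFactors, (1 + h p) = ∑ d ∈ k.divisors, ∏ p ∈ d.primeFactors, h p := by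
  induction k using induction_on_primes with
  | zero => simp at hk
  | one => simp
  | prime_mul p a hp ih =>
    rw [Nat.squarefree_mul_iff] at hk
    rw [sum_divisors_prime_mul' hp hk.2.2.ne_zero hk.1, prod_pf_mul hp hk.1 (fun p => 1 + h p), ih hk.2.2]
    have : ∑ d ∈ a.divisors, ∏ r ∈ (p * d).primeFactors, h r = h p * ∑ d ∈ a.divisors, ∏ r ∈ d.primeFactors, h r := by
      rw [mul_sum]
      exact sum_congr rfl (fun d hd => prod_pf_mul hp (coprime_of_mem_div hk.1 hd) h)
    rw [this]; ring

noncomputable def sf (N : ℕ) : Finset ℕ := (Ioc 0 N).filter Squarefree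

lemma mem_sf {N k : ℕ} : k ∈ sf N ↔ (0 < k ∧ k ≤ N) ∧ Squarefree k := by
  unfold sf; rw [mem_filter, mem_Ioc]

lemma sf_sum_le_prod (h : ℕ → ℝ) (hh : ∀ p, 0 ≤ h p) (N : ℕ) :
    ∑ d ∈ sf N, ∏ p ∈ d.primeFactors, h p ≤ ∏ p ∈ (Ioc 0 N).filter Nat.Prime, (1 + h p) := by
  rw [prod_one_add]
  have hinj : Set.InjOn Nat.primeFactors (sf N : Set ℕ) := by
    intro a ha b hb hab
    rw [mem_coe, mem_sf] at ha hb
    rw [← Nat.prod_primeFactors_of_squarefree ha.2, ← Nat.prod_primeFactors_of_squarefree hb.2, hab]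
  rw [← sum_image (f := fun t => ∏ p ∈ t, h p) hinj]
  apply sum_le_sum_of_subset_of_nonneg
  · intro t ht
    rw [mem_image] at ht
    obtain ⟨d, hd, rfl⟩ := ht
    rw [mem_sf] at hd
    rw [mem_powerset]
    intro p hp
    rw [mem_filter, mem_Ioc]
    have := Nat.prime_of_mem_primeFactors hp
    exact ⟨⟨this.pos, (Nat.le_of_mem_primeFactors hp).trans hd.1.2⟩, this⟩
  · intro t _ _
    exact prod_nonneg (fun p _ => hh p)

lemma sf_swap (a : ℕ → ℝ) (b : ℕ → ℝ) (ha : ∀ d, 0 ≤ a d) (hb : ∀ d, 0 ≤ b d) (N : ℕ) :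
    ∑ k ∈ sf N, b k * ∑ d ∈ k.divisors, a d ≤ ∑ d ∈ sf N, a d * ∑ m ∈ Ioc 0 (N / d), b (d * m) := by
  have h1 : ∀ k ∈ sf N, b k * ∑ d ∈ k.divisors, a d = ∑ d ∈ sf N, if d ∣ k then a d * b k else 0 := by
    intro k hk
    rw [mem_sf] at hk
    rw [mul_sum, ← sum_filter]
    have : k.divisors = (sf N).filter (fun d => d ∣ k) := by
      ext d
      rw [Nat.mem_divisors, mem_filter, mem_sf]
      constructor
      · rintro ⟨h, h0⟩
        have hd := Nat.pos_of_dvd_of_pos h hk.1.1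
        exact ⟨⟨⟨hd, (Nat.le_of_dvd hk.1.1 h).trans hk.1.2⟩, hk.2.squarefree_of_dvd h⟩, h⟩
      · rintro ⟨_, h⟩
        exact ⟨h, hk.1.1.ne'⟩
    rw [this]
    exact sum_congr rfl (fun d _ => mul_comm _ _)
  rw [sum_congr rfl h1, sum_comm]
  refine sum_le_sum (fun d hd => ?_)
  rw [mem_sf] at hd
  rw [← sum_filter, ← mul_sum]
  apply mul_le_mul_of_nonneg_left _ (ha d)
  rw [← sum_image (f := b) (s := Ioc 0 (N / d)) (g := fun m => d * m) (by intro x _ y _ h; exact Nat.eq_of_mul_eq_mul_left hd.1.1 h)]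
  apply sum_le_sum_of_subset_of_nonneg
  · intro k hk
    rw [mem_filter, mem_sf] at hk
    obtain ⟨⟨⟨hk1, hk2⟩, _⟩, m, rfl⟩ := hk
    rw [mem_image]
    refine ⟨m, ?_, rfl⟩
    rw [mem_Ioc, Nat.le_div_iff_mul_le hd.1.1]
    exact ⟨Nat.pos_of_mul_pos_left hk1, by linarith⟩
  · intro k _ _; exact hb k

lemma harm_le (N : ℕ) : ∑ m ∈ Ioc 0 N, 1 / (m:ℝ) ≤ 1 + log N := by
  have h := harmonic_le_one_add_log N
  rw [harmonic_eq_sum_Icc, icc_one_eq] at h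
  push_cast at h
  simpa [one_div] using h

lemma omega_pow_sum (j N : ℕ) (hN : 1 ≤ N) : ∑ d ∈ sf N, (∏ p ∈ d.primeFactors, (j:ℝ)) / d ≤ (1 + log N) ^ j := by
  induction j with
  | zero =>
    have hsub : ({1} : Finset ℕ) ⊆ sf N := by
      intro x hx; rw [mem_singleton] at hx; subst hx; rw [mem_sf]; exact ⟨⟨by norm_num, hN⟩, squarefree_one⟩
    rw [pow_zero, ← sum_subset hsub]
    · simp
    · intro d hd hd1
      rw [mem_sf] at hd
      rw [mem_singleton] at hd1
      have : d.primeFactors.Nonempty := by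
        rw [Nat.nonempty_primeFactors]; omega
      rw [prod_const, Nat.cast_zero, zero_pow (card_ne_zero.mpr this), zero_div]
  | succ j ih =>
    have hl : 0 ≤ log N := Real.log_nonneg (by exact_mod_cast hN)
    have h1 : ∑ d ∈ sf N, (∏ p ∈ d.primeFactors, ((j+1 : ℕ):ℝ)) / d = ∑ k ∈ sf N, (1 / (k:ℝ)) * ∑ d ∈ k.divisors, ∏ p ∈ d.primeFactors, (j:ℝ) := by
      refine sum_congr rfl (fun k hk => ?_)
      rw [mem_sf] at hk
      rw [← prod_one_add_div (fun _ => (j:ℝ)) k hk.2]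
      push_cast
      rw [add_comm (j:ℝ) 1]; ring
    rw [h1]
    refine (sf_swap _ (fun k => 1 / (k:ℝ)) (fun d => by positivity) (fun d => by positivity) N).trans ?_
    calc _ ≤ ∑ d ∈ sf N, (∏ p ∈ d.primeFactors, (j:ℝ)) / d * (1 + log N) := by
          refine sum_le_sum (fun d hd => ?_)
          rw [mem_sf] at hd
          have hd0 : (0:ℝ) < d := by exact_mod_cast hd.1.1
          have : ∑ m ∈ Ioc 0 (N / d), 1 / ((d * m : ℕ):ℝ) ≤ (1 / d) * (1 + log N) := by
            calc ∑ m ∈ Ioc 0 (N / d), 1 / ((d * m : ℕ):ℝ) = (1 / d) * ∑ m ∈ Ioc 0 (N / d), 1 / (m:ℝ) := by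
                  rw [mul_sum]
                  refine sum_congr rfl (fun m _ => ?_)
                  push_cast
                  rw [one_div_mul_one_div]
              _ ≤ (1 / d) * ∑ m ∈ Ioc 0 N, 1 / (m:ℝ) := by
                  gcongr
                  exact Nat.div_le_self N d
              _ ≤ _ := by
                  have := harm_le N
                  gcongr
          calc _ ≤ (∏ p ∈ d.primeFactors, (j:ℝ)) * ((1 / d) * (1 + log N)) := by gcongr
            _ = _ := by ring
      _ ≤ _ := by
          rw [← sum_mul, pow_succ]
          gcongr

lemma cK_sq_sum : ∃ C : ℝ, 0 < C ∧ ∀ N : ℕ, ∑ k ∈ sf N, cK k ^ 2 ≤ C * N := by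
  set h : ℕ → ℝ := fun p => 16 / Real.sqrt p
  have hh : ∀ p, 0 ≤ h p := fun p => by simp only [h]; positivity
  have hc : ∀ k, Squarefree k → cK k ^ 2 ≤ ∑ d ∈ k.divisors, ∏ p ∈ d.primeFactors, h p := by
    intro k hk
    rw [← prod_one_add_div h k hk, cK, ← prod_pow]
    apply prod_le_prod
    · intro p _; positivity
    · intro p hp
      have hp := Nat.prime_of_mem_primeFactors hp
      obtain ⟨h1, h2⟩ := sqrt_prime_lt hp.two_le
      have hp2 : (2:ℝ) ≤ p := by exact_mod_cast hp.two_le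
      have hs14 : (1.414:ℝ) ≤ Real.sqrt p := by
        apply Real.le_sqrt_of_sq_le
        norm_num; linarith
      simp only [h]
      set s := Real.sqrt p
      have e : (1 - 1 / s)⁻¹ = s / (s - 1) := by
        have : s - 1 ≠ 0 := by linarith
        field_simp
      have hs1 : 0 < s - 1 := by linarith
      have hs0 : 0 < s := by linarith
      rw [e, div_pow, show 1 + 16 / s = (s + 16) / s by field_simp, div_le_div_iff₀ (by positivity) (by positivity)]
      have : 0 ≤ (s - 1.414) * (14 * s - 11.2) := by
        apply mul_nonneg <;> linarith
      nlinarith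
  have hsum : Summable (fun n : ℕ => 16 / (n:ℝ) ^ (3/2 : ℝ)) := by
    have := (Real.summable_one_div_nat_rpow (p := 3/2)).mpr (by norm_num)
    simpa [div_eq_mul_inv] using this.mul_left 16
  refine ⟨exp (∑' n : ℕ, 16 / (n:ℝ) ^ (3/2 : ℝ)), Real.exp_pos _, fun N => ?_⟩
  calc ∑ k ∈ sf N, cK k ^ 2 ≤ ∑ k ∈ sf N, 1 * ∑ d ∈ k.divisors, ∏ p ∈ d.primeFactors, h p := by
        refine sum_le_sum (fun k hk => ?_)
        rw [mem_sf] at hk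
        rw [one_mul]; exact hc k hk.2
    _ ≤ ∑ d ∈ sf N, (∏ p ∈ d.primeFactors, h p) * ∑ m ∈ Ioc 0 (N / d), (1:ℝ) :=
        sf_swap _ (fun _ => 1) (fun d => prod_nonneg (fun p _ => hh p)) (fun _ => zero_le_one) N
    _ ≤ ∑ d ∈ sf N, (∏ p ∈ d.primeFactors, h p / p) * N := by
        refine sum_le_sum (fun d hd => ?_)
        rw [mem_sf] at hd
        have hd0 : (0:ℝ) < d := by exact_mod_cast hd.1.1
        have h1 : ∏ p ∈ d.primeFactors, h p / p = (∏ p ∈ d.primeFactors, h p) / d := by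
          rw [prod_div_distrib]
          congr 1
          rw [← Nat.cast_prod, Nat.prod_primeFactors_of_squarefree hd.2]
        rw [h1]
        have h2 : ∑ m ∈ Ioc 0 (N / d), (1:ℝ) ≤ N / d := by
          simp
          exact Nat.cast_div_le
        have : 0 ≤ ∏ p ∈ d.primeFactors, h p := prod_nonneg (fun p _ => hh p)
        calc _ ≤ (∏ p ∈ d.primeFactors, h p) * (N / d) := by gcongr
          _ = _ := by ring
    _ ≤ _ := by
        rw [← sum_mul]
        gcongr
        refine (sf_sum_le_prod (fun p => h p / p) (fun p => div_nonneg (hh p) (Nat.cast_nonneg p)) N).trans ?_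
        refine (Real.prod_one_add_le_exp_sum _ (fun p => div_nonneg (hh p) (Nat.cast_nonneg p))).trans ?_
        rw [Real.exp_le_exp]
        refine le_trans ?_ (hsum.sum_le_tsum ((Ioc 0 N).filter Nat.Prime) (fun n _ => by positivity))
        refine sum_le_sum (fun p hp => ?_)
        rw [mem_filter] at hp
        have hp0 : (0:ℝ) < p := by exact_mod_cast hp.2.pos
        apply le_of_eq
        simp only [h]
        rw [div_div, Real.sqrt_eq_rpow, show (3/2:ℝ) = 1/2 + 1 by norm_num, Real.rpow_add_one hp0.ne']

end

section
open Finset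

lemma block_sum {a : ℕ → ℝ} {C : ℝ} (hC : 0 < C) (ha : ∀ k, 0 ≤ a k) (hS : ∀ N : ℕ, ∑ k ∈ sf N, a k ≤ C * N)
    (b : ℝ → ℝ) (hb0 : ∀ z, 0 ≤ b z) (hb : ∀ z w, z ≤ w → b w ≤ b z) {y : ℝ} (hy : 1 ≤ y) :
    ∑ k ∈ sf ⌊y⌋₊, a k / k * b (y / k) ≤ C * exp 1 * ∑ j ∈ range (⌊log y⌋₊ + 1), b (exp j) := by
  have hy0 : 0 < y := by linarith
  have hmem : ∀ k ∈ sf ⌊y⌋₊, (0:ℝ) < k ∧ 1 ≤ y / k ∧ (1:ℝ) ≤ k := by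
    intro k hk
    rw [mem_sf] at hk
    have h0 : (0:ℝ) < k := by exact_mod_cast hk.1.1
    refine ⟨h0, ?_, by exact_mod_cast hk.1.1⟩
    rw [le_div_iff₀ h0, one_mul]
    exact (Nat.le_floor_iff' hk.1.1.ne').mp hk.1.2
  have hmaps : ∀ k ∈ sf ⌊y⌋₊, ⌊log (y / k)⌋₊ ∈ range (⌊log y⌋₊ + 1) := by
    intro k hk
    obtain ⟨h0, h1, h2⟩ := hmem k hk
    rw [mem_range, Nat.lt_succ_iff]
    apply Nat.floor_le_floor
    apply Real.log_le_log (by linarith)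
    exact div_le_self hy0.le h2
  rw [← sum_fiberwise_of_maps_to hmaps, mul_sum]
  refine sum_le_sum (fun j _ => ?_)
  set M := ⌊y * exp (-j)⌋₊
  calc ∑ k ∈ (sf ⌊y⌋₊).filter (fun k : ℕ => ⌊log (y / (k:ℝ))⌋₊ = j), a k / k * b (y / k)
      ≤ ∑ k ∈ (sf ⌊y⌋₊).filter (fun k : ℕ => ⌊log (y / (k:ℝ))⌋₊ = j), a k * (exp (j + 1) / y * b (exp j)) := by
        refine sum_le_sum (fun k hk => ?_)
        rw [mem_filter] at hk
        obtain ⟨h0, h1, h2⟩ := hmem k hk.1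
        have hl := Real.log_nonneg h1
        have hf1 : (j:ℝ) ≤ log (y / k) := by rw [← hk.2]; exact Nat.floor_le hl
        have hf2 : log (y / k) < j + 1 := by rw [← hk.2]; exact Nat.lt_floor_add_one _
        rw [Real.le_log_iff_exp_le (by linarith)] at hf1
        rw [Real.log_lt_iff_lt_exp (by linarith)] at hf2
        have e1 : 1 / (k:ℝ) ≤ exp (j + 1) / y := by
          rw [div_lt_iff₀ h0] at hf2
          rw [div_le_div_iff₀ h0 hy0]; linarith
        have e2 := hb _ _ hf1
        have e3 := ha k
        have e4 := hb0 (y / k)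
        calc a k / k * b (y / k) = a k * (1 / k * b (y / k)) := by ring
          _ ≤ _ := by gcongr
    _ = (∑ k ∈ (sf ⌊y⌋₊).filter (fun k : ℕ => ⌊log (y / (k:ℝ))⌋₊ = j), a k) * (exp (j + 1) / y * b (exp j)) := by rw [sum_mul]
    _ ≤ (C * M) * (exp (j + 1) / y * b (exp j)) := by
        have := hb0 (exp j)
        gcongr
        refine le_trans ?_ (hS M)
        apply sum_le_sum_of_subset_of_nonneg
        · intro k hk
          rw [mem_filter] at hk
          obtain ⟨h0, h1, h2⟩ := hmem k hk.1
          have hl := Real.log_nonneg h1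
          have hf1 : (j:ℝ) ≤ log (y / k) := by rw [← hk.2]; exact Nat.floor_le hl
          rw [Real.le_log_iff_exp_le (by linarith), le_div_iff₀ h0] at hf1
          have hk1 := (mem_sf.mp hk.1)
          rw [mem_sf]
          refine ⟨⟨hk1.1.1, ?_⟩, hk1.2⟩
          apply Nat.le_floor
          rw [Real.exp_neg, ← div_eq_mul_inv, le_div_iff₀ (Real.exp_pos _)]
          linarith
        · intro k _ _; exact ha k
    _ ≤ (C * (y * exp (-j))) * (exp (j + 1) / y * b (exp j)) := by
        have := hb0 (exp j)
        gcongr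
        exact Nat.floor_le (by positivity)
    _ = _ := by
        rw [Real.exp_add, Real.exp_neg]
        field_simp

lemma bB_anti (z w : ℝ) (h : z ≤ w) : bB w ≤ bB z := by
  unfold bB
  have := Real.log_nonneg (le_max_left 1 z)
  have h2 : log (max 1 z) ≤ log (max 1 w) := Real.log_le_log (by positivity) (max_le_max le_rfl h)
  gcongr

lemma bB_le_one (z : ℝ) : bB z ≤ 1 := by
  unfold bB
  have := Real.log_nonneg (le_max_left 1 z)
  rw [div_le_one (by positivity)]
  apply one_le_pow₀; linarith

lemma cB_sum : ∃ C : ℝ, 0 < C ∧ ∀ y : ℝ, 1 ≤ y → ∑ k ∈ sf ⌊y⌋₊, cK k ^ 2 / k * bB (y / k) ≤ C := by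
  obtain ⟨C, hC, hS⟩ := cK_sq_sum
  have hsm : Summable (fun j : ℕ => 1 / ((j + 1 : ℕ):ℝ) ^ 2) := by
    have := (Real.summable_one_div_nat_pow (p := 2)).mpr (by norm_num)
    exact (summable_nat_add_iff 1).mpr this
  refine ⟨C * exp 1 * (1 + ∑' j : ℕ, 1 / ((j + 1 : ℕ):ℝ) ^ 2), ?_, fun y hy => ?_⟩
  · have : 0 ≤ ∑' j : ℕ, 1 / ((j + 1 : ℕ):ℝ) ^ 2 := tsum_nonneg (fun j => by positivity)
    positivity
  refine (block_sum hC (fun k => sq_nonneg _) hS bB (fun z => (bB_pos z).le) bB_anti hy).trans ?_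
  gcongr
  have h1 : ∑ j ∈ range (⌊log y⌋₊ + 1), bB (exp j) ≤ ∑ j ∈ range (⌊log y⌋₊ + 1), 1 / ((j + 1 : ℕ):ℝ) ^ 2 := by
    refine sum_le_sum (fun j _ => ?_)
    unfold bB
    rw [max_eq_right (Real.one_le_exp (Nat.cast_nonneg j)), Real.log_exp]
    apply one_div_le_one_div_of_le (by positivity)
    push_cast
    have hj : (0:ℝ) ≤ j := Nat.cast_nonneg j
    calc ((j:ℝ) + 1) ^ 2 ≤ (20 + (j:ℝ)) ^ 2 := by gcongr ?_ ^ 2; linarith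
      _ ≤ (20 + (j:ℝ)) ^ 10 := pow_le_pow_right₀ (by linarith) (by norm_num)
  have h2 := hsm.sum_le_tsum (range (⌊log y⌋₊ + 1)) (fun j _ => by positivity)
  linarith

lemma c1_sum : ∃ C : ℝ, 0 < C ∧ ∀ y : ℝ, 1 ≤ y → ∑ k ∈ sf ⌊y⌋₊, cK k ^ 2 / k ≤ C * (1 + log y) := by
  obtain ⟨C, hC, hS⟩ := cK_sq_sum
  refine ⟨C * exp 1, by positivity, fun y hy => ?_⟩
  have h := block_sum hC (fun k => sq_nonneg (cK k)) hS (fun _ => 1) (fun z => zero_le_one) (fun _ _ _ => le_rfl) hy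
  simp only [mul_one, sum_const, card_range, nsmul_eq_mul] at h
  refine h.trans ?_
  gcongr
  push_cast
  linarith [Nat.floor_le (Real.log_nonneg hy)]

lemma sum_hyperbola (N : ℕ) (f : ℕ → ℕ → ℝ) :
    ∑ k ∈ Ioc 0 N, ∑ m ∈ Ioc 0 (N / k), f k m = ∑ n ∈ Ioc 0 N, ∑ k ∈ n.divisors, f k (n / k) := by
  have h1 : ∀ n ∈ Ioc 0 N, ∑ k ∈ n.divisors, f k (n / k) = ∑ k ∈ Ioc 0 N, if k ∣ n then f k (n / k) else 0 := by
    intro n hn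
    rw [mem_Ioc] at hn
    rw [← sum_filter]
    apply sum_congr _ (fun _ _ => rfl)
    ext k
    rw [Nat.mem_divisors, mem_filter, mem_Ioc]
    constructor
    · rintro ⟨h, _⟩
      exact ⟨⟨Nat.pos_of_dvd_of_pos h hn.1, (Nat.le_of_dvd hn.1 h).trans hn.2⟩, h⟩
    · rintro ⟨_, h⟩; exact ⟨h, hn.1.ne'⟩
  rw [sum_congr rfl h1, sum_comm]
  refine sum_congr rfl (fun k hk => ?_)
  rw [mem_Ioc] at hk
  rw [← sum_filter]
  have h2 : (Ioc 0 N).filter (fun n => k ∣ n) = (Ioc 0 (N / k)).image (fun m => k * m) := by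
    ext n
    simp only [mem_filter, mem_Ioc, mem_image]
    constructor
    · rintro ⟨⟨h1, h2⟩, m, rfl⟩
      refine ⟨m, ⟨Nat.pos_of_mul_pos_left h1, ?_⟩, rfl⟩
      rw [Nat.le_div_iff_mul_le hk.1]; linarith
    · rintro ⟨m, ⟨h1, h2⟩, rfl⟩
      rw [Nat.le_div_iff_mul_le hk.1] at h2
      refine ⟨⟨Nat.mul_pos hk.1 h1, by linarith⟩, dvd_mul_right _ _⟩
  rw [h2, sum_image (by intro x _ y _ h; exact Nat.eq_of_mul_eq_mul_left hk.1 h)]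
  refine sum_congr rfl (fun m _ => ?_)
  rw [Nat.mul_div_cancel_left m hk.1]

lemma sum_moebius_div (n : ℕ) (hn : 0 < n) : ∑ k ∈ n.divisors, (moebius (n / k) : ℝ) = if n = 1 then 1 else 0 := by
  rw [Nat.sum_div_divisors n (fun d => (moebius d : ℝ))]
  have h := congrArg (fun f : ArithmeticFunction ℤ => f n) ArithmeticFunction.moebius_mul_coe_zeta
  change (moebius * (ArithmeticFunction.zeta : ArithmeticFunction ℤ)) n = (1 : ArithmeticFunction ℤ) n at h
  rw [ArithmeticFunction.coe_mul_zeta_apply, ArithmeticFunction.one_apply] at h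
  have h2 : ((∑ i ∈ n.divisors, moebius i : ℤ) : ℝ) = ((if n = 1 then 1 else 0 : ℤ) : ℝ) := by rw [h]
  push_cast at h2
  exact h2

lemma sum_coprime_split (n : ℕ) (hn : 0 < n) :
    ∑ k ∈ n.divisors, (if Squarefree k then (if (n / k).Coprime k then (moebius (n / k) : ℝ) else 0) else 0) = if n = 1 then 1 else 0 := by
  by_cases hs : Squarefree n
  · rw [← sum_moebius_div n hn]
    refine sum_congr rfl (fun k hk => ?_)
    have hd := Nat.dvd_of_mem_divisors hk
    have h1 := hs.squarefree_of_dvd hd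
    have h2 : (n / k).Coprime k := by
      obtain ⟨m, rfl⟩ := hd
      have hk0 : 0 < k := Nat.pos_of_mul_pos_right hn
      rw [Nat.mul_div_cancel_left _ hk0]
      exact (Nat.squarefree_mul_iff.mp hs).1.symm
    rw [if_pos h1, if_pos h2]
  · have hn1 : n ≠ 1 := by rintro rfl; exact hs squarefree_one
    rw [if_neg hn1]
    refine sum_eq_zero (fun k hk => ?_)
    have hd := Nat.dvd_of_mem_divisors hk
    split_ifs with h1 h2
    · have : ¬ Squarefree (n / k) := by
        intro h3
        apply hs
        rw [← Nat.div_mul_cancel hd, Nat.squarefree_mul_iff]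
        exact ⟨h2, h3, h1⟩
      rw [ArithmeticFunction.moebius_eq_zero_of_not_squarefree this]; simp
    · rfl
    · rfl

lemma log_identity {D : ℝ} (hD : 1 ≤ D) : ∑ k ∈ sf ⌊D⌋₊, 1 / (k:ℝ) * SK lgp k (D / k) = log D := by
  set N := ⌊D⌋₊
  have hN : 1 ≤ N := (Nat.one_le_floor_iff _).mpr hD
  have h1 : ∑ k ∈ sf N, 1 / (k:ℝ) * SK lgp k (D / k) = ∑ k ∈ Ioc 0 N, ∑ m ∈ Ioc 0 (N / k),
      (if Squarefree k then (if m.Coprime k then (moebius m : ℝ) else 0) else 0) * (1 / ((k * m : ℕ) : ℝ) * lgp (D / (k * m : ℕ))) := by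
    unfold sf
    rw [sum_filter]
    refine sum_congr rfl (fun k hk => ?_)
    split_ifs with hs
    · unfold SK
      rw [Nat.floor_div_natCast, mul_sum]
      refine sum_congr rfl (fun m _ => ?_)
      push_cast
      rw [div_div]
      split_ifs <;> ring
    · simp
  rw [h1, sum_hyperbola N (fun k m => (if Squarefree k then (if m.Coprime k then (moebius m : ℝ) else 0) else 0) * (1 / ((k * m : ℕ) : ℝ) * lgp (D / (k * m : ℕ))))]
  have h2 : ∀ n ∈ Ioc 0 N, ∑ k ∈ n.divisors, (if Squarefree k then (if (n / k).Coprime k then (moebius (n / k) : ℝ) else 0) else 0) * (1 / ((k * (n / k) : ℕ) : ℝ) * lgp (D / (k * (n / k) : ℕ)))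
      = if n = 1 then log D else 0 := by
    intro n hn
    rw [mem_Ioc] at hn
    have : ∀ k ∈ n.divisors, (if Squarefree k then (if (n / k).Coprime k then (moebius (n / k) : ℝ) else 0) else 0) * (1 / ((k * (n / k) : ℕ) : ℝ) * lgp (D / (k * (n / k) : ℕ)))
        = (if Squarefree k then (if (n / k).Coprime k then (moebius (n / k) : ℝ) else 0) else 0) * (1 / (n : ℝ) * lgp (D / n)) := by
      intro k hk
      rw [Nat.mul_div_cancel' (Nat.dvd_of_mem_divisors hk)]
    rw [sum_congr rfl this, ← sum_mul, sum_coprime_split n hn.1]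
    split_ifs with h
    · subst h
      simp [lgp, hD]
    · simp
  rw [sum_congr rfl h2, sum_ite_eq' (Ioc 0 N) 1, if_pos (by rw [mem_Ioc]; omega)]

noncomputable def phiS (k : ℕ) : ℝ := if Squarefree k then 1 / (k.totient : ℝ) else 0

lemma phiS_nonneg (k : ℕ) : 0 ≤ phiS k := by unfold phiS; split_ifs <;> positivity

lemma sum_sf (N : ℕ) (f : ℕ → ℝ) : ∑ k ∈ sf N, f k = ∑ k ∈ Ioc 0 N, if Squarefree k then f k else 0 := by
  unfold sf; rw [sum_filter]

lemma phiS_sum : ∃ C : ℝ, 0 < C ∧ ∀ D : ℝ, 1 ≤ D → |∑ k ∈ Ioc 0 ⌊D⌋₊, phiS k - log D| ≤ C := by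
  obtain ⟨C, hC, hb⟩ := SK_bound
  obtain ⟨C', hC', hs⟩ := cB_sum
  refine ⟨C * C', by positivity, fun D hD => ?_⟩
  have h1 : ∑ k ∈ Ioc 0 ⌊D⌋₊, phiS k = ∑ k ∈ sf ⌊D⌋₊, 1 / (k:ℝ) * gK k := by
    rw [sum_sf]
    refine sum_congr rfl (fun k hk => ?_)
    rw [mem_Ioc] at hk
    unfold phiS gK
    have : (k:ℝ) ≠ 0 := by exact_mod_cast hk.1.ne'
    split_ifs
    · field_simp
    · rfl
  rw [h1, ← log_identity hD, ← sum_sub_distrib]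
  refine (abs_sum_le_sum_abs _ _).trans ?_
  calc _ ≤ ∑ k ∈ sf ⌊D⌋₊, C * (cK k ^ 2 / k * bB (D / k)) := by
        refine sum_le_sum (fun k hk => ?_)
        rw [mem_sf] at hk
        have h2 := (hb k hk.2 (D / k)).2
        have h3 := one_le_cK k
        have h4 := bB_pos (D / k)
        rw [← mul_sub, abs_mul, abs_of_nonneg (by positivity), abs_sub_comm]
        calc 1 / (k:ℝ) * |SK lgp k (D / k) - gK k| ≤ 1 / (k:ℝ) * (cK k ^ 2 * (C * bB (D / k))) := by
              gcongr
              refine h2.trans ?_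
              gcongr
              nlinarith
          _ = _ := by ring
    _ ≤ _ := by
        rw [← mul_sum]
        have := hs D hD
        gcongr

end

section
open Finset MeasureTheory

lemma phiS_zero : phiS 0 = 0 := by
  unfold phiS; rw [if_neg not_squarefree_zero]

lemma phiS_log_sum : ∃ C : ℝ, 0 < C ∧ ∀ U V : ℝ, 1 ≤ U → U ≤ V →
    |∑ k ∈ Ioc ⌊U⌋₊ ⌊V⌋₊, (log V - log k) * phiS k - log (V / U) ^ 2 / 2| ≤ C * log (V / U) := by
  obtain ⟨C, hC, hS⟩ := phiS_sum
  refine ⟨2 * C, by positivity, fun U V hU hUV => ?_⟩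
  have hU0 : 0 < U := by linarith
  have hV0 : 0 < V := by linarith
  have hder : ∀ t : ℝ, deriv (fun t => log V - log t) t = - t⁻¹ := by
    intro t
    rw [deriv_const_sub, Real.deriv_log]
  have hlam : log (V / U) = log V - log U := Real.log_div hV0.ne' hU0.ne'
  have hlam0 : 0 ≤ log (V / U) := by rw [hlam]; linarith [Real.log_le_log hU0 hUV]
  have hci : IntegrableOn (fun t : ℝ => t⁻¹) (Set.Icc U V) := by
    apply ContinuousOn.integrableOn_Icc
    apply ContinuousOn.inv₀ continuousOn_id
    intro x hx; simp only [id]; linarith [hx.1]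
  have hint := integrableOn_mul_sum_Icc phiS (m := 0) hU0.le hci
  have key := sum_mul_eq_sub_sub_integral_mul phiS (f := fun t => log V - log t) (a := U) (b := V) hU0.le hUV
    (by
      intro t ht
      apply DifferentiableAt.const_sub
      exact Real.differentiableAt_log (by linarith [ht.1]))
    (by
      have h : deriv (fun t => log V - log t) = fun t => - t⁻¹ := funext hder
      rw [h]
      exact hci.neg)
  simp only [hder, sub_self, zero_mul] at key
  rw [key]
  have hE : ∀ t : ℝ, 1 ≤ t → |∑ k ∈ Icc 0 ⌊t⌋₊, phiS k - log t| ≤ C := by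
    intro t ht
    rw [sum_icc_zero phiS phiS_zero]; exact hS t ht
  have hiU := hE U hU
  set SU := ∑ k ∈ Icc 0 ⌊U⌋₊, phiS k
  have hneg : ∫ t in Set.Ioc U V, -t⁻¹ * ∑ k ∈ Icc 0 ⌊t⌋₊, phiS k = - ∫ t in Set.Ioc U V, t⁻¹ * ∑ k ∈ Icc 0 ⌊t⌋₊, phiS k := by
    rw [← integral_neg]
    congr 1; ext t; ring
  rw [hneg]
  have hI1 : ∫ t in Set.Ioc U V, t⁻¹ = log (V / U) := by
    rw [← intervalIntegral.integral_of_le hUV, integral_inv_of_pos hU0 hV0]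
  have hI2 : ∫ t in Set.Ioc U V, t⁻¹ * log t = (log V ^ 2 - log U ^ 2) / 2 := by
    rw [← intervalIntegral.integral_of_le hUV]
    rw [intervalIntegral.integral_eq_sub_of_hasDerivAt (f := fun t => log t ^ 2 / 2)]
    · ring
    · intro t ht
      rw [Set.uIcc_of_le hUV] at ht
      have := ((Real.hasDerivAt_log (x := t) (by linarith [ht.1])).pow 2).div_const 2
      refine HasDerivAt.congr_deriv this ?_
      norm_num
      ring
    · apply ContinuousOn.intervalIntegrable
      rw [Set.uIcc_of_le hUV]
      apply ContinuousOn.mul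
      · apply ContinuousOn.inv₀ continuousOn_id
        intro x hx; simp only [id]; linarith [hx.1]
      · apply ContinuousOn.log continuousOn_id
        intro x hx; simp only [id]; linarith [hx.1]
  have hc2 : IntegrableOn (fun t : ℝ => t⁻¹ * log t) (Set.Ioc U V) := by
    apply IntegrableOn.mono_set _ Set.Ioc_subset_Icc_self
    apply ContinuousOn.integrableOn_Icc
    apply ContinuousOn.mul
    · apply ContinuousOn.inv₀ continuousOn_id
      intro x hx; simp only [id]; linarith [hx.1]
    · apply ContinuousOn.log continuousOn_id
      intro x hx; simp only [id]; linarith [hx.1]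
  have hc1 : IntegrableOn (fun t : ℝ => t⁻¹) (Set.Ioc U V) := hci.mono_set Set.Ioc_subset_Icc_self
  have hint' : IntegrableOn (fun t : ℝ => t⁻¹ * ∑ k ∈ Icc 0 ⌊t⌋₊, phiS k) (Set.Ioc U V) := hint.mono_set Set.Ioc_subset_Icc_self
  have hdiff : |(∫ t in Set.Ioc U V, t⁻¹ * ∑ k ∈ Icc 0 ⌊t⌋₊, phiS k) - (log V ^ 2 - log U ^ 2) / 2| ≤ C * log (V / U) := by
    rw [← hI2, ← integral_sub hint' hc2, ← hI1, ← integral_const_mul]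
    rw [← Real.norm_eq_abs]
    apply norm_integral_le_of_norm_le (hc1.const_mul C)
    rw [ae_restrict_iff' measurableSet_Ioc]
    refine Filter.Eventually.of_forall (fun t ht => ?_)
    have ht0 : 0 < t := by linarith [ht.1]
    rw [← mul_sub, Real.norm_eq_abs, abs_mul, abs_of_pos (inv_pos.mpr ht0), mul_comm C]
    have := hE t (by linarith [ht.1])
    gcongr
  set I := ∫ t in Set.Ioc U V, t⁻¹ * ∑ k ∈ Icc 0 ⌊t⌋₊, phiS k
  have e : 0 - (log V - log U) * SU - -I - log (V / U) ^ 2 / 2 =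
     (I - (log V ^ 2 - log U ^ 2) / 2) - log (V / U) * (SU - log U) := by rw [hlam]; ring
  rw [e]
  refine (abs_sub _ _).trans ?_
  rw [abs_mul, abs_of_nonneg hlam0]
  nlinarith [mul_le_mul_of_nonneg_left hiU hlam0]

noncomputable def kap' (k : ℕ) : ℝ := ∑ p ∈ k.primeFactors, (p:ℝ) * log p / (p - 1)
noncomputable def kap (k : ℕ) : ℝ := ∑ p ∈ k.primeFactors, log p / ((p:ℝ) - 1)

lemma kap'_eq (k : ℕ) (hk : Squarefree k) : kap' k = log k + kap k := by
  unfold kap' kap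
  have h1 : log k = ∑ p ∈ k.primeFactors, log (p:ℝ) := by
    conv_lhs => rw [← Nat.prod_primeFactors_of_squarefree hk]
    rw [Nat.cast_prod, Real.log_prod]
    intro p hp
    have := (Nat.prime_of_mem_primeFactors hp).pos
    exact_mod_cast this.ne'
  rw [h1, ← sum_add_distrib]
  refine sum_congr rfl (fun p hp => ?_)
  have h2 : (2:ℝ) ≤ p := by exact_mod_cast (Nat.prime_of_mem_primeFactors hp).two_le
  have : (p:ℝ) - 1 ≠ 0 := by linarith
  field_simp
  ring

lemma kap_nonneg (k : ℕ) : 0 ≤ kap k := by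
  refine sum_nonneg (fun p hp => ?_)
  have h2 : (2:ℝ) ≤ p := by exact_mod_cast (Nat.prime_of_mem_primeFactors hp).two_le
  apply div_nonneg (Real.log_nonneg (by linarith)) (by linarith)

lemma kap_le_log (k : ℕ) (hk : Squarefree k) : kap k ≤ log k := by
  have h1 : log k = ∑ p ∈ k.primeFactors, log (p:ℝ) := by
    conv_lhs => rw [← Nat.prod_primeFactors_of_squarefree hk]
    rw [Nat.cast_prod, Real.log_prod]
    intro p hp
    have := (Nat.prime_of_mem_primeFactors hp).pos
    exact_mod_cast this.ne'
  rw [h1]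
  refine sum_le_sum (fun p hp => ?_)
  have h2 : (2:ℝ) ≤ p := by exact_mod_cast (Nat.prime_of_mem_primeFactors hp).two_le
  apply div_le_self (Real.log_nonneg (by linarith)) (by linarith)

lemma sum_le_prod_one_add (s : Finset ℕ) (h : ℕ → ℝ) (hh : ∀ i ∈ s, 0 ≤ h i) : ∑ i ∈ s, h i ≤ ∏ i ∈ s, (1 + h i) := by
  have : 1 + ∑ i ∈ s, h i ≤ ∏ i ∈ s, (1 + h i) := by
    induction s using Finset.induction_on with
    | empty => simp
    | insert a s ha ih =>
      rw [sum_insert ha, prod_insert ha]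
      have h1 := ih (fun i hi => hh i (mem_insert_of_mem hi))
      have h2 := hh a (mem_insert_self _ _)
      have h3 : 0 ≤ ∑ i ∈ s, h i := sum_nonneg (fun i hi => hh i (mem_insert_of_mem hi))
      nlinarith
  linarith

lemma kap_le_cK (k : ℕ) : kap k ≤ 2 * cK k := by
  have h1 : kap k ≤ ∑ p ∈ k.primeFactors, 2 * (1 / √(p:ℝ)) := by
    refine sum_le_sum (fun p hp => ?_)
    have h2 : (2:ℝ) ≤ p := by exact_mod_cast (Nat.prime_of_mem_primeFactors hp).two_le
    have hs0 : 0 < √(p:ℝ) := Real.sqrt_pos.mpr (by linarith)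
    have hss := Real.mul_self_sqrt (show (0:ℝ) ≤ p by linarith)
    have hs1 : 1 < √(p:ℝ) := by nlinarith
    have hl : log p ≤ 2 * (√(p:ℝ) - 1) := by
      have := Real.log_le_sub_one_of_pos hs0
      rw [Real.log_sqrt (by linarith)] at this
      linarith
    rw [div_le_iff₀ (by linarith)]
    have : 2 * (1 / √(p:ℝ)) * (p - 1) = 2 * (√(p:ℝ) - 1) * ((√(p:ℝ) + 1) / √(p:ℝ)) := by
      field_simp
      nlinarith
    rw [this]
    have h3 : 1 ≤ (√(p:ℝ) + 1) / √(p:ℝ) := by rw [le_div_iff₀ hs0]; linarith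
    nlinarith
  refine h1.trans ?_
  rw [← mul_sum]
  gcongr
  refine (sum_le_prod_one_add _ _ (fun i _ => by positivity)).trans ?_
  unfold cK
  apply prod_le_prod
  · intro i _; positivity
  · intro p hp
    have h2 : (2:ℝ) ≤ p := by exact_mod_cast (Nat.prime_of_mem_primeFactors hp).two_le
    have hs0 : 0 < √(p:ℝ) := Real.sqrt_pos.mpr (by linarith)
    have hss := Real.mul_self_sqrt (show (0:ℝ) ≤ p by linarith)
    have hs1 : 1 < √(p:ℝ) := by nlinarith
    have h3 : 1 / √(p:ℝ) < 1 := by rw [div_lt_one hs0]; exact hs1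
    have h4 : 0 < 1 / √(p:ℝ) := by positivity
    rw [le_inv_comm₀ (by positivity) (by linarith), ← one_div, le_div_iff₀ (by linarith)]
    nlinarith

lemma kap'_mul {p a : ℕ} (hp : p.Prime) (ha : a ≠ 0) (hpa : p.Coprime a) : kap' (p * a) = p * log p / (p - 1) + kap' a := by
  unfold kap'
  rw [Nat.primeFactors_mul hp.ne_zero ha, Nat.Prime.primeFactors hp, sum_union]
  · simp
  · rw [disjoint_singleton_left]
    intro h
    exact (hp.coprime_iff_not_dvd.mp hpa) (Nat.dvd_of_mem_primeFactors h)

lemma sum_phi_kap (g : ℕ) (hg : Squarefree g) : (g:ℝ) * log g = ∑ k ∈ g.divisors, (k.totient:ℝ) * kap' k := by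
  induction g using induction_on_primes with
  | zero => exact absurd hg not_squarefree_zero
  | one => simp [kap']
  | prime_mul p a hp ih =>
    have hs := Nat.squarefree_mul_iff.mp hg
    have ha : a ≠ 0 := by rintro rfl; exact not_squarefree_zero hs.2.2
    have hpa := hs.1
    rw [sum_divisors_prime_mul' hp ha hpa]
    have h1 : ∀ d ∈ a.divisors, ((p * d).totient:ℝ) * kap' (p * d) = p * log p * (d.totient:ℝ) + (p - 1) * ((d.totient:ℝ) * kap' d) := by
      intro d hd
      have hd' := Nat.dvd_of_mem_divisors hd
      have hpd : p.Coprime d := Nat.Coprime.coprime_dvd_right hd' hpa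
      have hd0 : d ≠ 0 := fun h => ha (by subst h; exact zero_dvd_iff.mp hd')
      rw [Nat.totient_mul hpd, kap'_mul hp hd0 hpd, Nat.totient_prime hp]
      have h2 : (2:ℝ) ≤ p := by exact_mod_cast hp.two_le
      push_cast [hp.one_le]
      have : (p:ℝ) - 1 ≠ 0 := by linarith
      field_simp
    rw [sum_congr rfl h1, sum_add_distrib, ← mul_sum, ← mul_sum, ← ih hs.2.2]
    have h3 : ∑ d ∈ a.divisors, (d.totient:ℝ) = a := by
      rw [← Nat.cast_sum, Nat.sum_totient]
    rw [h3]
    push_cast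
    rw [Real.log_mul (by exact_mod_cast hp.ne_zero) (by exact_mod_cast ha)]
    ring

lemma tau_cK (d : ℕ) (hd : Squarefree d) : (d.divisors.card : ℝ) * cK d ≤ ∏ p ∈ d.primeFactors, ((8:ℕ):ℝ) := by
  have h1 : (d.divisors.card : ℝ) = ∏ p ∈ d.primeFactors, (2:ℝ) := by
    have := prod_one_add_div (fun _ => (1:ℝ)) d hd
    simp only [prod_const_one, sum_const, nsmul_eq_mul, mul_one] at this
    rw [← this]; norm_num
  rw [h1, cK, ← prod_mul_distrib]
  apply prod_le_prod
  · intro p hp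
    have h2 : (2:ℝ) ≤ p := by exact_mod_cast (Nat.prime_of_mem_primeFactors hp).two_le
    have hs0 : 0 < √(p:ℝ) := Real.sqrt_pos.mpr (by linarith)
    have hss := Real.mul_self_sqrt (show (0:ℝ) ≤ p by linarith)
    have hs1 : 1 < √(p:ℝ) := by nlinarith
    have h3 : 1 / √(p:ℝ) < 1 := by rw [div_lt_one hs0]; exact hs1
    have : 0 < 1 - 1 / √(p:ℝ) := by linarith
    positivity
  · intro p hp
    have h2 : (2:ℝ) ≤ p := by exact_mod_cast (Nat.prime_of_mem_primeFactors hp).two_le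
    have hs0 : 0 < √(p:ℝ) := Real.sqrt_pos.mpr (by linarith)
    have hss := Real.mul_self_sqrt (show (0:ℝ) ≤ p by linarith)
    have hs1 : 4/3 < √(p:ℝ) := by nlinarith
    have h3 : 1 / √(p:ℝ) ≤ 3/4 := by rw [div_le_iff₀ hs0]; linarith
    have h4 : (1 - 1 / √(p:ℝ))⁻¹ ≤ 4 := by
      rw [inv_le_comm₀ (by linarith) (by norm_num)]; linarith
    push_cast
    linarith

lemma tau_c_sum (N : ℕ) (hN : 1 ≤ N) : ∑ d ∈ sf N, (d.divisors.card : ℝ) * cK d / d ≤ (1 + log N) ^ 8 := by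
  refine le_trans ?_ (omega_pow_sum 8 N hN)
  refine sum_le_sum (fun d hd => ?_)
  have := tau_cK d (mem_sf.mp hd).2
  gcongr

end

section
open Finset

lemma filter_dvd_eq (N k : ℕ) (hk : 0 < k) :
    (Ioc 0 N).filter (fun n => k ∣ n) = (Ioc 0 (N / k)).image (fun m => k * m) := by
  ext n
  simp only [mem_filter, mem_Ioc, mem_image]
  constructor
  · rintro ⟨⟨h1, h2⟩, m, rfl⟩
    refine ⟨m, ⟨Nat.pos_of_mul_pos_left h1, ?_⟩, rfl⟩
    rw [Nat.le_div_iff_mul_le hk]; linarith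
  · rintro ⟨m, ⟨h1, h2⟩, rfl⟩
    rw [Nat.le_div_iff_mul_le hk] at h2
    refine ⟨⟨Nat.mul_pos hk h1, by linarith⟩, dvd_mul_right _ _⟩

lemma sum_dvd_eq (N k : ℕ) (hk : 0 < k) (f : ℕ → ℝ) :
    ∑ n ∈ Ioc 0 N, (if k ∣ n then f n else 0) = ∑ m ∈ Ioc 0 (N / k), f (k * m) := by
  rw [← sum_filter, filter_dvd_eq N k hk, sum_image (by intro x _ y _ h; exact Nat.eq_of_mul_eq_mul_left hk h)]

lemma SK_extend (φ : ℝ → ℝ) (hφ : ∀ z, z < 1 → φ z = 0) (k : ℕ) (y : ℝ) (M : ℕ) (hM : ⌊y⌋₊ ≤ M) :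
    SK φ k y = ∑ n ∈ Ioc 0 M, if n.Coprime k then (moebius n : ℝ) / n * φ (y / n) else 0 := by
  unfold SK
  apply sum_subset
  · exact Ioc_subset_Ioc_right hM
  · intro n hn hn'
    rw [mem_Ioc] at hn hn'
    have h1 : ⌊y⌋₊ < n := by
      by_contra h; exact hn' ⟨hn.1, by omega⟩
    have h2 : y < n := (Nat.floor_lt' hn.1.ne').mp h1
    have h3 : (0:ℝ) < n := by exact_mod_cast hn.1
    rw [hφ (y / n) (by rw [div_lt_one h3]; exact h2)]
    simp

lemma multiples_sum (φ : ℝ → ℝ) (hφ : ∀ z, z < 1 → φ z = 0) {W V : ℝ} (hWV : W ≤ V) (k : ℕ) (hk : 0 < k) :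
    ∑ d ∈ Ioc 0 ⌊V⌋₊, (if k ∣ d then (moebius d : ℝ) / d * φ (W / d) else 0)
      = (moebius k : ℝ) / k * SK φ k (W / k) := by
  rw [sum_dvd_eq _ k hk (fun d => (moebius d : ℝ) / d * φ (W / d))]
  rw [SK_extend φ hφ k (W / k) (⌊V⌋₊ / k) (by
    rw [Nat.floor_div_natCast]
    exact Nat.div_le_div_right (Nat.floor_le_floor hWV)), mul_sum]
  refine sum_congr rfl (fun m _ => ?_)
  by_cases hc : m.Coprime k
  · rw [if_pos hc, ArithmeticFunction.isMultiplicative_moebius.map_mul_of_coprime hc.symm]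
    push_cast
    rw [div_div]
    ring
  · rw [if_neg hc]
    have : ¬ Squarefree (k * m) := by
      intro h
      exact hc (Nat.squarefree_mul_iff.mp h).1.symm
    rw [ArithmeticFunction.moebius_eq_zero_of_not_squarefree this]
    simp

noncomputable def psiR (U V : ℝ) (d : ℕ) : ℝ := (moebius d : ℝ) * (lgp (V / d) - lgp (U / d)) / log (V / U)

lemma lgp_lt_one (z : ℝ) (h : z < 1) : lgp z = 0 := by unfold lgp; rw [if_neg (not_le.mpr h)]

lemma lgp_log (W : ℝ) (d : ℕ) (hd : 0 < d) : lgp (W / d) * log d = log W * lgp (W / d) - lgp (W / d) ^ 2 := by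
  unfold lgp
  have hd' : (0:ℝ) < d := by exact_mod_cast hd
  split_ifs with h
  · have hW : 0 < W := by
      rw [le_div_iff₀ hd'] at h; linarith
    rw [Real.log_div hW.ne' hd'.ne']; ring
  · ring

noncomputable def yA (ψ : ℕ → ℝ) (N k : ℕ) : ℝ := ∑ d ∈ Ioc 0 N, if k ∣ d then ψ d / d else 0
noncomputable def yB (ψ : ℕ → ℝ) (N k : ℕ) : ℝ := ∑ d ∈ Ioc 0 N, if k ∣ d then ψ d / d * log d else 0

lemma yA_eq {U V : ℝ} (hUV : U ≤ V) (k : ℕ) (hk : 0 < k) :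
    yA (psiR U V) ⌊V⌋₊ k = (moebius k : ℝ) / (k * log (V / U)) * (SK lgp k (V / k) - SK lgp k (U / k)) := by
  have h1 := multiples_sum lgp lgp_lt_one (le_refl V) k hk
  have h2 := multiples_sum lgp lgp_lt_one hUV k hk
  have : yA (psiR U V) ⌊V⌋₊ k = (1 / log (V / U)) * (∑ d ∈ Ioc 0 ⌊V⌋₊, (if k ∣ d then (moebius d : ℝ) / d * lgp (V / d) else 0)
      - ∑ d ∈ Ioc 0 ⌊V⌋₊, (if k ∣ d then (moebius d : ℝ) / d * lgp (U / d) else 0)) := by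
    unfold yA
    rw [← sum_sub_distrib, mul_sum]
    refine sum_congr rfl (fun d _ => ?_)
    unfold psiR
    split_ifs
    · ring
    · ring
  rw [this, h1, h2]
  rw [← div_div]
  ring

lemma yB_eq {U V : ℝ} (hUV : U ≤ V) (k : ℕ) (hk : 0 < k) :
    yB (psiR U V) ⌊V⌋₊ k = (moebius k : ℝ) / (k * log (V / U)) *
      (log V * SK lgp k (V / k) - SK (fun z => lgp z ^ 2) k (V / k) - log U * SK lgp k (U / k) + SK (fun z => lgp z ^ 2) k (U / k)) := by
  have hz : ∀ z, z < 1 → (fun z => lgp z ^ 2) z = 0 := by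
    intro z hz; simp [lgp_lt_one z hz]
  have h1 := multiples_sum lgp lgp_lt_one (le_refl V) k hk
  have h2 := multiples_sum lgp lgp_lt_one hUV k hk
  have h3 := multiples_sum _ hz (le_refl V) k hk
  have h4 := multiples_sum _ hz hUV k hk
  have : yB (psiR U V) ⌊V⌋₊ k = (1 / log (V / U)) * (
      log V * (∑ d ∈ Ioc 0 ⌊V⌋₊, (if k ∣ d then (moebius d : ℝ) / d * lgp (V / d) else 0))
      - (∑ d ∈ Ioc 0 ⌊V⌋₊, (if k ∣ d then (moebius d : ℝ) / d * lgp (V / d) ^ 2 else 0))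
      - log U * (∑ d ∈ Ioc 0 ⌊V⌋₊, (if k ∣ d then (moebius d : ℝ) / d * lgp (U / d) else 0))
      + (∑ d ∈ Ioc 0 ⌊V⌋₊, (if k ∣ d then (moebius d : ℝ) / d * lgp (U / d) ^ 2 else 0))) := by
    unfold yB
    rw [mul_sum, mul_sum, ← sum_sub_distrib, ← sum_sub_distrib, ← sum_add_distrib, mul_sum]
    refine sum_congr rfl (fun d hd => ?_)
    rw [mem_Ioc] at hd
    unfold psiR
    split_ifs
    · have e1 := lgp_log V d hd.1
      have e2 := lgp_log U d hd.1
      calc _ = (1 / log (V / U)) * ((moebius d : ℝ) / d * ((lgp (V / d) * log d) - (lgp (U / d) * log d))) := by ring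
        _ = _ := by rw [e1, e2]; ring
    · ring
  rw [this, h1, h2, h3, h4]
  rw [← div_div]
  ring

lemma quad_form (ψ : ℕ → ℝ) (hψ : ∀ d, ¬ Squarefree d → ψ d = 0) (N : ℕ) (ℓ : ℝ) :
    ∑ d ∈ Ioc 0 N, ∑ e ∈ Ioc 0 N, ψ d * ψ e / (d.lcm e : ℕ) * (ℓ - log (d.lcm e : ℕ)) =
    ∑ k ∈ sf N, (k.totient : ℝ) * (ℓ * yA ψ N k ^ 2 - 2 * yA ψ N k * yB ψ N k + kap' k * yA ψ N k ^ 2) := by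
  have h1 : ∀ d ∈ Ioc 0 N, ∀ e ∈ Ioc 0 N, ψ d * ψ e / (d.lcm e : ℕ) * (ℓ - log (d.lcm e : ℕ)) =
      ∑ k ∈ sf N, (k.totient : ℝ) * ((if k ∣ d then ψ d / d else 0) * (if k ∣ e then ψ e / e else 0) * (ℓ + kap' k)
        - (if k ∣ d then ψ d / d * log d else 0) * (if k ∣ e then ψ e / e else 0)
        - (if k ∣ d then ψ d / d else 0) * (if k ∣ e then ψ e / e * log e else 0)) := by
    intro d hd e he
    rw [mem_Ioc] at hd he
    by_cases hs : Squarefree d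
    swap
    · rw [hψ d hs]; simp
    set g := d.gcd e with hg
    have hg0 : 0 < g := Nat.gcd_pos_of_pos_left _ hd.1
    have hgs : Squarefree g := hs.squarefree_of_dvd (Nat.gcd_dvd_left d e)
    have hd0 : (0:ℝ) < d := by exact_mod_cast hd.1
    have he0 : (0:ℝ) < e := by exact_mod_cast he.1
    have hg0' : (0:ℝ) < g := by exact_mod_cast hg0
    have hl0 : (0:ℝ) < (d.lcm e : ℕ) := by exact_mod_cast Nat.lcm_pos hd.1 he.1
    have hgl : (g:ℝ) * (d.lcm e : ℕ) = d * e := by exact_mod_cast Nat.gcd_mul_lcm d e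
    have hl : ((d.lcm e : ℕ) : ℝ) = d * e / g := by rw [eq_div_iff hg0'.ne']; linarith
    have hR : ∑ k ∈ sf N, (k.totient : ℝ) * ((if k ∣ d then ψ d / d else 0) * (if k ∣ e then ψ e / e else 0) * (ℓ + kap' k)
        - (if k ∣ d then ψ d / d * log d else 0) * (if k ∣ e then ψ e / e else 0)
        - (if k ∣ d then ψ d / d else 0) * (if k ∣ e then ψ e / e * log e else 0))
        = ∑ k ∈ g.divisors, (ψ d / d * (ψ e / e) * (ℓ - log d - log e) * (k.totient : ℝ) + ψ d / d * (ψ e / e) * ((k.totient : ℝ) * kap' k)) := by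
      have hsub : g.divisors ⊆ sf N := by
        intro k hk
        have hk' := Nat.dvd_of_mem_divisors hk
        rw [mem_sf]
        refine ⟨⟨Nat.pos_of_dvd_of_pos hk' hg0, ?_⟩, hgs.squarefree_of_dvd hk'⟩
        exact ((Nat.le_of_dvd hd.1 (hk'.trans (Nat.gcd_dvd_left d e)))).trans hd.2
      rw [← sum_subset hsub]
      · refine sum_congr rfl (fun k hk => ?_)
        have hk' := Nat.dvd_of_mem_divisors hk
        have e1 := hk'.trans (Nat.gcd_dvd_left d e)
        have e2 := hk'.trans (Nat.gcd_dvd_right d e)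
        rw [if_pos e1, if_pos e2, if_pos e1, if_pos e2]
        ring
      · intro k _ hk
        have : ¬ (k ∣ d ∧ k ∣ e) := by
          intro h
          exact hk (Nat.mem_divisors.mpr ⟨Nat.dvd_gcd h.1 h.2, hg0.ne'⟩)
        by_cases h1 : k ∣ d
        · have h2 : ¬ k ∣ e := fun h => this ⟨h1, h⟩
          simp [h2]
        · simp [h1]
    rw [hR, sum_add_distrib, ← mul_sum, ← mul_sum, ← sum_phi_kap g hgs, ← Nat.cast_sum, Nat.sum_totient, hl]
    rw [Real.log_div (by positivity) hg0'.ne', Real.log_mul hd0.ne' he0.ne']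
    field_simp
    ring
  rw [sum_congr rfl (fun d hd => sum_congr rfl (h1 d hd))]
  rw [sum_congr rfl (fun d hd => sum_comm), sum_comm]
  refine sum_congr rfl (fun k _ => ?_)
  simp only [← mul_sum]
  congr 1
  have e1 : yA ψ N k * yA ψ N k = ∑ d ∈ Ioc 0 N, ∑ e ∈ Ioc 0 N, (if k ∣ d then ψ d / d else 0) * (if k ∣ e then ψ e / e else 0) := by
    unfold yA; rw [sum_mul_sum]
  have e2 : yB ψ N k * yA ψ N k = ∑ d ∈ Ioc 0 N, ∑ e ∈ Ioc 0 N, (if k ∣ d then ψ d / d * log d else 0) * (if k ∣ e then ψ e / e else 0) := by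
    unfold yA yB; rw [sum_mul_sum]
  have e3 : yA ψ N k * yB ψ N k = ∑ d ∈ Ioc 0 N, ∑ e ∈ Ioc 0 N, (if k ∣ d then ψ d / d else 0) * (if k ∣ e then ψ e / e * log e else 0) := by
    unfold yA yB; rw [sum_mul_sum]
  simp only [sum_sub_distrib, ← sum_mul]
  rw [← e1, ← e2, ← e3]
  ring

end

section
open Finset

lemma real1 {c B C C' L A Q Q' ℓ κ : ℝ} (hc : 1 ≤ c) (hB0 : 0 ≤ B) (hB : B ≤ 1) (hC : 0 < C) (hC' : 0 < C') (hL : 1 ≤ L) (hA : 0 < A)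
    (hQ : |Q| ≤ 2 * C * (c * B)) (hQ' : |Q'| ≤ C' * (c * L)) (h0 : 0 ≤ ℓ + κ) (h1 : ℓ + κ ≤ (A + 2) * L) :
    |ℓ * Q ^ 2 - 2 * Q * Q' + κ * Q ^ 2| ≤ (4 * C ^ 2 * (A + 2) + 4 * C * C') * (c ^ 2 * (L * B)) := by
  have e : ℓ * Q ^ 2 - 2 * Q * Q' + κ * Q ^ 2 = (ℓ + κ) * (Q * Q) - 2 * (Q * Q') := by ring
  rw [e]
  refine (abs_sub _ _).trans ?_
  rw [abs_mul, abs_of_nonneg h0, abs_mul, abs_mul 2, abs_mul]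
  have a1 : (ℓ + κ) * (|Q| * |Q|) ≤ ((A + 2) * L) * ((2 * C * (c * B)) * (2 * C * (c * 1))) := by
    have : |Q| ≤ 2 * C * (c * 1) := hQ.trans (by gcongr)
    gcongr
  have a2 : |Q| * |Q'| ≤ (2 * C * (c * B)) * (C' * (c * L)) := by gcongr
  have : |(2:ℝ)| = 2 := by norm_num
  rw [this]
  nlinarith

lemma real2 {c B C C2 L A G e1 e3 ℓ lk κ : ℝ} (hc : 1 ≤ c) (hB0 : 0 ≤ B) (hB : B ≤ 1) (hC : 0 < C) (hC2 : 0 < C2) (hL : 1 ≤ L) (hA : 0 < A)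
    (hG0 : 0 ≤ G) (hG : G ≤ c) (h1 : |e1| ≤ c * (C * B)) (h3 : |e3| ≤ c * C2) (hl0 : 0 ≤ ℓ) (hl : ℓ ≤ A * L) (hk0 : 0 ≤ lk) (hk : lk ≤ L)
    (hκ0 : 0 ≤ κ) (hκ : κ ≤ lk) :
    |ℓ * (G + e1) ^ 2 - 2 * (G + e1) * (L * (G + e1) - (2 * G * (L - lk) + e3)) + (lk + κ) * (G + e1) ^ 2 - G ^ 2 * (ℓ + 2 * L - 3 * lk) - κ * G ^ 2|
      ≤ ((A + 4) * C * (2 + C) + 4 * C + 2 * (1 + C) * C2) * (c ^ 2 * (L * B + 1)) := by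
  have e : ℓ * (G + e1) ^ 2 - 2 * (G + e1) * (L * (G + e1) - (2 * G * (L - lk) + e3)) + (lk + κ) * (G + e1) ^ 2 - G ^ 2 * (ℓ + 2 * L - 3 * lk) - κ * G ^ 2
     = (ℓ - 2 * L + lk + κ) * (e1 * (2 * G + e1)) + (2 * ((G + e1) * e3) + 4 * (G * ((L - lk) * e1))) := by ring
  rw [e]
  have he1 : |e1| ≤ c * C := h1.trans (by nlinarith [mul_nonneg (by linarith : 0 ≤ c) hC.le, mul_pos (by linarith : 0 < c) hC])
  have aG : |G| = G := abs_of_nonneg hG0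
  have b1 : |ℓ - 2 * L + lk + κ| ≤ (A + 4) * L := by rw [abs_le]; constructor <;> nlinarith
  have b2 : |2 * G + e1| ≤ c * (2 + C) := by
    refine (abs_add_le _ _).trans ?_
    rw [abs_mul, aG, abs_two]; nlinarith
  have b3 : |G + e1| ≤ c * (1 + C) := by
    refine (abs_add_le _ _).trans ?_
    rw [aG]; nlinarith
  have b4 : |L - lk| ≤ L := by rw [abs_le]; constructor <;> linarith
  have t1 : |(ℓ - 2 * L + lk + κ) * (e1 * (2 * G + e1))| ≤ ((A + 4) * L) * ((c * (C * B)) * (c * (2 + C))) := by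
    rw [abs_mul, abs_mul]; gcongr
  have t2 : |2 * ((G + e1) * e3)| ≤ 2 * ((c * (1 + C)) * (c * C2)) := by
    rw [abs_mul, abs_two, abs_mul]; gcongr
  have t3 : |4 * (G * ((L - lk) * e1))| ≤ 4 * (c * (L * (c * (C * B)))) := by
    rw [abs_mul, abs_mul, abs_mul, aG, abs_of_pos (by norm_num : (0:ℝ) < 4)]; gcongr
  refine (abs_add_le _ _).trans ?_
  have t4 := abs_add_le (2 * ((G + e1) * e3)) (4 * (G * ((L - lk) * e1)))
  have hLB : 0 ≤ L * B := by positivity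
  have p1 : 0 ≤ c ^ 2 := sq_nonneg c
  have fin : ((A + 4) * L) * ((c * (C * B)) * (c * (2 + C))) + (2 * ((c * (1 + C)) * (c * C2)) + 4 * (c * (L * (c * (C * B)))))
     ≤ ((A + 4) * C * (2 + C) + 4 * C + 2 * (1 + C) * C2) * (c ^ 2 * (L * B + 1)) := by
    have : ((A + 4) * C * (2 + C) + 4 * C + 2 * (1 + C) * C2) * (c ^ 2 * (L * B + 1)) - (((A + 4) * L) * ((c * (C * B)) * (c * (2 + C))) + (2 * ((c * (1 + C)) * (c * C2)) + 4 * (c * (L * (c * (C * B))))))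
      = ((A + 4) * C * (2 + C) + 4 * C) * c ^ 2 + 2 * (1 + C) * C2 * c ^ 2 * (L * B) := by ring
    have : 0 ≤ ((A + 4) * C * (2 + C) + 4 * C) * c ^ 2 + 2 * (1 + C) * C2 * c ^ 2 * (L * B) := by positivity
    linarith
  linarith

lemma alg1 (φ k lam m Q Q' ℓ κ : ℝ) (hm : m ^ 2 = 1) :
    φ * (ℓ * (m / (k * lam) * Q) ^ 2 - 2 * (m / (k * lam) * Q) * (m / (k * lam) * Q') + κ * (m / (k * lam) * Q) ^ 2)
      = φ / (k ^ 2 * lam ^ 2) * (ℓ * Q ^ 2 - 2 * Q * Q' + κ * Q ^ 2) := by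
  linear_combination (φ / (k ^ 2 * lam ^ 2) * (ℓ * Q ^ 2 - 2 * Q * Q' + κ * Q ^ 2)) * hm

lemma alg2 (φ k lam G X T κ : ℝ) (hk : k ≠ 0) (hφ : φ * G = k) :
    φ / (k ^ 2 * lam ^ 2) * X - φ / k ^ 2 * G ^ 2 * T / lam ^ 2 = φ / (k ^ 2 * lam ^ 2) * (X - G ^ 2 * T - κ * G ^ 2) + κ * G / (k * lam ^ 2) := by
  have : κ * G / (k * lam ^ 2) = φ / (k ^ 2 * lam ^ 2) * (κ * G ^ 2) := by
    rw [← hφ] at hk ⊢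
    have h1 : φ ≠ 0 := left_ne_zero_of_mul hk
    have h2 : G ≠ 0 := right_ne_zero_of_mul hk
    by_cases hl : lam = 0
    · simp [hl]
    field_simp
  rw [this]; ring

set_option maxHeartbeats 800000 in
lemma per_k (A : ℝ) (hA : 0 < A) : ∃ C : ℝ, 0 < C ∧ ∀ U V ℓ : ℝ, 1 ≤ U → U < V → 1 ≤ log V → 0 ≤ ℓ → ℓ ≤ A * log V →
    ∀ k ∈ sf ⌊V⌋₊,
    |(k.totient : ℝ) * (ℓ * yA (psiR U V) ⌊V⌋₊ k ^ 2 - 2 * yA (psiR U V) ⌊V⌋₊ k * yB (psiR U V) ⌊V⌋₊ k + kap' k * yA (psiR U V) ⌊V⌋₊ k ^ 2)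
      - (if U < k then phiS k * (ℓ + 2 * log V - 3 * log k) else 0) / log (V / U) ^ 2|
     ≤ C / log (V / U) ^ 2 * (cK k ^ 2 / k * (log V * (if (k:ℝ) ≤ U then bB (U / k) else 0) + log V * bB (V / k) + 1)) := by
  obtain ⟨C, hC, hb⟩ := SK_bound
  obtain ⟨C2, hC2, hb2⟩ := SK2_bound
  have hC' : 0 < 1 + 2 * C + 2 * C2 := by positivity
  set D1 := 4 * C ^ 2 * (A + 2) + 4 * C * (1 + 2 * C + 2 * C2) with hD1
  set D2 := (A + 4) * C * (2 + C) + 4 * C + 2 * (1 + C) * C2 with hD2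
  have hD1p : 0 < D1 := by positivity
  have hD2p : 0 < D2 := by positivity
  refine ⟨D1 + (D2 + 2), by positivity, fun U V ℓ hU hUV hL hl0 hl k hk => ?_⟩
  rw [mem_sf] at hk
  have hk0 : (0:ℝ) < k := by exact_mod_cast hk.1.1
  have hk1 : (1:ℝ) ≤ k := by exact_mod_cast hk.1.1
  have hkV : (k:ℝ) ≤ V := (Nat.le_floor_iff' hk.1.1.ne').mp hk.1.2
  have hU0 : 0 < U := by linarith
  have hV0 : 0 < V := by linarith
  have hlam : 0 < log (V / U) := Real.log_pos (by rw [lt_div_iff₀ hU0]; linarith)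
  have hlam' : log (V / U) = log V - log U := Real.log_div hV0.ne' hU0.ne'
  set lam := log (V / U)
  set L := log V
  set lk := log (k:ℝ) with hlk
  have hlk0 : 0 ≤ lk := Real.log_nonneg hk1
  have hlkL : lk ≤ L := Real.log_le_log hk0 hkV
  have hκ0 := kap_nonneg k
  have hκ1 := kap_le_log k hk.2
  have hκ2 := kap_le_cK k
  have hκ' := kap'_eq k hk.2
  have hc := one_le_cK k
  have hG0 := gK_nonneg k
  have hGc := gK_le_cK k hk.2
  have hφ0 : (0:ℝ) < k.totient := by exact_mod_cast Nat.totient_pos.mpr hk.1.1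
  have hφk : (k.totient : ℝ) ≤ k := by exact_mod_cast Nat.totient_le k
  have hφG : (k.totient : ℝ) * gK k = k := by unfold gK; field_simp
  have hm : (moebius k : ℝ) ^ 2 = 1 := by
    have := ArithmeticFunction.moebius_sq_eq_one_of_squarefree hk.2
    exact_mod_cast this
  have hphiS : phiS k = (k.totient : ℝ) / k ^ 2 * gK k ^ 2 := by
    unfold phiS gK; rw [if_pos hk.2]; field_simp
  rw [yA_eq hUV.le k hk.1.1, yB_eq hUV.le k hk.1.1]
  have hBV0 := bB_pos (V / k)
  have hBV1 := bB_le_one (V / k)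
  have hV1 := (hb k hk.2 (V / k)).2
  have hV2 := hb2 k hk.2 (V / k)
  have hlgV : lgp (V / k) = L - lk := by
    unfold lgp; rw [if_pos (by rw [le_div_iff₀ hk0]; linarith), Real.log_div hV0.ne' hk0.ne']
  rw [hlgV] at hV2
  have hscale : ∀ Z : ℝ, (k.totient : ℝ) / (k ^ 2 * lam ^ 2) * |Z| ≤ 1 / (k * lam ^ 2) * |Z| := by
    intro Z
    gcongr ?_ * _
    rw [div_le_div_iff₀ (by positivity) (by positivity)]
    have : 0 ≤ (k:ℝ) * lam ^ 2 := by positivity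
    calc (k.totient : ℝ) * (k * lam ^ 2) ≤ k * (k * lam ^ 2) := mul_le_mul_of_nonneg_right hφk this
      _ = _ := by ring
  by_cases hkU : (k:ℝ) ≤ U
  · rw [if_neg (not_lt.mpr hkU), if_pos hkU, zero_div, sub_zero]
    have hBU0 := bB_pos (U / k)
    have hBU1 := bB_le_one (U / k)
    have hU1 := (hb k hk.2 (U / k)).2
    have hU2 := hb2 k hk.2 (U / k)
    have hlgU : lgp (U / k) = log U - lk := by
      unfold lgp; rw [if_pos (by rw [le_div_iff₀ hk0]; linarith), Real.log_div hU0.ne' hk0.ne']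
    rw [hlgU] at hU2
    have hBB : bB (V / k) ≤ bB (U / k) := bB_anti _ _ (by gcongr)
    have hlU0 : 0 ≤ log U := Real.log_nonneg hU
    have hlUL : log U ≤ L := Real.log_le_log hU0 hUV.le
    set F := SK lgp k (V / k)
    set f := SK lgp k (U / k)
    set F2 := SK (fun z => lgp z ^ 2) k (V / k)
    set f2 := SK (fun z => lgp z ^ 2) k (U / k)
    have hQ : |F - f| ≤ 2 * C * (cK k * bB (U / k)) := by
      have e : F - f = (F - gK k) - (f - gK k) := by ring
      rw [e]
      refine (abs_sub _ _).trans ?_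
      have : cK k * (C * bB (V / k)) ≤ cK k * (C * bB (U / k)) := by gcongr
      linarith
    have hQ' : |L * F - F2 - log U * f + f2| ≤ (1 + 2 * C + 2 * C2) * (cK k * L) := by
      have e : L * F - F2 - log U * f + f2 = (L * (F - gK k) - (F2 - 2 * gK k * (L - lk))) - (log U * (f - gK k) - (f2 - 2 * gK k * (log U - lk))) - gK k * (L - log U) := by ring
      rw [e]
      have a1 : |L * (F - gK k)| ≤ L * (cK k * (C * 1)) := by
        rw [abs_mul, abs_of_nonneg (by linarith : 0 ≤ L)]
        gcongr
        exact hV1.trans (by gcongr)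
      have a2 : |log U * (f - gK k)| ≤ L * (cK k * (C * 1)) := by
        rw [abs_mul, abs_of_nonneg hlU0]
        gcongr
        exact hU1.trans (by gcongr)
      have a3 : |gK k * (L - log U)| ≤ cK k * L := by
        rw [abs_mul, abs_of_nonneg hG0, abs_of_nonneg (by linarith)]
        gcongr
        linarith
      have a4 : cK k * C2 ≤ cK k * C2 * L := le_mul_of_one_le_right (by positivity) hL
      have t1 := abs_sub (L * (F - gK k)) (F2 - 2 * gK k * (L - lk))
      have t2 := abs_sub (log U * (f - gK k)) (f2 - 2 * gK k * (log U - lk))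
      have t3 := abs_sub (L * (F - gK k) - (F2 - 2 * gK k * (L - lk))) (log U * (f - gK k) - (f2 - 2 * gK k * (log U - lk)))
      have t4 := abs_sub ((L * (F - gK k) - (F2 - 2 * gK k * (L - lk))) - (log U * (f - gK k) - (f2 - 2 * gK k * (log U - lk)))) (gK k * (L - log U))
      linarith
    have hR := real1 (ℓ := ℓ) (κ := kap' k) hc hBU0.le hBU1 hC hC' hL hA hQ hQ' (by linarith) (by linarith)
    set Q := F - f
    set Q' := L * F - F2 - log U * f + f2
    rw [alg1 _ _ _ _ _ _ _ _ hm, abs_mul, abs_of_nonneg (by positivity)]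
    refine (hscale _).trans ?_
    calc _ ≤ 1 / (k * lam ^ 2) * (D1 * (cK k ^ 2 * (L * bB (U / k)))) := by gcongr
      _ = D1 / lam ^ 2 * (cK k ^ 2 / k * (L * bB (U / k))) := by field_simp
      _ ≤ _ := by
        have : 0 ≤ L * bB (V / k) := by positivity
        gcongr
        · linarith
        · linarith
  · rw [if_pos (not_le.mp hkU), if_neg hkU]
    have hUk : U / k < 1 := by rw [div_lt_one hk0]; linarith
    rw [SK_lt_one lgp k hUk, SK_lt_one (fun z => lgp z ^ 2) k hUk]
    set e1 := SK lgp k (V / k) - gK k with he1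
    set e3 := SK (fun z => lgp z ^ 2) k (V / k) - 2 * gK k * (L - lk) with he3
    have hR := real2 hc hBV0.le hBV1 hC hC2 hL hA hG0 hGc hV1 hV2 hl0 hl hlk0 hlkL hκ0 hκ1
    have hF : SK lgp k (V / k) = gK k + e1 := by rw [he1]; ring
    have hF2 : SK (fun z => lgp z ^ 2) k (V / k) = 2 * gK k * (L - lk) + e3 := by rw [he3]; ring
    rw [hF, hF2, hκ', hphiS]
    set Q := gK k + e1
    set Z := ℓ * Q ^ 2 - 2 * Q * (L * Q - (2 * gK k * (L - lk) + e3)) + (lk + kap k) * Q ^ 2 - gK k ^ 2 * (ℓ + 2 * L - 3 * lk) - kap k * gK k ^ 2 with hZ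
    rw [sub_zero, mul_zero, sub_zero, add_zero, alg1 _ _ _ _ _ _ _ _ hm, alg2 _ _ _ _ _ _ (kap k) hk0.ne' hφG, ← hZ]
    refine (abs_add_le _ _).trans ?_
    rw [abs_mul, abs_of_nonneg (by positivity : 0 ≤ (k.totient : ℝ) / (k ^ 2 * lam ^ 2)), abs_of_nonneg (by positivity : 0 ≤ kap k * gK k / (k * lam ^ 2))]
    have s1 : (k.totient : ℝ) / (k ^ 2 * lam ^ 2) * |Z| ≤ 1 / (k * lam ^ 2) * (D2 * (cK k ^ 2 * (L * bB (V / k) + 1))) := by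
      refine (hscale _).trans ?_
      gcongr
    have s2 : kap k * gK k / (k * lam ^ 2) ≤ (2 * cK k) * cK k / (k * lam ^ 2) := by gcongr
    have hLB : 0 ≤ L * bB (V / k) := by positivity
    calc _ ≤ 1 / (k * lam ^ 2) * (D2 * (cK k ^ 2 * (L * bB (V / k) + 1))) + (2 * cK k) * cK k / (k * lam ^ 2) := add_le_add s1 s2
      _ = (1 / (k * lam ^ 2) * cK k ^ 2) * (D2 * (L * bB (V / k) + 1) + 2) := by ring
      _ ≤ (1 / (k * lam ^ 2) * cK k ^ 2) * ((D1 + (D2 + 2)) * (L * bB (V / k) + 1)) := by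
        gcongr
        have p1 : 0 ≤ D1 * (L * bB (V / k) + 1) := by positivity
        linarith
      _ = _ := by rw [mul_zero, zero_add]; ring

end

section
open Finset

lemma psiR_sqf (U V : ℝ) (d : ℕ) (hd : ¬ Squarefree d) : psiR U V d = 0 := by
  unfold psiR; rw [ArithmeticFunction.moebius_eq_zero_of_not_squarefree hd]; simp

noncomputable def PP (U V ℓ : ℝ) : ℝ := ∑ d ∈ Ioc 0 ⌊V⌋₊, ∑ e ∈ Ioc 0 ⌊V⌋₊,
  psiR U V d * psiR U V e / (d.lcm e : ℕ) * (ℓ - log (d.lcm e : ℕ))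

lemma main_sum (A : ℝ) (hA : 0 < A) : ∃ C : ℝ, 0 < C ∧ ∀ U V ℓ : ℝ, 1 ≤ U → U < V → 1 ≤ log V → 0 ≤ ℓ → ℓ ≤ A * log V →
    |∑ k ∈ sf ⌊V⌋₊, (if U < k then phiS k * (ℓ + 2 * log V - 3 * log k) else 0)
      - ((ℓ - log V) * log (V / U) + 3 / 2 * log (V / U) ^ 2)| ≤ C * log V := by
  obtain ⟨C1, hC1, h1⟩ := phiS_sum
  obtain ⟨C2, hC2, h2⟩ := phiS_log_sum
  refine ⟨(A + 1) * (2 * C1) + 3 * C2, by positivity, fun U V ℓ hU hUV hL hl0 hl => ?_⟩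
  have hU0 : 0 < U := by linarith
  have hV0 : 0 < V := by linarith
  have hlam : 0 < log (V / U) := Real.log_pos (by rw [lt_div_iff₀ hU0]; linarith)
  have hlam' : log (V / U) = log V - log U := Real.log_div hV0.ne' hU0.ne'
  have hUl := Real.log_nonneg hU
  have hfl : ⌊U⌋₊ ≤ ⌊V⌋₊ := Nat.floor_le_floor hUV.le
  have hs : ∑ k ∈ sf ⌊V⌋₊, (if U < k then phiS k * (ℓ + 2 * log V - 3 * log k) else 0)
      = ∑ k ∈ Ioc ⌊U⌋₊ ⌊V⌋₊, phiS k * (ℓ + 2 * log V - 3 * log k) := by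
    rw [sum_sf]
    rw [← sum_Ioc_consecutive _ (Nat.zero_le _) hfl]
    have z : ∑ k ∈ Ioc 0 ⌊U⌋₊, (if Squarefree k then (if U < k then phiS k * (ℓ + 2 * log V - 3 * log k) else 0) else 0) = 0 := by
      refine sum_eq_zero (fun k hk => ?_)
      rw [mem_Ioc] at hk
      have : (k:ℝ) ≤ U := (Nat.le_floor_iff' hk.1.ne').mp hk.2
      rw [if_neg (not_lt.mpr this)]; simp
    rw [z, zero_add]
    refine sum_congr rfl (fun k hk => ?_)
    rw [mem_Ioc] at hk
    have : U < k := (Nat.floor_lt hU0.le).mp hk.1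
    rw [if_pos this]
    split_ifs with hq
    · rfl
    · unfold phiS; rw [if_neg hq]; ring
  rw [hs]
  have h3 : |∑ k ∈ Ioc ⌊U⌋₊ ⌊V⌋₊, phiS k - log (V / U)| ≤ 2 * C1 := by
    have a := h1 U hU
    have b := h1 V (by linarith)
    rw [← sum_Ioc_consecutive _ (Nat.zero_le _) hfl] at b
    rw [hlam']
    rw [abs_le] at a b ⊢
    constructor <;> linarith [a.1, a.2, b.1, b.2]
  have h4 := h2 U V hU hUV.le
  have e : ∑ k ∈ Ioc ⌊U⌋₊ ⌊V⌋₊, phiS k * (ℓ + 2 * log V - 3 * log k) =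
      (ℓ - log V) * ∑ k ∈ Ioc ⌊U⌋₊ ⌊V⌋₊, phiS k + 3 * ∑ k ∈ Ioc ⌊U⌋₊ ⌊V⌋₊, (log V - log k) * phiS k := by
    rw [mul_sum, mul_sum, ← sum_add_distrib]
    refine sum_congr rfl (fun k _ => ?_)
    ring
  rw [e]
  set S := ∑ k ∈ Ioc ⌊U⌋₊ ⌊V⌋₊, phiS k
  set S' := ∑ k ∈ Ioc ⌊U⌋₊ ⌊V⌋₊, (log V - log k) * phiS k
  set lam := log (V / U)
  have e2 : (ℓ - log V) * S + 3 * S' - ((ℓ - log V) * lam + 3 / 2 * lam ^ 2) = (ℓ - log V) * (S - lam) + 3 * (S' - lam ^ 2 / 2) := by ring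
  rw [e2]
  refine (abs_add_le _ _).trans ?_
  rw [abs_mul, abs_mul, abs_of_pos (by norm_num : (0:ℝ) < 3)]
  have h5 : |ℓ - log V| ≤ (A + 1) * log V := by rw [abs_le]; constructor <;> nlinarith
  have h6 : |ℓ - log V| * |S - lam| ≤ ((A + 1) * log V) * (2 * C1) := by gcongr
  have h7 : C2 * lam ≤ C2 * log V := by gcongr; linarith
  linarith

lemma PP_est (A : ℝ) (hA : 0 < A) : ∃ C : ℝ, 0 < C ∧ ∀ U V ℓ : ℝ, 1 ≤ U → U < V → 1 ≤ log V → 0 ≤ ℓ → ℓ ≤ A * log V →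
    |PP U V ℓ - ((ℓ - log V) / log (V / U) + 3 / 2)| ≤ C * log V / log (V / U) ^ 2 := by
  obtain ⟨C, hC, h⟩ := per_k A hA
  obtain ⟨C0, hC0, h0⟩ := main_sum A hA
  obtain ⟨C1, hC1, h1⟩ := cB_sum
  obtain ⟨C3, hC3, h3⟩ := c1_sum
  refine ⟨C * (C1 + C1 + 2 * C3) + C0, by positivity, fun U V ℓ hU hUV hL hl0 hl => ?_⟩
  have hU0 : 0 < U := by linarith
  have hV0 : 0 < V := by linarith
  have hlam : 0 < log (V / U) := Real.log_pos (by rw [lt_div_iff₀ hU0]; linarith)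
  unfold PP
  rw [quad_form _ (psiR_sqf U V)]
  have hk := h U V ℓ hU hUV hL hl0 hl
  have hm := h0 U V ℓ hU hUV hL hl0 hl
  set lam := log (V / U)
  set f : ℕ → ℝ := fun k => (k.totient : ℝ) * (ℓ * yA (psiR U V) ⌊V⌋₊ k ^ 2 - 2 * yA (psiR U V) ⌊V⌋₊ k * yB (psiR U V) ⌊V⌋₊ k + kap' k * yA (psiR U V) ⌊V⌋₊ k ^ 2)
  set g : ℕ → ℝ := fun k => if U < k then phiS k * (ℓ + 2 * log V - 3 * log k) else 0
  have t1 : |∑ k ∈ sf ⌊V⌋₊, f k - (∑ k ∈ sf ⌊V⌋₊, g k) / lam ^ 2| ≤ C * (C1 + C1 + 2 * C3) * log V / lam ^ 2 := by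
    rw [sum_div, ← sum_sub_distrib]
    refine (abs_sum_le_sum_abs _ _).trans ((sum_le_sum hk).trans ?_)
    rw [← mul_sum]
    have hsplit : ∑ k ∈ sf ⌊V⌋₊, cK k ^ 2 / k * (log V * (if (k:ℝ) ≤ U then bB (U / k) else 0) + log V * bB (V / k) + 1)
        = log V * (∑ k ∈ sf ⌊V⌋₊, cK k ^ 2 / k * (if (k:ℝ) ≤ U then bB (U / k) else 0)) + log V * (∑ k ∈ sf ⌊V⌋₊, cK k ^ 2 / k * bB (V / k)) + ∑ k ∈ sf ⌊V⌋₊, cK k ^ 2 / k := by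
      rw [mul_sum, mul_sum, ← sum_add_distrib, ← sum_add_distrib]
      refine sum_congr rfl (fun k _ => ?_)
      ring
    have hUs : ∑ k ∈ sf ⌊V⌋₊, cK k ^ 2 / k * (if (k:ℝ) ≤ U then bB (U / k) else 0) = ∑ k ∈ sf ⌊U⌋₊, cK k ^ 2 / k * bB (U / k) := by
      have hsub : sf ⌊U⌋₊ ⊆ sf ⌊V⌋₊ := by
        intro k hk
        rw [mem_sf] at hk ⊢
        exact ⟨⟨hk.1.1, hk.1.2.trans (Nat.floor_le_floor hUV.le)⟩, hk.2⟩
      rw [← sum_subset hsub]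
      · refine sum_congr rfl (fun k hk => ?_)
        rw [mem_sf] at hk
        rw [if_pos ((Nat.le_floor_iff' hk.1.1.ne').mp hk.1.2)]
      · intro k hk hk'
        rw [mem_sf] at hk hk'
        rw [if_neg, mul_zero]
        intro hh
        exact hk' ⟨⟨hk.1.1, (Nat.le_floor_iff' hk.1.1.ne').mpr hh⟩, hk.2⟩
    rw [hsplit, hUs]
    have b1 := h1 U hU
    have b2 := h1 V (by linarith)
    have b3 := h3 V (by linarith)
    have b4 : log V * (∑ k ∈ sf ⌊U⌋₊, cK k ^ 2 / k * bB (U / k)) + log V * (∑ k ∈ sf ⌊V⌋₊, cK k ^ 2 / k * bB (V / k)) + ∑ k ∈ sf ⌊V⌋₊, cK k ^ 2 / k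
       ≤ (C1 + C1 + 2 * C3) * log V := by
      have c1 := mul_le_mul_of_nonneg_left b1 (by linarith : 0 ≤ log V)
      have c2 := mul_le_mul_of_nonneg_left b2 (by linarith : 0 ≤ log V)
      have c3 := mul_le_mul_of_nonneg_left hL hC3.le
      linarith
    calc _ ≤ C / lam ^ 2 * ((C1 + C1 + 2 * C3) * log V) := by gcongr
      _ = _ := by ring
  have t2 : |(∑ k ∈ sf ⌊V⌋₊, g k) / lam ^ 2 - ((ℓ - log V) / lam + 3 / 2)| ≤ C0 * log V / lam ^ 2 := by
    have : (∑ k ∈ sf ⌊V⌋₊, g k) / lam ^ 2 - ((ℓ - log V) / lam + 3 / 2) = (∑ k ∈ sf ⌊V⌋₊, g k - ((ℓ - log V) * lam + 3 / 2 * lam ^ 2)) / lam ^ 2 := by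
      field_simp
    rw [this, abs_div, abs_of_pos (by positivity : 0 < lam ^ 2)]
    gcongr
  have t3 := abs_sub_le (∑ k ∈ sf ⌊V⌋₊, f k) ((∑ k ∈ sf ⌊V⌋₊, g k) / lam ^ 2) ((ℓ - log V) / lam + 3 / 2)
  calc _ ≤ _ := t3
    _ ≤ _ := add_le_add t1 t2
    _ = _ := by ring

end

section
open Finset

noncomputable def hh (y : ℝ) : ℝ := -log ((1 - exp (-y)) / y)

lemma hh_arg_pos {y : ℝ} (hy : 0 < y) : 0 < (1 - exp (-y)) / y := by
  have : exp (-y) < 1 := by rw [Real.exp_lt_one_iff]; linarith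
  apply div_pos (by linarith) hy

lemma hh_nonneg {y : ℝ} (hy : 0 < y) : 0 ≤ hh y := by
  unfold hh
  have h1 : (1 - exp (-y)) / y ≤ 1 := by
    rw [div_le_one hy]
    linarith [Real.add_one_le_exp (-y)]
  linarith [Real.log_nonpos (hh_arg_pos hy).le h1]

lemma hh_le_log {y : ℝ} (hy : 0 < y) : hh y ≤ log (1 + y) := by
  unfold hh
  rw [← Real.log_inv]
  apply Real.log_le_log (inv_pos.mpr (hh_arg_pos hy))
  rw [inv_div]
  have h0 : exp (-y) < 1 := by rw [Real.exp_lt_one_iff]; linarith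
  rw [div_le_iff₀ (by linarith)]
  have h1 := Real.add_one_le_exp y
  have h2 : (1 + y) * exp (-y) ≤ exp y * exp (-y) := by
    gcongr; linarith
  rw [← Real.exp_add, add_neg_cancel, Real.exp_zero] at h2
  nlinarith

lemma hh_le {y : ℝ} (hy : 0 < y) : hh y ≤ y := by
  have := hh_le_log hy
  have h2 := Real.log_le_sub_one_of_pos (show 0 < 1 + y by linarith)
  linarith

lemma hh_mono {y z : ℝ} (hy : 0 < y) (hyz : y ≤ z) : hh y ≤ hh z := by
  unfold hh
  rw [neg_le_neg_iff]
  apply Real.log_le_log (hh_arg_pos (by linarith))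
  have hs := (convexOn_exp).secant_mono (a := 0) (x := -z) (y := -y) (Set.mem_univ _) (Set.mem_univ _) (Set.mem_univ _)
    (by linarith) (by linarith) (by linarith)
  rw [Real.exp_zero, sub_zero, sub_zero] at hs
  have e : ∀ t : ℝ, (1 - exp (-t)) / t = (exp (-t) - 1) / -t := by
    intro t; rw [div_neg, ← neg_div]; ring
  rw [e, e]; exact hs

lemma log_eq_hh {m X : ℝ} (hm : 0 < m) (hX : 0 < X) : -log (1 - exp (-(m / X))) = log X - log m + hh (m / X) := by
  unfold hh
  have hy : 0 < m / X := div_pos hm hX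
  have h0 : exp (-(m / X)) < 1 := by rw [Real.exp_lt_one_iff]; linarith
  rw [Real.log_div (by linarith) hy.ne', Real.log_div hm.ne' hX.ne']
  ring

lemma hasSum_mult (m : ℕ) (hm : 0 < m) {X : ℝ} (hX : 0 < X) :
    HasSum (fun n : ℕ => if m ∣ n then (n:ℝ)⁻¹ * exp (-(n:ℝ) / X) else 0) ((m:ℝ)⁻¹ * (-log (1 - exp (-(m / X))))) := by
  have hm' : (0:ℝ) < m := by exact_mod_cast hm
  have hy : 0 < (m:ℝ) / X := div_pos hm' hX
  have h0 : exp (-((m:ℝ) / X)) < 1 := by rw [Real.exp_lt_one_iff]; linarith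
  have h1 := (Real.hasSum_pow_div_log_of_abs_lt_one (x := exp (-((m:ℝ) / X))) (by rw [abs_of_pos (Real.exp_pos _)]; exact h0)).mul_left ((m:ℝ)⁻¹)
  have hinj : Function.Injective (fun j : ℕ => m * (j + 1)) := by
    intro a b h
    have := Nat.eq_of_mul_eq_mul_left hm h
    omega
  rw [← hinj.hasSum_iff]
  · refine Eq.mp (congrArg (fun f => HasSum f _) ?_) h1
    funext j
    symm
    simp only [Function.comp]
    rw [if_pos (dvd_mul_right _ _), ← Real.exp_nat_mul]
    push_cast
    have : -((m:ℝ) * (j + 1)) / X = (j + 1) * -(m / X) := by ring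
    rw [this, mul_inv]
    ring
  · intro n hn
    split_ifs with h
    · obtain ⟨j, rfl⟩ := h
      rcases Nat.eq_zero_or_pos j with rfl | hj
      · simp
      · exact absurd ⟨j - 1, by simp only; congr 1; omega⟩ hn
    · rfl

lemma sq_expand (ψ : ℕ → ℝ) (N : ℕ) (hψ : ∀ d, N < d → ψ d = 0) (n : ℕ) (hn : 0 < n) :
    (∑ d ∈ n.divisors, ψ d) ^ 2 = ∑ d ∈ Ioc 0 N, ∑ e ∈ Ioc 0 N, ψ d * ψ e * (if d.lcm e ∣ n then 1 else 0) := by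
  have h1 : ∑ d ∈ n.divisors, ψ d = ∑ d ∈ Ioc 0 N, if d ∣ n then ψ d else 0 := by
    rw [← sum_filter]
    symm
    apply sum_subset_zero_on_sdiff
    · intro d hd
      rw [mem_filter, mem_Ioc] at hd
      exact Nat.mem_divisors.mpr ⟨hd.2, hn.ne'⟩
    · intro d hd
      rw [mem_sdiff, mem_filter, mem_Ioc] at hd
      apply hψ
      by_contra h
      have hd1 := Nat.dvd_of_mem_divisors hd.1
      exact hd.2 ⟨⟨Nat.pos_of_dvd_of_pos hd1 hn, by omega⟩, hd1⟩
    · intro d _; rfl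
  rw [h1, sq, sum_mul_sum]
  refine sum_congr rfl (fun d _ => sum_congr rfl (fun e _ => ?_))
  have : d.lcm e ∣ n ↔ d ∣ n ∧ e ∣ n := Nat.lcm_dvd_iff
  by_cases hd : d ∣ n <;> by_cases he : e ∣ n <;> simp [this, hd, he]

noncomputable def TT (ψ : ℕ → ℝ) (N : ℕ) (X : ℝ) : ℝ := ∑ d ∈ Ioc 0 N, ∑ e ∈ Ioc 0 N, ψ d * ψ e / (d.lcm e : ℕ) * (-log (1 - exp (-((d.lcm e : ℕ) / X))))

lemma TT_hasSum (ψ : ℕ → ℝ) (N : ℕ) (hψ : ∀ d, N < d → ψ d = 0) {X : ℝ} (hX : 0 < X) :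
    HasSum (fun n : ℕ => (∑ d ∈ n.divisors, ψ d) ^ 2 * (n:ℝ)⁻¹ * exp (-(n:ℝ) / X)) (TT ψ N X) := by
  have h : HasSum (fun n : ℕ => ∑ d ∈ Ioc 0 N, ∑ e ∈ Ioc 0 N, ψ d * ψ e * (if d.lcm e ∣ n then (n:ℝ)⁻¹ * exp (-(n:ℝ) / X) else 0)) (TT ψ N X) := by
    unfold TT
    apply hasSum_sum
    intro d hd
    apply hasSum_sum
    intro e he
    rw [mem_Ioc] at hd he
    have := (hasSum_mult (d.lcm e) (Nat.lcm_pos hd.1 he.1) hX).mul_left (ψ d * ψ e)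
    rw [← mul_assoc, ← div_eq_mul_inv] at this
    exact this
  convert h using 1
  funext n
  rcases Nat.eq_zero_or_pos n with rfl | hn
  · simp
  · rw [sq_expand ψ N hψ n hn, sum_mul, sum_mul]
    refine sum_congr rfl (fun d _ => ?_)
    rw [sum_mul, sum_mul]
    refine sum_congr rfl (fun e _ => ?_)
    split_ifs <;> ring

noncomputable def RR (ψ : ℕ → ℝ) (N : ℕ) (X : ℝ) : ℝ := ∑ d ∈ Ioc 0 N, ∑ e ∈ Ioc 0 N, ψ d * ψ e / (d.lcm e : ℕ) * hh ((d.lcm e : ℕ) / X)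

lemma TT_eq (U V : ℝ) {X : ℝ} (hX : 0 < X) : TT (psiR U V) ⌊V⌋₊ X = PP U V (log X) + RR (psiR U V) ⌊V⌋₊ X := by
  unfold TT PP RR
  rw [← sum_add_distrib]
  refine sum_congr rfl (fun d hd => ?_)
  rw [← sum_add_distrib]
  refine sum_congr rfl (fun e he => ?_)
  rw [mem_Ioc] at hd he
  rw [log_eq_hh (by exact_mod_cast Nat.lcm_pos hd.1 he.1) hX]
  ring

end

section
open Finset


lemma gcd_split (d e : ℕ) (hd : Squarefree d) (he : 0 < e) (r : ℝ) (F : ℕ → ℝ) :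
    (moebius e : ℝ) * r * F (d.lcm e) = ∑ g ∈ d.divisors, if g ∣ e then
      (if (e / g).Coprime d then (moebius g : ℝ) * (moebius (e / g) : ℝ) * r * F (d * (e / g)) else 0) else 0 := by
  have hd0 : 0 < d := Nat.pos_of_ne_zero (fun h => not_squarefree_zero (h ▸ hd))
  set g := d.gcd e with hg
  have hg0 : 0 < g := Nat.gcd_pos_of_pos_left _ hd0
  have hgd : g ∣ d := Nat.gcd_dvd_left d e
  have hge : g ∣ e := Nat.gcd_dvd_right d e
  rw [sum_eq_single_of_mem g (Nat.mem_divisors.mpr ⟨hgd, hd0.ne'⟩)]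
  · rw [if_pos hge]
    have hlcm : d.lcm e = d * (e / g) := by
      unfold Nat.lcm
      rw [Nat.mul_div_assoc _ hge]
    have hgs : Squarefree g := hd.squarefree_of_dvd hgd
    have hmul : g * (e / g) = e := Nat.mul_div_cancel' hge
    by_cases hc : (e / g).Coprime d
    · rw [if_pos hc, hlcm]
      have hc' : g.Coprime (e / g) := (Nat.Coprime.coprime_dvd_right hgd hc).symm
      have := ArithmeticFunction.isMultiplicative_moebius.map_mul_of_coprime hc'
      rw [hmul] at this
      rw [this]; push_cast; ring
    · rw [if_neg hc]
      have : ¬ Squarefree e := by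
        intro hs
        rw [← hmul] at hs
        have h1 := (Nat.squarefree_mul_iff.mp hs).1
        apply hc
        have h2 : (e / g).gcd d ∣ g := Nat.dvd_gcd (Nat.gcd_dvd_right _ _) ((Nat.gcd_dvd_left _ _).trans (Nat.div_dvd_of_dvd hge))
        have h3 : (e / g).gcd d ∣ e / g := Nat.gcd_dvd_left _ _
        exact Nat.dvd_one.mp (h1 ▸ Nat.dvd_gcd h2 h3)
      rw [ArithmeticFunction.moebius_eq_zero_of_not_squarefree this]; simp
  · intro k hk hkg
    split_ifs with h1 h2
    · exfalso
      apply hkg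
      have hkd := Nat.dvd_of_mem_divisors hk
      have : d.gcd (k * (e / k)) = d.gcd k := Nat.Coprime.gcd_mul_right_cancel_right k h2
      rw [Nat.mul_div_cancel' h1, Nat.gcd_eq_right hkd] at this
      rw [hg, this]
    · rfl
    · rfl

lemma inner_eq (ρ : ℕ → ℝ) (d N : ℕ) (hd : Squarefree d) (F : ℕ → ℝ) :
    ∑ e ∈ Ioc 0 N, (moebius e : ℝ) * ρ e * F (d.lcm e) =
    ∑ g ∈ d.divisors, (moebius g : ℝ) * ∑ m ∈ Ioc 0 (N / g), (if m.Coprime d then (moebius m : ℝ) * ρ (g * m) * F (d * m) else 0) := by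
  rw [sum_congr rfl (fun e he => gcd_split d e hd (mem_Ioc.mp he).1 (ρ e) F), sum_comm]
  refine sum_congr rfl (fun g hg => ?_)
  have hd0 : 0 < d := Nat.pos_of_ne_zero (fun h => not_squarefree_zero (h ▸ hd))
  have hg0 : 0 < g := Nat.pos_of_dvd_of_pos (Nat.dvd_of_mem_divisors hg) hd0
  rw [sum_dvd_eq N g hg0 (fun e => if (e / g).Coprime d then (moebius g : ℝ) * (moebius (e / g) : ℝ) * ρ e * F (d * (e / g)) else 0), mul_sum]
  refine sum_congr rfl (fun m _ => ?_)
  simp only [Nat.mul_div_cancel_left m hg0]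
  split_ifs <;> ring

lemma abel_mono (a h : ℕ → ℝ) (D : ℝ) (hD : 0 ≤ D) (N M : ℕ) (hA : ∀ n, N ≤ n → n ≤ M → |∑ i ∈ Ioc N n, a i| ≤ D)
    (hm : ∀ n, N < n → n < M → h n ≤ h (n + 1)) (h0 : ∀ n, N < n → n ≤ M → 0 ≤ h n) (hNM : N < M) :
    |∑ i ∈ Ioc N M, a i * h i| ≤ 2 * D * h M := by
  have hle : ∀ n, N < n → n ≤ M → h n ≤ h M := by
    intro n hn hnM
    induction M, hnM using Nat.le_induction with
    | base => exact le_rfl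
    | succ M hM ih =>
      have h1 := ih (fun k hk hk2 => hA k hk (by omega)) (fun k hk hk2 => hm k hk (by omega)) (fun k hk hk2 => h0 k hk (by omega)) (by omega)
      exact h1.trans (hm M (by omega) (by omega))
  have h1 := abel_antitone a (fun n => h M - h n) D hD N M hA (fun n h1 h2 => by linarith [hm n h1 h2])
    (fun n h1 h2 => by linarith [hle n h1 h2]) hNM
  have e : ∑ i ∈ Ioc N M, a i * h i = h M * ∑ i ∈ Ioc N M, a i - ∑ i ∈ Ioc N M, a i * (h M - h i) := by
    rw [mul_sum, ← sum_sub_distrib]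
    refine sum_congr rfl (fun i _ => ?_)
    ring
  rw [e]
  refine (abs_sub _ _).trans ?_
  rw [abs_mul, abs_of_nonneg (h0 M hNM le_rfl)]
  have h2 := mul_le_mul_of_nonneg_left (hA M hNM.le le_rfl) (h0 M hNM le_rfl)
  have h3 := h0 (N + 1) (by omega) (by omega)
  have h4 : D * (h M - h (N + 1)) ≤ D * h M := by gcongr; linarith
  linarith

lemma ind_sum (k n : ℕ) : ∑ m ∈ Ioc 0 n, (if m.Coprime k then (moebius m : ℝ) / m else 0) = SK ind1 k n := by
  unfold SK
  rw [Nat.floor_natCast]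
  refine sum_congr rfl (fun m hm => ?_)
  rw [mem_Ioc] at hm
  have hm0 : (0:ℝ) < m := by exact_mod_cast hm.1
  have : ind1 ((n:ℝ) / m) = 1 := by
    unfold ind1
    rw [if_pos]
    rw [le_div_iff₀ hm0, one_mul]
    exact_mod_cast hm.2
  rw [this, mul_one]

lemma J_bound {C : ℝ} (hC : 0 < C) (hb : ∀ k : ℕ, Squarefree k → ∀ y : ℝ, |SK ind1 k y| ≤ cK k * (C * bB y))
    (ρ : ℕ → ℝ) (h : ℕ → ℝ) (d M Y : ℕ) (hd : Squarefree d) (H t : ℝ) (ht : 0 ≤ t)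
    (hρ0 : ∀ m, 0 < m → 0 ≤ ρ m) (hρ1 : ∀ m, 0 < m → ρ m ≤ 1) (hρa : ∀ m, 0 < m → ρ (m + 1) ≤ ρ m)
    (hh0 : ∀ m, 0 < m → 0 ≤ h m) (hh1 : ∀ m, 0 < m → h m ≤ t * m) (hhm : ∀ m, 0 < m → h m ≤ h (m + 1)) (hH0 : 0 ≤ H) (hH : ∀ m, 0 < m → m ≤ M → h m ≤ H) :
    |∑ m ∈ Ioc 0 M, (if m.Coprime d then (moebius m : ℝ) / m else 0) * h m * ρ m| ≤ Y * t + 4 * C * cK d * bB Y * H := by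
  set a : ℕ → ℝ := fun m => if m.Coprime d then (moebius m : ℝ) / m else 0 with ha
  have hc := one_le_cK d
  have hB := bB_pos Y
  have habs : ∀ m : ℕ, 0 < m → |a m| ≤ 1 / m := by
    intro m hm
    simp only [ha]
    split_ifs
    · rw [abs_div, Nat.abs_cast]
      gcongr
      exact abs_moebius_le m
    · simp
  have hsmall : ∀ K : ℕ, K ≤ Y → |∑ m ∈ Ioc 0 K, a m * h m * ρ m| ≤ Y * t := by
    intro K hK
    refine (abs_sum_le_sum_abs _ _).trans ?_
    calc ∑ m ∈ Ioc 0 K, |a m * h m * ρ m| ≤ ∑ m ∈ Ioc 0 K, t := by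
          refine sum_le_sum (fun m hm => ?_)
          have hm0 := (mem_Ioc.mp hm).1
          have hm0' : (0:ℝ) < m := by exact_mod_cast hm0
          rw [abs_mul, abs_mul, abs_of_nonneg (hh0 m hm0), abs_of_nonneg (hρ0 m hm0)]
          have h1 := habs m hm0
          have h2 := hh1 m hm0
          have h3 := hh0 m hm0
          have h4 := hρ0 m hm0
          have h5 := hρ1 m hm0
          calc |a m| * h m * ρ m ≤ (1 / m) * (t * m) * 1 := by gcongr
            _ = t := by field_simp
      _ = K * t := by simp
      _ ≤ Y * t := by gcongr
  have hpos : 0 ≤ 4 * C * cK d * bB Y * H := by positivity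
  rcases le_or_gt M Y with hMY | hMY
  · linarith [hsmall M hMY]
  rw [← sum_Ioc_consecutive _ (Nat.zero_le Y) hMY.le]
  refine (abs_add_le _ _).trans ?_
  refine add_le_add (hsmall Y le_rfl) ?_
  set D := 2 * C * cK d * bB Y with hD
  have hD0 : 0 ≤ D := by positivity
  have hA : ∀ n, Y ≤ n → |∑ i ∈ Ioc Y n, a i| ≤ D := by
    intro n hn
    have e : ∑ i ∈ Ioc Y n, a i = SK ind1 d n - SK ind1 d Y := by
      rw [← ind_sum, ← ind_sum, ← sum_Ioc_consecutive _ (Nat.zero_le Y) hn]; ring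
    rw [e]
    refine (abs_sub _ _).trans ?_
    have h1 := hb d hd n
    have h2 := hb d hd Y
    have h3 : cK d * (C * bB n) ≤ cK d * (C * bB Y) := by
      have := bB_anti (Y:ℝ) n (by exact_mod_cast hn)
      gcongr
    rw [hD]; linarith
  have hA2 : ∀ n, Y ≤ n → n ≤ M → |∑ i ∈ Ioc Y n, a i * h i| ≤ 2 * D * H := by
    intro n hn hnM
    rcases hn.eq_or_lt with rfl | hlt
    · simp; positivity
    · refine (abel_mono a h D hD0 Y n (fun k hk _ => hA k hk) (fun k hk _ => hhm k (by omega)) (fun k hk _ => hh0 k (by omega)) hlt).trans ?_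
      have := hH n (by omega) hnM
      gcongr
  have := abel_antitone (fun i => a i * h i) ρ (2 * D * H) (by positivity) Y M hA2 (fun k hk _ => hρa k (by omega)) (fun k hk _ => hρ0 k (by omega)) hMY
  refine this.trans ?_
  have h1 := hρ1 (Y + 1) (by omega)
  calc 2 * D * H * ρ (Y + 1) ≤ 2 * D * H * 1 := by gcongr
    _ = _ := by rw [hD]; ring

noncomputable def rhoR (U V : ℝ) (d : ℕ) : ℝ := (lgp (V / d) - lgp (U / d)) / log (V / U)

lemma psiR_rho (U V : ℝ) (d : ℕ) : psiR U V d = (moebius d : ℝ) * rhoR U V d := by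
  unfold psiR rhoR; ring

lemma rho_cases {U V : ℝ} (hU : 0 < U) (hUV : U < V) (d : ℕ) (hd : 0 < d) :
    rhoR U V d = max 0 (min 1 ((log V - log d) / log (V / U))) := by
  have hd0 : (0:ℝ) < d := by exact_mod_cast hd
  have hV : 0 < V := by linarith
  have hlam : 0 < log (V / U) := Real.log_pos (by rw [lt_div_iff₀ hU]; linarith)
  have hlam' : log (V / U) = log V - log U := Real.log_div hV.ne' hU.ne'
  unfold rhoR lgp
  have i1 : 1 ≤ V / d ↔ log d ≤ log V := by
    rw [le_div_iff₀ hd0, one_mul, Real.log_le_log_iff hd0 hV]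
  have i2 : 1 ≤ U / d ↔ log d ≤ log U := by
    rw [le_div_iff₀ hd0, one_mul, Real.log_le_log_iff hd0 hU]
  rw [Real.log_div hV.ne' hd0.ne', Real.log_div hU.ne' hd0.ne']
  simp only [i1, i2]
  split_ifs with h1 h2
  · have e : (log V - log d - (log U - log d)) / log (V / U) = 1 := by
      rw [div_eq_one_iff_eq hlam.ne']; linarith
    rw [e, min_eq_left, max_eq_right zero_le_one]
    rw [le_div_iff₀ hlam]; linarith
  · rw [sub_zero, min_eq_right, max_eq_right]
    · apply div_nonneg (by linarith) hlam.le
    · rw [div_le_one hlam]; linarith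
  · exfalso; linarith
  · rw [sub_zero, zero_div, max_eq_left]
    refine (min_le_right _ _).trans ?_
    apply div_nonpos_of_nonpos_of_nonneg (by linarith) hlam.le

lemma rho_anti {U V : ℝ} (hU : 0 < U) (hUV : U < V) {d e : ℕ} (hd : 0 < d) (hde : d ≤ e) : rhoR U V e ≤ rhoR U V d := by
  rw [rho_cases hU hUV d hd, rho_cases hU hUV e (by omega)]
  have hlam : 0 < log (V / U) := Real.log_pos (by rw [lt_div_iff₀ hU]; linarith)
  have : log d ≤ log e := Real.log_le_log (by exact_mod_cast hd) (by exact_mod_cast hde)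
  gcongr

lemma rho_nonneg {U V : ℝ} (hU : 0 < U) (hUV : U < V) {d : ℕ} (hd : 0 < d) : 0 ≤ rhoR U V d := by
  rw [rho_cases hU hUV d hd]; exact le_max_left _ _

lemma rho_le_one {U V : ℝ} (hU : 0 < U) (hUV : U < V) {d : ℕ} (hd : 0 < d) : rhoR U V d ≤ 1 := by
  rw [rho_cases hU hUV d hd]; exact max_le zero_le_one (min_le_left _ _)

lemma psiR_abs {U V : ℝ} (hU : 0 < U) (hUV : U < V) {d : ℕ} (hd : 0 < d) : |psiR U V d| ≤ 1 := by
  rw [psiR_rho, abs_mul, abs_of_nonneg (rho_nonneg hU hUV hd)]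
  have h1 := abs_moebius_le d
  have h2 := rho_le_one hU hUV hd
  have h3 := rho_nonneg hU hUV hd
  calc _ ≤ (1:ℝ) * 1 := by gcongr
    _ = 1 := by ring

lemma RR_bound : ∃ C : ℝ, 0 < C ∧ ∀ (U V X : ℝ) (Y : ℕ), 1 ≤ U → U < V → 1 ≤ X →
    |RR (psiR U V) ⌊V⌋₊ X| ≤ (Y * V / X + C * bB Y * log (1 + V ^ 2)) * (1 + log V) ^ 8 := by
  obtain ⟨C, hC, hb⟩ := SK_bound
  refine ⟨4 * C, by positivity, fun U V X Y hU hUV hX => ?_⟩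
  have hU0 : 0 < U := by linarith
  have hV0 : 0 < V := by linarith
  have hX0 : 0 < X := by linarith
  have hV1 : 1 ≤ V := by linarith
  set N := ⌊V⌋₊ with hN
  have hN1 : 1 ≤ N := (Nat.one_le_floor_iff _).mpr hV1
  have hNV : (N:ℝ) ≤ V := Nat.floor_le hV0.le
  set H := log (1 + V ^ 2) with hHdef
  have hH0 : 0 ≤ H := Real.log_nonneg (by nlinarith)
  have hB := bB_pos Y
  set E := Y * V / X + 4 * C * bB Y * H with hE
  have hE0 : 0 ≤ E := by positivity
  have hinner : ∀ d ∈ sf N, |∑ e ∈ Ioc 0 N, psiR U V d * psiR U V e / (d.lcm e : ℕ) * hh ((d.lcm e : ℕ) / X)| ≤ (d.divisors.card : ℝ) * cK d / d * E := by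
    intro d hd
    rw [mem_sf] at hd
    have hd0 : (0:ℝ) < d := by exact_mod_cast hd.1.1
    have hdV : (d:ℝ) ≤ V := le_trans (by exact_mod_cast hd.1.2) hNV
    have hc := one_le_cK d
    obtain ⟨F, hF⟩ : ∃ F : ℕ → ℝ, ∀ t, F t = hh ((t:ℝ) / X) / t := ⟨_, fun _ => rfl⟩
    have e1 : ∑ e ∈ Ioc 0 N, psiR U V d * psiR U V e / (d.lcm e : ℕ) * hh ((d.lcm e : ℕ) / X) =
        psiR U V d * ∑ e ∈ Ioc 0 N, (moebius e : ℝ) * rhoR U V e * F (d.lcm e) := by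
      rw [mul_sum]
      refine sum_congr rfl (fun e _ => ?_)
      rw [psiR_rho U V e, hF]; ring
    rw [e1, abs_mul, inner_eq (rhoR U V) d N hd.2]
    have hψ := psiR_abs hU0 hUV hd.1.1
    have e2 : |∑ g ∈ d.divisors, (moebius g : ℝ) * ∑ m ∈ Ioc 0 (N / g), (if m.Coprime d then (moebius m : ℝ) * rhoR U V (g * m) * F (d * m) else 0)|
        ≤ ∑ g ∈ d.divisors, 1 / (d:ℝ) * (cK d * E) := by
      refine (abs_sum_le_sum_abs _ _).trans (sum_le_sum (fun g hg => ?_))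
      have hg0 : 0 < g := Nat.pos_of_dvd_of_pos (Nat.dvd_of_mem_divisors hg) hd.1.1
      rw [abs_mul]
      have hmu := abs_moebius_le g
      have e3 : ∑ m ∈ Ioc 0 (N / g), (if m.Coprime d then (moebius m : ℝ) * rhoR U V (g * m) * F (d * m) else 0)
          = 1 / (d:ℝ) * ∑ m ∈ Ioc 0 (N / g), (if m.Coprime d then (moebius m : ℝ) / m else 0) * (fun m : ℕ => hh (d * m / X)) m * (fun m : ℕ => rhoR U V (g * m)) m := by
        rw [mul_sum]
        refine sum_congr rfl (fun m _ => ?_)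
        rw [hF]
        push_cast
        rw [← div_div (hh _)]
        split_ifs
        · ring
        · ring
      rw [e3, abs_mul, abs_of_pos (by positivity : 0 < 1 / (d:ℝ))]
      have hJ := J_bound hC (fun k hk y => (hb k hk y).1) (fun m : ℕ => rhoR U V (g * m)) (fun m : ℕ => hh (d * m / X)) d (N / g) Y hd.2 H (V / X) (by positivity)
        (fun m hm => rho_nonneg hU0 hUV (Nat.mul_pos hg0 hm)) (fun m hm => rho_le_one hU0 hUV (Nat.mul_pos hg0 hm))
        (fun m hm => rho_anti hU0 hUV (Nat.mul_pos hg0 hm) (Nat.mul_le_mul_left g (Nat.le_succ m)))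
        (fun m hm => by
          have hm' : (0:ℝ) < m := by exact_mod_cast hm
          exact hh_nonneg (by positivity))
        (fun m hm => by
          have hm' : (0:ℝ) < m := by exact_mod_cast hm
          refine (hh_le (by positivity)).trans ?_
          rw [div_mul_eq_mul_div]
          gcongr)
        (fun m hm => by
          have hm' : (0:ℝ) < m := by exact_mod_cast hm
          apply hh_mono (by positivity)
          push_cast
          gcongr
          linarith)
        hH0
        (fun m hm hmM => by
          have hm' : (0:ℝ) < m := by exact_mod_cast hm
          refine (hh_le_log (by positivity)).trans ?_
          apply Real.log_le_log (by positivity)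
          have hmV : (m:ℝ) ≤ V := by
            refine le_trans ?_ hNV
            exact_mod_cast hmM.trans (Nat.div_le_self _ _)
          have : (d:ℝ) * m / X ≤ d * m := div_le_self (by positivity) hX
          have h2 : (d:ℝ) * m ≤ V * V := by gcongr
          nlinarith)
      have hfin : Y * (V / X) + 4 * C * cK d * bB Y * H ≤ cK d * E := by
        rw [hE]
        have h1 : Y * (V / X) ≤ cK d * (Y * V / X) := by
          rw [← mul_div_assoc]
          exact le_mul_of_one_le_left (by positivity) hc
        linarith
      have hcE : 0 ≤ cK d * E := by positivity
      calc _ ≤ 1 * (1 / (d:ℝ) * (cK d * E)) := by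
            gcongr
            exact hJ.trans hfin
        _ = _ := one_mul _
    rw [sum_const, nsmul_eq_mul] at e2
    have hcE : 0 ≤ cK d * E := by positivity
    calc _ ≤ 1 * ((d.divisors.card : ℝ) * (1 / (d:ℝ) * (cK d * E))) := by gcongr
      _ = _ := by ring
  have hout : RR (psiR U V) N X = ∑ d ∈ sf N, ∑ e ∈ Ioc 0 N, psiR U V d * psiR U V e / (d.lcm e : ℕ) * hh ((d.lcm e : ℕ) / X) := by
    rw [sum_sf]
    unfold RR
    refine sum_congr rfl (fun d _ => ?_)
    split_ifs with hs
    · rfl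
    · refine sum_eq_zero (fun e _ => ?_)
      rw [psiR_sqf U V d hs]; simp
  rw [hout]
  refine (abs_sum_le_sum_abs _ _).trans ((sum_le_sum hinner).trans ?_)
  rw [← sum_mul, mul_comm]
  have hlogN : log N ≤ log V := Real.log_le_log (by exact_mod_cast hN1) hNV
  have hlogN0 : 0 ≤ log N := Real.log_nonneg (by exact_mod_cast hN1)
  have ht := tau_c_sum N hN1
  calc _ ≤ E * (1 + log N) ^ 8 := by gcongr
    _ ≤ _ := by gcongr

end

section
open Finset

lemma exp_neg_le (k : ℕ) {t : ℝ} (ht : 0 < t) : exp (-t) ≤ (k.factorial : ℝ) / t ^ k := by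
  rw [Real.exp_neg, inv_le_comm₀ (Real.exp_pos _) (by positivity), inv_div]
  exact Real.pow_div_factorial_le_exp t ht.le k

lemma T_est {u₁ v x₀ x₁ : ℝ} (hu : 0 < u₁) (h₃ : u₁ < v) (h₄ : v < x₀) (h₅ : x₀ < x₁) :
    ∃ C : ℝ, 0 < C ∧ ∃ L₀ : ℝ, 1 ≤ L₀ ∧ ∀ L : ℝ, L₀ ≤ L → ∀ x ∈ Set.Icc x₀ x₁,
      |TT (psiR (exp (L * u₁)) (exp (L * v))) ⌊exp (L * v)⌋₊ (exp (L * x)) - (3 / 2 + (x - v) / (v - u₁))| ≤ C / L := by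
  have hv : 0 < v := by linarith
  have hx1 : 0 < x₁ := by linarith
  obtain ⟨C1, hC1, hP⟩ := PP_est (x₁ / v) (by positivity)
  obtain ⟨C2, hC2, hR⟩ := RR_bound
  set δ := (x₀ - v) / 2 with hδ
  have hδ0 : 0 < δ := by rw [hδ]; linarith
  have hvu : 0 < v - u₁ := by linarith
  refine ⟨C1 * v / (v - u₁) ^ 2 + ((Nat.factorial 9 : ℝ) / δ ^ 9 + C2 * (1 + 2 * v) / δ ^ 10) * (1 + v) ^ 8, by positivity, max 1 (1 / v), le_max_left _ _, fun L hL x hx => ?_⟩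
  have hL1 : 1 ≤ L := (le_max_left _ _).trans hL
  have hLv : 1 ≤ L * v := by
    have := (le_max_right _ _).trans hL
    rwa [div_le_iff₀ hv] at this
  have hL0 : 0 < L := by linarith
  have hx0 : 0 < x := by linarith [hx.1]
  rw [TT_eq _ _ (Real.exp_pos _), Real.log_exp]
  have hlam : log (exp (L * v) / exp (L * u₁)) = L * (v - u₁) := by
    rw [← Real.exp_sub, Real.log_exp]; ring
  have hU1 : 1 ≤ exp (L * u₁) := Real.one_le_exp (by positivity)
  have hUV : exp (L * u₁) < exp (L * v) := Real.exp_lt_exp.mpr (by gcongr)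
  have p := hP (exp (L * u₁)) (exp (L * v)) (L * x) hU1 hUV (by rw [Real.log_exp]; exact hLv) (by positivity)
    (by
      rw [Real.log_exp]
      have : x₁ / v * (L * v) = L * x₁ := by field_simp
      rw [this]; gcongr; exact hx.2)
  rw [hlam, Real.log_exp] at p
  have e1 : (L * x - L * v) / (L * (v - u₁)) + 3 / 2 = 3 / 2 + (x - v) / (v - u₁) := by
    rw [← mul_sub, mul_div_mul_left _ _ hL0.ne']; ring
  have e2 : C1 * (L * v) / (L * (v - u₁)) ^ 2 = C1 * v / (v - u₁) ^ 2 / L := by field_simp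
  rw [e1, e2] at p
  have r := hR (exp (L * u₁)) (exp (L * v)) (exp (L * x)) ⌊exp (L * δ)⌋₊ hU1 hUV (Real.one_le_exp (by positivity))
  rw [Real.log_exp] at r
  have r1 : (⌊exp (L * δ)⌋₊ : ℝ) * exp (L * v) / exp (L * x) ≤ (Nat.factorial 9 : ℝ) / δ ^ 9 / L ^ 9 := by
    calc (⌊exp (L * δ)⌋₊ : ℝ) * exp (L * v) / exp (L * x) ≤ exp (L * δ) * exp (L * v) / exp (L * x) := by
          gcongr
          exact Nat.floor_le (Real.exp_pos _).le
      _ = exp (L * δ + L * v - L * x) := by rw [Real.exp_sub, Real.exp_add]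
      _ ≤ exp (-(L * δ)) := by
          apply Real.exp_le_exp.mpr
          have : L * (2 * δ + v) ≤ L * x := by
            gcongr
            rw [hδ]; linarith [hx.1]
          linarith
      _ ≤ (Nat.factorial 9 : ℝ) / (L * δ) ^ 9 := exp_neg_le 9 (by positivity)
      _ = _ := by rw [mul_pow]; field_simp
  have r2 : bB (⌊exp (L * δ)⌋₊ : ℝ) ≤ 1 / (δ * L) ^ 10 := by
    have hz1 : 1 ≤ exp (L * δ) := Real.one_le_exp (by positivity)
    have hf1 : 1 ≤ ⌊exp (L * δ)⌋₊ := (Nat.one_le_floor_iff _).mpr hz1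
    have hf1' : (1:ℝ) ≤ (⌊exp (L * δ)⌋₊ : ℝ) := by exact_mod_cast hf1
    have hf2 := Nat.lt_floor_add_one (exp (L * δ))
    unfold bB
    rw [max_eq_right hf1']
    have hlog : δ * L - log 2 ≤ log (⌊exp (L * δ)⌋₊ : ℝ) := by
      have h : log (exp (L * δ) / 2) ≤ log (⌊exp (L * δ)⌋₊ : ℝ) :=
        Real.log_le_log (by positivity) (by linarith)
      rw [Real.log_div (Real.exp_pos _).ne' (by norm_num), Real.log_exp] at h
      linarith
    have hl2 := Real.log_two_lt_d9
    gcongr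
    linarith
  have r3 : log (1 + exp (L * v) ^ 2) ≤ (1 + 2 * v) * L := by
    have h1 : 1 ≤ exp (L * v) := Real.one_le_exp (by positivity)
    have h2 : 1 + exp (L * v) ^ 2 ≤ 2 * exp (L * v) ^ 2 := by nlinarith
    calc log (1 + exp (L * v) ^ 2) ≤ log (2 * exp (L * v) ^ 2) := Real.log_le_log (by positivity) h2
      _ = log 2 + 2 * (L * v) := by
          rw [Real.log_mul (by norm_num) (by positivity), Real.log_pow, Real.log_exp]; norm_num
      _ ≤ _ := by
          have := Real.log_two_lt_d9
          nlinarith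
  have r3' : 0 ≤ log (1 + exp (L * v) ^ 2) := Real.log_nonneg (by nlinarith [Real.exp_pos (L * v)])
  have r4 : (1 + L * v) ^ 8 ≤ ((1 + v) * L) ^ 8 := by
    gcongr; linarith
  have hB := bB_pos (⌊exp (L * δ)⌋₊ : ℝ)
  have r5 : |RR (psiR (exp (L * u₁)) (exp (L * v))) ⌊exp (L * v)⌋₊ (exp (L * x))| ≤
      ((Nat.factorial 9 : ℝ) / δ ^ 9 + C2 * (1 + 2 * v) / δ ^ 10) * (1 + v) ^ 8 / L := by
    refine r.trans ?_
    calc _ ≤ ((Nat.factorial 9 : ℝ) / δ ^ 9 / L ^ 9 + C2 * (1 / (δ * L) ^ 10) * ((1 + 2 * v) * L)) * ((1 + v) * L) ^ 8 := by gcongr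
      _ = _ := by field_simp
  set a := PP (exp (L * u₁)) (exp (L * v)) (L * x)
  set b := RR (psiR (exp (L * u₁)) (exp (L * v))) ⌊exp (L * v)⌋₊ (exp (L * x))
  have : a + b - (3 / 2 + (x - v) / (v - u₁)) = (a - (3 / 2 + (x - v) / (v - u₁))) + b := by ring
  rw [this, add_div]
  exact (abs_add_le _ _).trans (add_le_add p r5)

lemma psiR_le {U V : ℝ} (hU : 0 < U) (hUV : U < V) {d : ℕ} (hd : 0 < d) (hdU : (d:ℝ) ≤ U) : psiR U V d = (moebius d : ℝ) := by
  have hd0 : (0:ℝ) < d := by exact_mod_cast hd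
  have hV : 0 < V := by linarith
  have hlam : 0 < log (V / U) := Real.log_pos (by rw [lt_div_iff₀ hU]; linarith)
  have hlam' : log (V / U) = log V - log U := Real.log_div hV.ne' hU.ne'
  unfold psiR lgp
  rw [if_pos (by rw [le_div_iff₀ hd0]; linarith), if_pos (by rw [le_div_iff₀ hd0]; linarith), Real.log_div hV.ne' hd0.ne', Real.log_div hU.ne' hd0.ne']
  rw [div_eq_iff hlam.ne', hlam']; ring

lemma psiR_gt {U V : ℝ} (hUV : U < V) {d : ℕ} (hd : ⌊V⌋₊ < d) : psiR U V d = 0 := by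
  have hd0 : (0:ℝ) < d := by exact_mod_cast (by omega : 0 < d)
  have h : V < d := (Nat.floor_lt' (by omega)).mp hd
  unfold psiR
  rw [lgp_lt_one (V / d) (by rw [div_lt_one hd0]; exact h), lgp_lt_one (U / d) (by rw [div_lt_one hd0]; linarith)]
  simp

lemma b_small {U V : ℝ} (hU : 0 < U) (hUV : U < V) {n : ℕ} (hn : 0 < n) (hnU : (n:ℝ) ≤ U) :
    ∑ d ∈ n.divisors, psiR U V d = if n = 1 then 1 else 0 := by
  rw [← sum_moebius_div n hn, Nat.sum_div_divisors n (fun d => (moebius d : ℝ))]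
  refine sum_congr rfl (fun d hd => ?_)
  have hdn := Nat.dvd_of_mem_divisors hd
  refine psiR_le hU hUV (Nat.pos_of_dvd_of_pos hdn hn) (le_trans ?_ hnU)
  exact_mod_cast Nat.le_of_dvd hn hdn

lemma b_abs {U V : ℝ} (hU : 0 < U) (hUV : U < V) {n : ℕ} (hn : 0 < n) : |∑ d ∈ n.divisors, psiR U V d| ≤ n := by
  refine (abs_sum_le_sum_abs _ _).trans ?_
  calc _ ≤ ∑ d ∈ n.divisors, (1:ℝ) := sum_le_sum (fun d hd => psiR_abs hU hUV (Nat.pos_of_dvd_of_pos (Nat.dvd_of_mem_divisors hd) hn))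
    _ = (n.divisors.card : ℝ) := by simp
    _ ≤ n := by exact_mod_cast Nat.card_divisors_le_self n

lemma T_small {u₀ u₁ v : ℝ} (hu0 : 0 < u₀) (hu : u₀ < u₁) (h₃ : u₁ < v) :
    ∃ C : ℝ, 0 < C ∧ ∃ L₀ : ℝ, 1 ≤ L₀ ∧ ∀ L : ℝ, L₀ ≤ L → ∀ u ∈ Set.Icc u₀ u₁,
      |TT (psiR (exp (L * u₁)) (exp (L * v))) ⌊exp (L * v)⌋₊ (exp (L * u) / L ^ 2) - 1| ≤ C / L := by
  have hsm : Summable (fun n : ℕ => 1 / (n:ℝ) ^ 2) := (Real.summable_one_div_nat_pow (p := 2)).mpr (by norm_num)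
  set Z := ∑' n : ℕ, 1 / (n:ℝ) ^ 2 with hZ
  have hZ0 : 0 ≤ Z := tsum_nonneg (fun n => by positivity)
  refine ⟨6 / u₀ ^ 3 + 48 * Z, by positivity, max 1 (6 * u₁ + 2), le_max_left _ _, fun L hL u hu' => ?_⟩
  have hL1 : 1 ≤ L := (le_max_left _ _).trans hL
  have hL2 : 6 * u₁ + 2 ≤ L := (le_max_right _ _).trans hL
  have hL0 : 0 < L := by linarith
  have hu1 : 0 < u₁ := by linarith
  set U := exp (L * u₁) with hU
  set V := exp (L * v)
  have hU0 : 0 < U := Real.exp_pos _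
  have hU1 : 1 ≤ U := Real.one_le_exp (by positivity)
  have hUV : U < V := Real.exp_lt_exp.mpr (by gcongr)
  set X := exp (L * u) / L ^ 2 with hX
  have hX0 : 0 < X := by positivity
  set N := ⌊V⌋₊
  have hs := TT_hasSum (psiR U V) N (fun d hd => psiR_gt hUV hd) hX0
  have h1 := hasSum_ite_eq (1:ℕ) (exp (-1 / X))
  have h2 := hs.sub h1
  set K := 48 * exp (-L) with hK
  have hK0 : 0 < K := by positivity
  have hb : ∀ n : ℕ, 0 ≤ (∑ d ∈ n.divisors, psiR U V d) ^ 2 * (n:ℝ)⁻¹ * exp (-(n:ℝ) / X) - (if n = 1 then exp (-1 / X) else 0) ∧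
      (∑ d ∈ n.divisors, psiR U V d) ^ 2 * (n:ℝ)⁻¹ * exp (-(n:ℝ) / X) - (if n = 1 then exp (-1 / X) else 0) ≤ K * (1 / (n:ℝ) ^ 2) := by
    intro n
    rcases Nat.eq_zero_or_pos n with rfl | hn
    · simp
    have hn0 : (0:ℝ) < n := by exact_mod_cast hn
    by_cases hnU : (n:ℝ) ≤ U
    · rw [b_small hU0 hUV hn hnU]
      by_cases h : n = 1
      · subst h
        simp; positivity
      · rw [if_neg h, if_neg h]; simp; positivity
    · push Not at hnU
      have hn1 : n ≠ 1 := by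
        rintro rfl; push_cast at hnU; linarith
      rw [if_neg hn1, sub_zero]
      refine ⟨by positivity, ?_⟩
      have hba := b_abs hU0 hUV hn
      have hbs : (∑ d ∈ n.divisors, psiR U V d) ^ 2 ≤ (n:ℝ) ^ 2 := by
        rw [← sq_abs]; gcongr
      have huu : exp (L * u) ≤ U := Real.exp_le_exp.mpr (by gcongr; exact hu'.2)
      have hXU : X ≤ U := (div_le_self (Real.exp_pos _).le (one_le_pow₀ hL1)).trans huu
      have hnX : L ^ 2 ≤ n / X := by
        rw [le_div_iff₀ hX0, hX]
        have : L ^ 2 * (exp (L * u) / L ^ 2) = exp (L * u) := by field_simp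
        rw [this]; linarith
      have hexp : exp (-(n:ℝ) / X) ≤ exp (-(L ^ 2 / 2)) * (48 * X ^ 3 / n ^ 3) := by
        have h3 : exp (-(n:ℝ) / X) = exp (-(n / X / 2)) * exp (-(n / X / 2)) := by
          rw [← Real.exp_add]; congr 1; ring
        have h4 : exp (-(n / X / 2)) ≤ 48 * X ^ 3 / n ^ 3 := by
          refine (exp_neg_le 3 (by positivity)).trans (le_of_eq ?_)
          have : (Nat.factorial 3 : ℝ) = 6 := by norm_num [Nat.factorial]
          rw [this]
          field_simp
          norm_num
        rw [h3]
        gcongr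
      have hfin : exp (-(L ^ 2 / 2)) * X ^ 3 ≤ exp (-L) := by
        calc exp (-(L ^ 2 / 2)) * X ^ 3 ≤ exp (-(L ^ 2 / 2)) * U ^ 3 := by gcongr
          _ = exp (-(L ^ 2 / 2) + 3 * (L * u₁)) := by rw [Real.exp_add, hU, ← Real.exp_nat_mul]; norm_num
          _ ≤ _ := by
            apply Real.exp_le_exp.mpr
            nlinarith
      calc _ ≤ (n:ℝ) ^ 2 * (n:ℝ)⁻¹ * (exp (-(L ^ 2 / 2)) * (48 * X ^ 3 / n ^ 3)) := by gcongr
        _ = 48 * (exp (-(L ^ 2 / 2)) * X ^ 3) * (1 / (n:ℝ) ^ 2) := by field_simp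
        _ ≤ _ := by rw [hK]; gcongr
  have l1 : 0 ≤ TT (psiR U V) N X - exp (-1 / X) := h2.nonneg (fun n => (hb n).1)
  have l2 : TT (psiR U V) N X - exp (-1 / X) ≤ K * Z := hasSum_le (fun n => (hb n).2) h2 (hsm.hasSum.mul_left K)
  have l3 : exp (-1 / X) ≤ 1 := Real.exp_le_one_iff.mpr (by
    rw [neg_div]
    have : 0 < 1 / X := by positivity
    linarith)
  have l4 : 1 - 6 / u₀ ^ 3 / L ≤ exp (-1 / X) := by
    have h3 := Real.add_one_le_exp (-1 / X)
    have h4 : 1 / X ≤ 6 / u₀ ^ 3 / L := by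
      rw [hX, one_div_div]
      calc L ^ 2 / exp (L * u) ≤ L ^ 2 / exp (L * u₀) := by gcongr; exact hu'.1
        _ = L ^ 2 * exp (-(L * u₀)) := by rw [Real.exp_neg]; rfl
        _ ≤ L ^ 2 * ((Nat.factorial 3 : ℝ) / (L * u₀) ^ 3) := by
            gcongr; exact exp_neg_le 3 (by positivity)
        _ = _ := by
            have : (Nat.factorial 3 : ℝ) = 6 := by norm_num [Nat.factorial]
            rw [this]; field_simp
    rw [neg_div] at h3
    rw [neg_div]
    linarith
  have l5 : K ≤ 48 / L := by
    have := exp_neg_le 1 hL0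
    rw [hK]
    simp at this
    rw [div_eq_mul_inv]; gcongr
  have l6 : K * Z ≤ 48 * Z / L := by
    calc K * Z ≤ 48 / L * Z := by gcongr
      _ = _ := by ring
  have p1 : 0 ≤ 6 / u₀ ^ 3 / L := by positivity
  have p2 : 0 ≤ 48 * Z / L := by positivity
  rw [add_div, abs_le]
  constructor <;> linarith

end

section
open Finset MeasureTheory

lemma exch (ψ : ℕ → ℝ) (N : ℕ) (hψ : ∀ d, N < d → ψ d = 0) (X : ℝ → ℝ) (hXc : Continuous X)
    (hXp : ∀ t, 0 < X t) (hXm : Monotone X) {a b : ℝ} (hab : a ≤ b) :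
    HasSum (fun n : ℕ => (∑ d ∈ n.divisors, ψ d) ^ 2 * (n : ℝ)⁻¹ *
      ∫ t in a..b, exp (-(n : ℝ) / X t)) (∫ t in a..b, TT ψ N (X t)) := by
  have hne : ∀ t, X t ≠ 0 := fun t => (hXp t).ne'
  have h1 : HasSum (fun n : ℕ => ∫ t in a..b, (∑ d ∈ n.divisors, ψ d) ^ 2 * (n : ℝ)⁻¹ *
      exp (-(n : ℝ) / X t)) (∫ t in a..b, TT ψ N (X t)) := by
    apply intervalIntegral.hasSum_integral_of_dominated_convergence
      (fun (n : ℕ) (_ : ℝ) => (∑ d ∈ n.divisors, ψ d) ^ 2 * (n : ℝ)⁻¹ *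
        exp (-(n : ℝ) / X b))
    · intro n
      apply Continuous.aestronglyMeasurable
      exact continuous_const.mul (Real.continuous_exp.comp (continuous_const.div hXc hne))
    · intro n
      refine Filter.Eventually.of_forall (fun t ht => ?_)
      rw [Set.uIoc_of_le hab] at ht
      have hn : (0:ℝ) ≤ (n:ℝ) := Nat.cast_nonneg n
      rw [Real.norm_of_nonneg (by positivity)]
      refine mul_le_mul_of_nonneg_left ?_ (by positivity)
      refine Real.exp_le_exp.2 ?_
      rw [neg_div, neg_div]
      exact neg_le_neg (div_le_div_of_nonneg_left hn (hXp t) (hXm ht.2))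
    · exact Filter.Eventually.of_forall (fun t ht => (TT_hasSum ψ N hψ (hXp b)).summable)
    · exact intervalIntegrable_const
    · exact Filter.Eventually.of_forall (fun t ht => TT_hasSum ψ N hψ (hXp t))
  refine Eq.mp (congrArg (fun f => HasSum f _) ?_) h1
  funext n
  exact intervalIntegral.integral_const_mul _ _

lemma TT_cont (ψ : ℕ → ℝ) (N : ℕ) (X : ℝ → ℝ) (hXc : Continuous X)
    (hXp : ∀ t, 0 < X t) : Continuous (fun t => TT ψ N (X t)) := by
  unfold TT
  refine continuous_finsetSum _ (fun d hd => continuous_finsetSum _ (fun e he => ?_))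
  rw [mem_Ioc] at hd he
  have hm : (0:ℝ) < (d.lcm e : ℕ) := by exact_mod_cast Nat.lcm_pos hd.1 he.1
  refine continuous_const.mul (Continuous.neg (Continuous.log ?_ (fun t => ?_)))
  · exact continuous_const.sub (Real.continuous_exp.comp
      (continuous_const.div hXc (fun t => (hXp t).ne')).neg)
  · have : exp (-((d.lcm e : ℕ) / X t)) < 1 := by
      rw [Real.exp_lt_one_iff]
      have := div_pos hm (hXp t)
      linarith
    exact (sub_pos.2 this).ne'

lemma avg_close {f g : ℝ → ℝ} (hf : Continuous f) (hg : Continuous g) {a b c : ℝ} (hab : a < b)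
    (h : ∀ t ∈ Set.Icc a b, |f t - g t| ≤ c) :
    |(∫ t in a..b, f t) / (b - a) - (∫ t in a..b, g t) / (b - a)| ≤ c := by
  have hp : 0 < b - a := sub_pos.2 hab
  rw [← sub_div, ← intervalIntegral.integral_sub (hf.intervalIntegrable _ _)
    (hg.intervalIntegrable _ _), abs_div, abs_of_pos hp, div_le_iff₀ hp]
  have := intervalIntegral.norm_integral_le_of_norm_le_const (a := a) (b := b) (C := c)
    (f := fun t => f t - g t) (fun t ht => by
      rw [Set.uIoc_of_le hab.le] at ht
      exact h t ⟨ht.1.le, ht.2⟩)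
  rwa [abs_of_pos hp, Real.norm_eq_abs] at this

lemma psiD_eq {q : ℕ} (hq : 1 < q) {u₁ v : ℝ} (h₃ : u₁ < v) (d : ℕ) :
    psiD q u₁ v d = psiR (exp (log q * u₁)) (exp (log q * v)) d := by
  have hq0 : (0:ℝ) < q := by exact_mod_cast (by omega : 0 < q)
  have hL : 0 < log q := Real.log_pos (by exact_mod_cast hq)
  rw [psiD, Real.rpow_def_of_pos hq0, Real.rpow_def_of_pos hq0]
  generalize hU : exp (log q * u₁) = U
  generalize hV : exp (log q * v) = V
  have hU0 : 0 < U := hU ▸ Real.exp_pos _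
  have hUV : U < V := by
    rw [← hU, ← hV]; exact Real.exp_lt_exp.2 (mul_lt_mul_of_pos_left h₃ hL)
  have hV0 : 0 < V := hU0.trans hUV
  rcases Nat.eq_zero_or_pos d with rfl | hd
  · simp [psiR]
  have hd' : (0:ℝ) < d := by exact_mod_cast hd
  split_ifs with ha hb
  · rw [psiR_le hU0 hUV hd ha]
  · push Not at ha
    rw [psiR, lgp_lt_one (U / d) ((div_lt_one hd').2 ha), lgp, if_pos ((one_le_div hd').2 hb),
      sub_zero]
  · push Not at hb
    rw [psiR_gt hUV ((Nat.floor_lt hV0.le).2 hb)]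

lemma jW_eq {q : ℕ} (hq : 1 < q) {u₀ u₁ x₀ x₁ : ℝ} (hu : u₀ < u₁) (hx : x₀ < x₁) (n : ℕ) :
    jWeight q u₀ u₁ x₀ x₁ n =
      (∫ x in x₀..x₁, exp (-(n:ℝ) / exp (log q * x))) / (x₁ - x₀) -
      (∫ u in u₀..u₁, exp (-(n:ℝ) / (exp (log q * u) / (log q) ^ 2)))
        / (u₁ - u₀) := by
  have hq0 : (0:ℝ) < q := by exact_mod_cast (by omega : 0 < q)
  have hL : 0 < log q := Real.log_pos (by exact_mod_cast hq)
  unfold jWeight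
  simp only [Real.rpow_def_of_pos hq0]
  generalize log q = L at hL
  have c1 : Continuous (fun x : ℝ => exp (-(n:ℝ) / exp (L * x))) :=
    Real.continuous_exp.comp (continuous_const.div (by fun_prop) (fun x => (Real.exp_pos _).ne'))
  have e2 : ∀ u : ℝ, exp (-(n:ℝ) * L ^ 2 / exp (L * u)) =
      exp (-(n:ℝ) / (exp (L * u) / L ^ 2)) := fun u => by rw [div_div_eq_mul_div]
  simp only [e2]
  have c2 : Continuous (fun u : ℝ => exp (-(n:ℝ) / (exp (L * u) / L ^ 2))) :=
    Real.continuous_exp.comp (continuous_const.div (by fun_prop) (fun x => by positivity))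
  have i1 : ∀ x : ℝ, (∫ u in u₀..u₁, (exp (-(n:ℝ) / exp (L * x)) -
      exp (-(n:ℝ) / (exp (L * u) / L ^ 2)))) =
      (u₁ - u₀) * exp (-(n:ℝ) / exp (L * x)) -
      ∫ u in u₀..u₁, exp (-(n:ℝ) / (exp (L * u) / L ^ 2)) := by
    intro x
    rw [intervalIntegral.integral_sub intervalIntegrable_const (c2.intervalIntegrable _ _),
      intervalIntegral.integral_const, smul_eq_mul]
  simp only [i1]
  have c3 : Continuous (fun x : ℝ => (u₁ - u₀) * exp (-(n:ℝ) / exp (L * x))) :=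
    continuous_const.mul c1
  rw [intervalIntegral.integral_sub (c3.intervalIntegrable _ _)
    intervalIntegrable_const, intervalIntegral.integral_const, smul_eq_mul,
    intervalIntegral.integral_const_mul]
  have p1 : u₁ - u₀ ≠ 0 := (sub_pos.2 hu).ne'
  have p2 : x₁ - x₀ ≠ 0 := (sub_pos.2 hx).ne'
  field_simp

lemma main_int {u₁ v x₀ x₁ : ℝ} (h₃ : u₁ < v) (h₅ : x₀ < x₁) :
    (∫ x in x₀..x₁, (3/2 + (x - v) / (v - u₁))) / (x₁ - x₀) =
      (x₁ + x₀ - u₁ - v) / (2 * (v - u₁)) + 1 := by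
  have p1 : v - u₁ ≠ 0 := (sub_pos.2 h₃).ne'
  have p2 : x₁ - x₀ ≠ 0 := (sub_pos.2 h₅).ne'
  have : (∫ x in x₀..x₁, (3/2 + (x - v) / (v - u₁))) =
      (x₁ - x₀) * (3/2) + ((x₁ ^ 2 - x₀ ^ 2) / 2 - (x₁ - x₀) * v) / (v - u₁) := by
    rw [intervalIntegral.integral_add intervalIntegrable_const
      (Continuous.intervalIntegrable (by fun_prop) _ _), intervalIntegral.integral_const,
      intervalIntegral.integral_div, intervalIntegral.integral_sub
      (Continuous.intervalIntegrable (by fun_prop) _ _) intervalIntegrable_const,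
      intervalIntegral.integral_const, integral_id, smul_eq_mul, smul_eq_mul]
  rw [this]
  field_simp
  ring

theorem bn_main
    (w u₀ u₁ v x₀ x₁ : ℝ) (hw : 0 < w) (h₁ : w < u₀) (h₂ : u₀ < u₁) (h₃ : u₁ < v)
    (h₄ : v < x₀) (h₅ : x₀ < x₁) :
    ∃ C : ℝ, 0 < C ∧ ∃ q₀ : ℕ, ∀ q : ℕ, q₀ ≤ q →
      |(∑' n : ℕ, (∑ d ∈ n.divisors, psiD q u₁ v d) ^ 2 * (n : ℝ)⁻¹ *
          jWeight q u₀ u₁ x₀ x₁ n) -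
        (x₁ + x₀ - u₁ - v) / (2 * (v - u₁))|
        ≤ C * (log (log q) / log q) *
            ((x₁ + x₀ - u₁ - v) / (2 * (v - u₁))) := by
  obtain ⟨C₁, hC₁, L₁, hL₁, H1⟩ := T_est (hw.trans (h₁.trans h₂)) h₃ h₄ h₅
  obtain ⟨C₂, hC₂, L₂, hL₂, H2⟩ := T_small (hw.trans h₁) h₂ h₃
  have hK : 0 < (x₁ + x₀ - u₁ - v) / (2 * (v - u₁)) :=
    div_pos (by linarith) (by linarith)
  have hmi := main_int h₃ h₅
  generalize (x₁ + x₀ - u₁ - v) / (2 * (v - u₁)) = K at hK hmi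
  refine ⟨(C₁ + C₂) / K, by positivity,
    ⌈exp (max (max L₁ L₂) (exp 1))⌉₊, fun q hq => ?_⟩
  have hq' : exp (max (max L₁ L₂) (exp 1)) ≤ q := Nat.ceil_le.1 hq
  have hq0 : (0:ℝ) < q := (Real.exp_pos _).trans_le hq'
  have hLm : max (max L₁ L₂) (exp 1) ≤ log q := (Real.le_log_iff_exp_le hq0).2 hq'
  have hLe : exp 1 ≤ log q := (le_max_right _ _).trans hLm
  have hLa : L₁ ≤ log q := ((le_max_left _ _).trans (le_max_left _ _)).trans hLm
  have hLb : L₂ ≤ log q := ((le_max_right _ _).trans (le_max_left _ _)).trans hLm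
  have hL0 : 0 < log q := (Real.exp_pos _).trans_le hLe
  have hll : 1 ≤ log (log q) := (Real.le_log_iff_exp_le hL0).2 hLe
  have hq1 : 1 < q := by
    have : (1:ℝ) < q := by
      by_contra hcon
      push Not at hcon
      exact absurd (Real.log_nonpos hq0.le hcon) (not_le.2 hL0)
    exact_mod_cast this
  simp only [psiD_eq hq1 h₃, jW_eq hq1 h₂ h₅]
  specialize H1 _ hLa
  specialize H2 _ hLb
  generalize log q = L at *
  have hUV : exp (L * u₁) < exp (L * v) :=
    Real.exp_lt_exp.2 (mul_lt_mul_of_pos_left h₃ hL0)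
  have hz : ∀ d, ⌊exp (L * v)⌋₊ < d →
      psiR (exp (L * u₁)) (exp (L * v)) d = 0 := fun d hd => psiR_gt hUV hd
  generalize psiR (exp (L * u₁)) (exp (L * v)) = ψ at *
  generalize ⌊exp (L * v)⌋₊ = N at *
  have cX : Continuous (fun t : ℝ => exp (L * t)) := by fun_prop
  have cY : Continuous (fun t : ℝ => exp (L * t) / L ^ 2) := by fun_prop
  have pX : ∀ t : ℝ, 0 < exp (L * t) := fun t => Real.exp_pos _
  have pY : ∀ t : ℝ, 0 < exp (L * t) / L ^ 2 := fun t => by positivity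
  have mX : Monotone (fun t : ℝ => exp (L * t)) := fun s t h =>
    Real.exp_le_exp.2 (mul_le_mul_of_nonneg_left h hL0.le)
  have mY : Monotone (fun t : ℝ => exp (L * t) / L ^ 2) := fun s t h =>
    div_le_div_of_nonneg_right (mX h) (by positivity)
  have s1 := (exch ψ N hz _ cX pX mX h₅.le).div_const (x₁ - x₀)
  have s2 := (exch ψ N hz _ cY pY mY h₂.le).div_const (u₁ - u₀)
  have s3 := (s1.sub s2).tsum_eq
  have s4 : (∑' n : ℕ, (∑ d ∈ n.divisors, ψ d) ^ 2 * (n : ℝ)⁻¹ *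
      ((∫ x in x₀..x₁, exp (-(n:ℝ) / exp (L * x))) / (x₁ - x₀) -
      (∫ u in u₀..u₁, exp (-(n:ℝ) / (exp (L * u) / L ^ 2))) / (u₁ - u₀))) =
      (∫ (t : ℝ) in x₀..x₁, TT ψ N (exp (L * t))) / (x₁ - x₀) -
      (∫ (t : ℝ) in u₀..u₁, TT ψ N (exp (L * t) / L ^ 2)) / (u₁ - u₀) := by
    refine Eq.trans (tsum_congr (fun n => ?_)) s3
    rw [mul_sub, mul_div_assoc, mul_div_assoc]
  rw [s4]
  have a1 := avg_close (TT_cont ψ N _ cX pX) (g := fun x => 3/2 + (x - v) / (v - u₁))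
    (by fun_prop) h₅ H1
  have a2 := avg_close (TT_cont ψ N _ cY pY) (g := fun x => 1) continuous_const h₂ H2
  rw [hmi] at a1
  rw [intervalIntegral.integral_const, smul_eq_mul, mul_one,
    div_self (sub_pos.2 h₂).ne'] at a2
  have fin : (C₁ + C₂) / K * (log L / L) * K = (C₁ / L + C₂ / L) * log L := by
    field_simp
  rw [fin]
  have hs : 0 ≤ C₁ / L + C₂ / L := by positivity
  refine le_trans ?_ (le_mul_of_one_le_right hs hll)
  rw [abs_le] at a1 a2 ⊢
  constructor <;> linarith [a1.1, a1.2, a2.1, a2.2]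

end

end

/-- **Evaluation of the `b_n` sum**: with fixed exponents `0 < w < u₀ < u₁ < v < x₀ < x₁`,
as `q → ∞`, `∑_n (∑_{d|n} ψ_d)² n⁻¹ j(n) = (1 + O(L⁻¹ log L))·(x₁+x₀-u₁-v)/(2(v-u₁))`. -/
theorem bn_sum_evaluation
    (w u₀ u₁ v x₀ x₁ : ℝ) (hw : 0 < w) (h₁ : w < u₀) (h₂ : u₀ < u₁) (h₃ : u₁ < v)
    (h₄ : v < x₀) (h₅ : x₀ < x₁) :
    ∃ C : ℝ, 0 < C ∧ ∃ q₀ : ℕ, ∀ q : ℕ, q₀ ≤ q →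
      |(∑' n : ℕ, (∑ d ∈ n.divisors, psiD q u₁ v d) ^ 2 * (n : ℝ)⁻¹ *
          jWeight q u₀ u₁ x₀ x₁ n) -
        (x₁ + x₀ - u₁ - v) / (2 * (v - u₁))|
        ≤ C * (Real.log (Real.log q) / Real.log q) *
            ((x₁ + x₀ - u₁ - v) / (2 * (v - u₁))) := by
  exact bn_main w u₀ u₁ v x₀ x₁ hw h₁ h₂ h₃ h₄ h₅
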